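/- Assume τ ≤ min{1/(63σu_-^2), 8/7785}. There exist positive constants δ_0 and ε_3 such that if δ_R = δ_S^2, δ_S ≤ δ_0, and sup_{0 ≤ t ≤ T}(‖φ(t,·)‖_{H^2} + √τ‖r(t,·)‖_{H^2}) ≤ ε_3, then there exists C > 0 such that for all t ∈ [0,T], writing E_k[g](t) = Σ_{i=1}^{2} ∫_ℝ |∂_ξ^i g(t,ξ)|^2 W(u^S(ξ)) dξ, N_∞ = sup_{[0,T]×ℝ}|φ|, N'_∞ = sup_{[0,T]×ℝ}|∂_ξφ|, and A_1 = C δ_R + C N_∞: E_k[φ^{-X}](t) + τ E_k[r^{-X}](t) + ∫_0^t E_k[r^{-X}](s) ds ≤ C u_m^2 (Σ_{i=1}^{2} ∫_ℝ |∂_ξ^i φ(0,ξ)|^2 dξ + Σ_{i=1}^{2} ∫_ℝ |∂_ξ^i r(0,ξ)|^2 dξ) + (u_m^2/27) ∫_0^t |Ẋ(s)|^2 ds + (C u_m^3 + C δ_R) ∫_0^t ∫_ℝ (φ^{-X})^2 W(u^S) ∂_ζ ũ^R dξ ds + (C u_m^3 + A_1) u_m^2 ∫_0^t ∫_ℝ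 (φ^{-X})^2 (u^S)' dξ ds + (C u_m^2 + A_1 + C N'_∞) ∫_0^t E_k[φ^{-X}](s) ds + C u_m^2 δ_R^{1/6}. -/

import Mathlib

open Filter MeasureTheory

noncomputable section

/-- The weight function of the paper. -/
def W (um : ℝ) (s : ℝ) : ℝ :=
  if s < 0 then (5 / 2) * um * (um - s)
  else if s < um / 2 then (5 / (2 * um ^ 2)) * (um - s) * (4 * s ^ 3 + um ^ 3)
  else (15 / 8) * um ^ 2

/-- A degenerate viscous Oleinik shock profile for the cubic flux, connecting
`u₋ = -2 u_m` (at `-∞`) to `u_m` (at `+∞`), with speed `σ = 3 u_m²`. -/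
def IsShockProfile (um τ : ℝ) (uS : ℝ → ℝ) : Prop :=
  ContDiff ℝ (⊤ : ℕ∞) uS ∧
  (∀ ξ, -2 * um < uS ξ ∧ uS ξ < um) ∧
  (∀ ξ, deriv uS ξ =
      (uS ξ - (-2 * um)) * (uS ξ - um) ^ 2
        / (1 + 3 * τ * (3 * um ^ 2) * ((uS ξ) ^ 2 - um ^ 2))) ∧
  Tendsto uS atBot (nhds (-2 * um)) ∧
  Tendsto uS atTop (nhds um)

/-- The smooth solution of Burgers' equation with tanh initial data joining the
speeds `σ` and `λ₊`. -/
def BurgersSol (lamPlus σ : ℝ) (wR : ℝ → ℝ → ℝ) : Prop :=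
  ContDiff ℝ (⊤ : ℕ∞) (fun p : ℝ × ℝ => wR p.1 p.2) ∧
  (∀ t x : ℝ, 0 ≤ t →
    deriv (fun s => wR s x) t + wR t x * deriv (fun y => wR t y) x = 0) ∧
  (∀ x : ℝ, wR 0 x = (lamPlus + σ) / 2 + ((lamPlus - σ) / 2) * Real.tanh x)

/-- The shifted approximate rarefaction wave in the moving frame:
`ũ^R(t,ζ) = u^R(1+t, ζ + σt)`, where `u^R(t,x) = sqrt(w^R(t,x)/3)`. -/
def tuR (um : ℝ) (wR : ℝ → ℝ → ℝ) (t ζ : ℝ) : ℝ :=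
  Real.sqrt (wR (1 + t) (ζ + 3 * um ^ 2 * t) / 3)

/-- The heat-flux shock profile `q^S(ξ) = (u^S(ξ))³ - u₋³ - σ(u^S(ξ) - u₋)`. -/
def qS (um : ℝ) (uS : ℝ → ℝ) (ξ : ℝ) : ℝ :=
  (uS ξ) ^ 3 - (-2 * um) ^ 3 - 3 * um ^ 2 * (uS ξ - (-2 * um))

/-- The composite-wave ansatz `ũ(t,ζ) = u^S(ζ) + ũ^R(t,ζ) - u_m`. -/
def tu (um : ℝ) (uS : ℝ → ℝ) (wR : ℝ → ℝ → ℝ) (t ζ : ℝ) : ℝ :=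
  uS ζ + tuR um wR t ζ - um

/-- The flux ansatz `q̃(t,ζ) = q^S(ζ) + ∂_ζ ũ^R(t,ζ)`. -/
def tq (um : ℝ) (uS : ℝ → ℝ) (wR : ℝ → ℝ → ℝ) (t ζ : ℝ) : ℝ :=
  qS um uS ζ + deriv (tuR um wR t) ζ

/-- The error term `F(t,ζ) = ∂_ζ[ũ³ - (u^S)³ - (ũ^R)³] - ∂_ζ² ũ^R`. -/
def Ferr (um : ℝ) (uS : ℝ → ℝ) (wR : ℝ → ℝ → ℝ) (t ζ : ℝ) : ℝ :=
  deriv (fun z => (tu um uS wR t z) ^ 3 - (uS z) ^ 3 - (tuR um wR t z) ^ 3) ζ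
    - iteratedDeriv 2 (tuR um wR t) ζ

/-- The squared `H^k(ℝ)` norm, `‖g‖²_{H^k} = Σ_{i=0}^{k} ∫ |∂^i g|²`. -/
def HnormSq (k : ℕ) (g : ℝ → ℝ) : ℝ :=
  ∑ i ∈ Finset.range (k + 1), ∫ ξ : ℝ, (iteratedDeriv i g ξ) ^ 2

/-- A perturbation solution `(φ, r)` on `[0,T]` with shift `X`: smooth, with
`φ(t,·), r(t,·) ∈ H²`, solving the shifted perturbation system, where `X` solves the
a-contraction shift ODE. -/
def PerturbSol (um τ T : ℝ) (uS : ℝ → ℝ) (wR φ r : ℝ → ℝ → ℝ) (X : ℝ → ℝ) : Prop :=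
  ContDiff ℝ (⊤ : ℕ∞) (fun p : ℝ × ℝ => φ p.1 p.2) ∧
  ContDiff ℝ (⊤ : ℕ∞) (fun p : ℝ × ℝ => r p.1 p.2) ∧
  (∀ t ∈ Set.Icc 0 T, ∀ i ≤ 2,
    Integrable (fun ξ : ℝ => (iteratedDeriv i (φ t) ξ) ^ 2) ∧
    Integrable (fun ξ : ℝ => (iteratedDeriv i (r t) ξ) ^ 2)) ∧
  X 0 = 0 ∧
  (∀ t : ℝ, HasDerivAt X ((32 / (25 * um ^ 2)) *
      ∫ ξ : ℝ, φ t ξ * W um (uS (ξ + X t)) * deriv uS (ξ + X t)) t) ∧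
  (∀ t ∈ Set.Icc 0 T, ∀ ξ : ℝ,
    deriv (fun s => φ s ξ) t - 3 * um ^ 2 * deriv (φ t) ξ
      + deriv (fun y => (φ t y + tu um uS wR t (y + X t)) ^ 3
          - (tu um uS wR t (y + X t)) ^ 3) ξ
      + deriv X t * (deriv uS (ξ + X t) + deriv (tuR um wR t) (ξ + X t))
      - deriv (r t) ξ
      = - Ferr um uS wR t (ξ + X t)) ∧
  (∀ t ∈ Set.Icc 0 T, ∀ ξ : ℝ,
    τ * deriv (fun s => r s ξ) t - τ * (3 * um ^ 2) * deriv (r t) ξ + r t ξ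
      - deriv (φ t) ξ
      + τ * deriv X t * deriv (tq um uS wR t) (ξ + X t)
      + τ * deriv (fun s => deriv (tuR um wR s) (ξ + X t)) t = 0)

/-- Shift of a time-dependent function by `-X(t)`: `g^{-X}(t,ξ) = g(t, ξ - X(t))`. -/
def shiftNeg (g : ℝ → ℝ → ℝ) (X : ℝ → ℝ) (t ξ : ℝ) : ℝ := g t (ξ - X t)

/-- The weighted higher-order energy `Σ_{i=1}^{2} ∫ |∂_ξ^i g|² W(u^S) dξ`. -/
def EW (um : ℝ) (uS : ℝ → ℝ) (g : ℝ → ℝ) : ℝ :=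
  (∫ ξ : ℝ, (deriv g ξ) ^ 2 * W um (uS ξ))
    + ∫ ξ : ℝ, (iteratedDeriv 2 g ξ) ^ 2 * W um (uS ξ)

noncomputable section

open scoped ContDiff

/-- Space derivative. -/
def dx (f : ℝ → ℝ → ℝ) (t x : ℝ) : ℝ := deriv (f t) x

/-- Time derivative. -/
def dt (f : ℝ → ℝ → ℝ) (t x : ℝ) : ℝ := deriv (fun s => f s x) t

/-- Joint smoothness on a set. -/
def SmoothOn (U : Set (ℝ × ℝ)) (f : ℝ → ℝ → ℝ) : Prop :=
  ContDiffOn ℝ ∞ (fun p : ℝ × ℝ => f p.1 p.2) U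

lemma SmoothOn.diffAt {U : Set (ℝ × ℝ)} {f : ℝ → ℝ → ℝ} (hU : IsOpen U) (h : SmoothOn U f)
    {t x : ℝ} (hp : (t, x) ∈ U) :
    DifferentiableAt ℝ (fun p : ℝ × ℝ => f p.1 p.2) (t, x) :=
  (h.contDiffAt (hU.mem_nhds hp)).differentiableAt (by simp)

lemma SmoothOn.hasDerivAt_x' {U : Set (ℝ × ℝ)} {f : ℝ → ℝ → ℝ} (hU : IsOpen U) (h : SmoothOn U f)
    {t x : ℝ} (hp : (t, x) ∈ U) :
    HasDerivAt (f t) (fderiv ℝ (fun p : ℝ × ℝ => f p.1 p.2) (t, x) (0, 1)) x := by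
  have h1 := (h.diffAt hU hp).hasFDerivAt
  have h2 : HasDerivAt (fun y : ℝ => (t, y)) ((0 : ℝ), (1 : ℝ)) x :=
    (hasDerivAt_const x t).prodMk (hasDerivAt_id x)
  exact h1.comp_hasDerivAt x h2

lemma SmoothOn.hasDerivAt_t' {U : Set (ℝ × ℝ)} {f : ℝ → ℝ → ℝ} (hU : IsOpen U) (h : SmoothOn U f)
    {t x : ℝ} (hp : (t, x) ∈ U) :
    HasDerivAt (fun s => f s x) (fderiv ℝ (fun p : ℝ × ℝ => f p.1 p.2) (t, x) (1, 0)) t := by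
  have h1 := (h.diffAt hU hp).hasFDerivAt
  have h2 : HasDerivAt (fun s : ℝ => (s, x)) ((1 : ℝ), (0 : ℝ)) t :=
    (hasDerivAt_id t).prodMk (hasDerivAt_const t x)
  exact h1.comp_hasDerivAt t h2

lemma SmoothOn.hasDerivAt_x {U : Set (ℝ × ℝ)} {f : ℝ → ℝ → ℝ} (hU : IsOpen U) (h : SmoothOn U f)
    {t x : ℝ} (hp : (t, x) ∈ U) : HasDerivAt (f t) (dx f t x) x :=
  (h.hasDerivAt_x' hU hp).differentiableAt.hasDerivAt

lemma SmoothOn.hasDerivAt_t {U : Set (ℝ × ℝ)} {f : ℝ → ℝ → ℝ} (hU : IsOpen U) (h : SmoothOn U f)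
    {t x : ℝ} (hp : (t, x) ∈ U) : HasDerivAt (fun s => f s x) (dt f t x) t :=
  (h.hasDerivAt_t' hU hp).differentiableAt.hasDerivAt

lemma SmoothOn.dx_eq {U : Set (ℝ × ℝ)} {f : ℝ → ℝ → ℝ} (hU : IsOpen U) (h : SmoothOn U f)
    {t x : ℝ} (hp : (t, x) ∈ U) :
    dx f t x = fderiv ℝ (fun p : ℝ × ℝ => f p.1 p.2) (t, x) (0, 1) :=
  (h.hasDerivAt_x' hU hp).deriv

lemma SmoothOn.dt_eq {U : Set (ℝ × ℝ)} {f : ℝ → ℝ → ℝ} (hU : IsOpen U) (h : SmoothOn U f)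
    {t x : ℝ} (hp : (t, x) ∈ U) :
    dt f t x = fderiv ℝ (fun p : ℝ × ℝ => f p.1 p.2) (t, x) (1, 0) :=
  (h.hasDerivAt_t' hU hp).deriv

lemma SmoothOn.dx {U : Set (ℝ × ℝ)} {f : ℝ → ℝ → ℝ} (hU : IsOpen U) (h : SmoothOn U f) :
    SmoothOn U (dx f) := by
  have h1 : ContDiffOn ℝ ∞ (fderiv ℝ (fun p : ℝ × ℝ => f p.1 p.2)) U :=
    h.fderiv_of_isOpen hU (by simp)
  have h2 := h1.clm_apply (contDiffOn_const (c := ((0 : ℝ), (1 : ℝ))))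
  refine h2.congr ?_
  rintro ⟨t, x⟩ hp
  exact h.dx_eq hU hp

lemma SmoothOn.dt {U : Set (ℝ × ℝ)} {f : ℝ → ℝ → ℝ} (hU : IsOpen U) (h : SmoothOn U f) :
    SmoothOn U (dt f) := by
  have h1 : ContDiffOn ℝ ∞ (fderiv ℝ (fun p : ℝ × ℝ => f p.1 p.2)) U :=
    h.fderiv_of_isOpen hU (by simp)
  have h2 := h1.clm_apply (contDiffOn_const (c := ((1 : ℝ), (0 : ℝ))))
  refine h2.congr ?_
  rintro ⟨t, x⟩ hp
  exact h.dt_eq hU hp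

lemma SmoothOn.comm {U : Set (ℝ × ℝ)} {f : ℝ → ℝ → ℝ} (hU : IsOpen U) (h : SmoothOn U f)
    {t x : ℝ} (hp : (t, x) ∈ U) : _root_.dt (_root_.dx f) t x = _root_.dx (_root_.dt f) t x := by
  set F : ℝ × ℝ → ℝ := fun p => f p.1 p.2 with hF
  have h1 : ContDiffOn ℝ ∞ (fderiv ℝ F) U := h.fderiv_of_isOpen hU (by simp)
  have h1d : DifferentiableAt ℝ (fderiv ℝ F) (t, x) :=
    (h1.contDiffAt (hU.mem_nhds hp)).differentiableAt (by simp)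
  have hsym : IsSymmSndFDerivAt ℝ F (t, x) :=
    (h.contDiffAt (hU.mem_nhds hp)).isSymmSndFDerivAt (by simpa using (ENat.LEInfty.out : (2 : ℕ∞ω) ≤ ∞))
  have e1 := (h.dx hU).dt_eq hU hp
  have e2 := (h.dt hU).dx_eq hU hp
  rw [e1, e2]
  have c1 : (fun p : ℝ × ℝ => _root_.dx f p.1 p.2) =ᶠ[nhds (t, x)]
      fun p => fderiv ℝ F p (0, 1) := by
    filter_upwards [hU.mem_nhds hp] with p hp'
    exact h.dx_eq hU hp'
  have c2 : (fun p : ℝ × ℝ => _root_.dt f p.1 p.2) =ᶠ[nhds (t, x)]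
      fun p => fderiv ℝ F p (1, 0) := by
    filter_upwards [hU.mem_nhds hp] with p hp'
    exact h.dt_eq hU hp'
  rw [c1.fderiv_eq, c2.fderiv_eq]
  have d1 := (h1d.hasFDerivAt.clm_apply (hasFDerivAt_const ((0 : ℝ), (1 : ℝ)) (t, x))).fderiv
  have d2 := (h1d.hasFDerivAt.clm_apply (hasFDerivAt_const ((1 : ℝ), (0 : ℝ)) (t, x))).fderiv
  rw [d1, d2]
  simpa using hsym (1, 0) (0, 1)

lemma SmoothOn.contOn {U : Set (ℝ × ℝ)} {f : ℝ → ℝ → ℝ} (h : SmoothOn U f) :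
    ContinuousOn (fun p : ℝ × ℝ => f p.1 p.2) U := ContDiffOn.continuousOn h

/-- Chain rule along a shift. -/
lemma SmoothOn.hasDerivAt_shift {U : Set (ℝ × ℝ)} {f : ℝ → ℝ → ℝ} (hU : IsOpen U)
    (h : SmoothOn U f) {X : ℝ → ℝ} {Y t ξ : ℝ} (hX : HasDerivAt X Y t)
    (hp : (t, ξ + X t) ∈ U) :
    HasDerivAt (fun s => f s (ξ + X s))
      (_root_.dt f t (ξ + X t) + Y * _root_.dx f t (ξ + X t)) t := by
  have h1 := (h.diffAt hU hp).hasFDerivAt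
  have h2 : HasDerivAt (fun s : ℝ => (s, ξ + X s)) ((1 : ℝ), Y) t :=
    (hasDerivAt_id t).prodMk (hX.const_add ξ)
  have h3 := h1.comp_hasDerivAt t h2
  rw [h.dt_eq hU hp, h.dx_eq hU hp]
  have : ((1 : ℝ), Y) = (1, 0) + Y • ((0 : ℝ), (1 : ℝ)) := by simp
  rw [this, map_add, map_smul, smul_eq_mul] at h3
  exact h3

lemma dx_dx_eq (f : ℝ → ℝ → ℝ) (t x : ℝ) : dx (dx f) t x = iteratedDeriv 2 (f t) x := by
  rw [iteratedDeriv_succ, iteratedDeriv_one]; rfl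

lemma dx_eq_deriv (f : ℝ → ℝ → ℝ) (t : ℝ) : dx f t = deriv (f t) := rfl

end

noncomputable section

open scoped ContDiff

/-! ### The weight -/

lemma hasDerivAt_glue {g h g' h' : ℝ → ℝ} {c : ℝ} (hg : ∀ s, HasDerivAt g (g' s) s)
    (hh : ∀ s, HasDerivAt h (h' s) s) (h0 : g c = h c) (h1 : g' c = h' c) (s : ℝ) :
    HasDerivAt (fun s => if s < c then g s else h s) (if s < c then g' s else h' s) s := by
  rcases lt_trichotomy s c with hs | hs | hs
  · rw [if_pos hs]
    refine (hg s).congr_of_eventuallyEq ?_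
    filter_upwards [Iio_mem_nhds hs] with y hy
    exact if_pos hy
  · subst hs
    rw [if_neg (lt_irrefl _)]
    have e1 : HasDerivWithinAt (fun y => if y < s then g y else h y) (h' s) (Set.Iic s) s := by
      rw [← h1]
      refine (hg s).hasDerivWithinAt.congr ?_ ?_
      · intro y hy
        rcases lt_or_eq_of_le (show y ≤ s from hy) with h | h
        · exact if_pos h
        · subst h; simp [h0]
      · simp [h0]
    have e2 : HasDerivWithinAt (fun y => if y < s then g y else h y) (h' s) (Set.Ici s) s := by
      refine (hh s).hasDerivWithinAt.congr ?_ ?_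
      · intro y hy
        exact if_neg (not_lt.mpr hy)
      · simp
    have := e1.union e2
    rw [Set.Iic_union_Ici] at this
    exact hasDerivWithinAt_univ.mp this
  · rw [if_neg (not_lt.mpr hs.le)]
    refine (hh s).congr_of_eventuallyEq ?_
    filter_upwards [Ioi_mem_nhds hs] with y hy
    exact if_neg (not_lt.mpr (le_of_lt hy))

/-- The derivative of the weight. -/
def Wd (m s : ℝ) : ℝ :=
  if s < 0 then -((5 / 2) * m)
  else if s < m / 2 then -(5 / (2 * m ^ 2)) * (2 * s - m) ^ 2 * (4 * s + m)
  else 0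

lemma W_hasDerivAt {m : ℝ} (hm : 0 < m) (s : ℝ) : HasDerivAt (W m) (Wd m s) s := by
  have hm2 : (0:ℝ) < m / 2 := by positivity
  have A : ∀ s, HasDerivAt (fun s => (5 / 2) * m * (m - s)) (-((5 / 2) * m)) s := by
    intro s
    have := ((hasDerivAt_id s).const_sub m).const_mul ((5 / 2) * m)
    exact this.congr_deriv (by ring)
  have B : ∀ s, HasDerivAt (fun s => (5 / (2 * m ^ 2)) * (m - s) * (4 * s ^ 3 + m ^ 3))
      (-(5 / (2 * m ^ 2)) * (2 * s - m) ^ 2 * (4 * s + m)) s := by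
    intro s
    have h1 := ((hasDerivAt_id s).const_sub m).const_mul (5 / (2 * m ^ 2))
    have h2 := (((hasDerivAt_id s).pow 3).const_mul 4).add_const (m ^ 3)
    have := h1.mul h2
    exact this.congr_deriv (by simp; ring)
  have C : ∀ s, HasDerivAt (fun _ : ℝ => (15 / 8) * m ^ 2) 0 s := fun s => hasDerivAt_const _ _
  have BC := hasDerivAt_glue (c := m / 2) B C (by field_simp; ring) (by ring)
  have := hasDerivAt_glue (c := 0) A BC (by rw [if_pos hm2]; field_simp; ring)
    (by rw [if_pos hm2]; field_simp; ring) s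
  exact this

lemma Wd_cont {m : ℝ} (hm : 0 < m) : Continuous (Wd m) := by
  have hm2 : (0:ℝ) < m / 2 := by positivity
  have key : ∀ (g h : ℝ → ℝ) (c : ℝ), Continuous g → Continuous h → g c = h c →
      Continuous (fun s => if s < c then g s else h s) := by
    intro g h c hg hh he
    have : (fun s => if s < c then g s else h s) = fun s => if c ≤ s then h s else g s := by
      funext s
      by_cases hs : s < c
      · rw [if_pos hs, if_neg (not_le.mpr hs)]
      · rw [if_neg hs, if_pos (not_lt.mp hs)]
    rw [this]
    exact Continuous.if_le hh hg continuous_const continuous_id (by intro x hx; subst hx; exact he.symm)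
  have BC := key (fun s => -(5 / (2 * m ^ 2)) * (2 * s - m) ^ 2 * (4 * s + m)) (fun _ => 0) (m / 2)
    (by fun_prop) continuous_const (by ring)
  exact key (fun _ => -((5 / 2) * m)) _ 0 continuous_const BC
    (by rw [if_pos hm2]; field_simp; ring)

lemma W_cont {m : ℝ} (hm : 0 < m) : Continuous (W m) :=
  continuous_iff_continuousAt.mpr fun s => (W_hasDerivAt hm s).continuousAt

lemma Wd_bound {m : ℝ} (hm : 0 < m) (s : ℝ) : Wd m s ≤ 0 ∧ -((5 / 2) * m) ≤ Wd m s := by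
  unfold Wd
  split_ifs with h1 h2
  · constructor <;> nlinarith
  · push Not at h1
    have e : -(5 / (2 * m ^ 2)) * (2 * s - m) ^ 2 * (4 * s + m)
        = -((5 / (2 * m ^ 2)) * ((2 * s - m) ^ 2 * (4 * s + m))) := by ring
    rw [e]
    have hp : 0 ≤ (2 * s - m) ^ 2 * (4 * s + m) := by positivity
    have hq : (2 * s - m) ^ 2 * (4 * s + m) ≤ m ^ 3 := by nlinarith [mul_nonneg h1 h1, mul_nonneg (mul_nonneg h1 h1) hm.le, mul_nonneg (mul_nonneg h1 h1) (sub_nonneg.mpr h2.le)]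
    constructor
    · have : 0 ≤ (5 / (2 * m ^ 2)) * ((2 * s - m) ^ 2 * (4 * s + m)) := by positivity
      linarith
    · have : (5 / (2 * m ^ 2)) * ((2 * s - m) ^ 2 * (4 * s + m)) ≤ (5 / (2 * m ^ 2)) * m ^ 3 := by
        gcongr
      have e2 : (5 / (2 * m ^ 2)) * m ^ 3 = (5 / 2) * m := by field_simp
      linarith
  · constructor <;> linarith

lemma W_bound {m : ℝ} (hm : 0 < m) {s : ℝ} (h1 : -2 * m < s) (h2 : s < m) :
    (15 / 8) * m ^ 2 ≤ W m s ∧ W m s ≤ (15 / 2) * m ^ 2 := by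
  unfold W
  split_ifs with h3 h4
  · constructor <;> nlinarith
  · push Not at h3
    have e : (5 / (2 * m ^ 2)) * (m - s) * (4 * s ^ 3 + m ^ 3)
        = (15 / 8) * m ^ 2 + (10 / m ^ 2) * ((m / 2 - s) ^ 3 * (s + m / 2)) := by
      field_simp; ring
    have hp : 0 ≤ (m / 2 - s) ^ 3 * (s + m / 2) := by
      have : 0 ≤ m / 2 - s := by linarith
      positivity
    have hq : (m / 2 - s) ^ 3 * (s + m / 2) ≤ (m / 2) ^ 3 * m := by
      have : 0 ≤ m / 2 - s := by linarith
      gcongr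
      · linarith
      · linarith
    rw [e]
    constructor
    · have : 0 ≤ (10 / m ^ 2) * ((m / 2 - s) ^ 3 * (s + m / 2)) := by positivity
      linarith
    · have : (10 / m ^ 2) * ((m / 2 - s) ^ 3 * (s + m / 2)) ≤ (10 / m ^ 2) * ((m / 2) ^ 3 * m) := by
        gcongr
      have e2 : (10 / m ^ 2) * ((m / 2) ^ 3 * m) = 5 / 4 * m ^ 2 := by field_simp; ring
      nlinarith [sq_nonneg m]
  · constructor <;> nlinarith

/-! ### The shock profile -/

/-- Pointwise facts about the shock. -/
structure Shock (m τ : ℝ) (uS : ℝ → ℝ) : Prop where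
  hm : 0 < m
  hτ : 0 < τ
  hτm : τ * m ^ 4 ≤ 1 / 756
  prof : IsShockProfile m τ uS

namespace Shock
variable {m τ : ℝ} {uS : ℝ → ℝ}

lemma lo (h : Shock m τ uS) (ζ : ℝ) : -2 * m < uS ζ := (h.prof.2.1 ζ).1
lemma hi (h : Shock m τ uS) (ζ : ℝ) : uS ζ < m := (h.prof.2.1 ζ).2
lemma smooth (h : Shock m τ uS) : ContDiff ℝ ∞ uS := h.prof.1
lemma smooth1 (h : Shock m τ uS) : ContDiff ℝ ∞ (deriv uS) :=
  (contDiff_infty_iff_deriv.mp h.smooth).2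
lemma smooth2 (h : Shock m τ uS) : ContDiff ℝ ∞ (deriv (deriv uS)) :=
  (contDiff_infty_iff_deriv.mp h.smooth1).2
lemma smooth3 (h : Shock m τ uS) : ContDiff ℝ ∞ (deriv (deriv (deriv uS))) :=
  (contDiff_infty_iff_deriv.mp h.smooth2).2
lemma d1 (h : Shock m τ uS) (ζ : ℝ) : HasDerivAt uS (deriv uS ζ) ζ :=
  (h.smooth.differentiable (by simp) ζ).hasDerivAt
lemma d2 (h : Shock m τ uS) (ζ : ℝ) : HasDerivAt (deriv uS) (deriv (deriv uS) ζ) ζ :=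
  (h.smooth1.differentiable (by simp) ζ).hasDerivAt
lemma d3 (h : Shock m τ uS) (ζ : ℝ) :
    HasDerivAt (deriv (deriv uS)) (deriv (deriv (deriv uS)) ζ) ζ :=
  (h.smooth2.differentiable (by simp) ζ).hasDerivAt

lemma sq_bd (h : Shock m τ uS) (ζ : ℝ) : -m ^ 2 ≤ (uS ζ) ^ 2 - m ^ 2 ∧ (uS ζ) ^ 2 - m ^ 2 ≤ 3 * m ^ 2 := by
  have := h.lo ζ; have := h.hi ζ; have := h.hm
  constructor <;> nlinarith [sq_nonneg (uS ζ)]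

lemma Dn_bd (h : Shock m τ uS) (ζ : ℝ) :
    0.98 ≤ 1 + 9 * τ * m ^ 2 * ((uS ζ) ^ 2 - m ^ 2) ∧
    1 + 9 * τ * m ^ 2 * ((uS ζ) ^ 2 - m ^ 2) ≤ 1.04 := by
  obtain ⟨h1, h2⟩ := h.sq_bd ζ
  have h3 := h.hτm
  have h4 : 0 ≤ τ * m ^ 2 := mul_nonneg h.hτ.le (sq_nonneg m)
  have h5 := mul_le_mul_of_nonneg_left h1 h4
  have h6 := mul_le_mul_of_nonneg_left h2 h4
  constructor <;> nlinarith

lemma ode (h : Shock m τ uS) (ζ : ℝ) :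
    (1 + 9 * τ * m ^ 2 * ((uS ζ) ^ 2 - m ^ 2)) * deriv uS ζ
      = (uS ζ + 2 * m) * (m - uS ζ) ^ 2 := by
  have h1 := h.prof.2.2.1 ζ
  have h2 := (h.Dn_bd ζ).1
  have e : 1 + 3 * τ * (3 * m ^ 2) * ((uS ζ) ^ 2 - m ^ 2)
    = 1 + 9 * τ * m ^ 2 * ((uS ζ) ^ 2 - m ^ 2) := by ring
  rw [e] at h1
  rw [h1]
  have : (1 + 9 * τ * m ^ 2 * ((uS ζ) ^ 2 - m ^ 2)) ≠ 0 := by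
    intro h0; rw [h0] at h2; norm_num at h2
  rw [mul_div_cancel₀ _ this]; ring

lemma pos (h : Shock m τ uS) (ζ : ℝ) : 0 < deriv uS ζ := by
  have h1 := h.ode ζ
  have h2 := (h.Dn_bd ζ).1
  have h3 : 0 < (uS ζ + 2 * m) * (m - uS ζ) ^ 2 := by
    have := h.lo ζ; have := h.hi ζ
    have : 0 < uS ζ + 2 * m := by linarith
    have : 0 < m - uS ζ := by linarith
    positivity
  rw [← h1] at h3
  exact pos_of_mul_pos_right h3 (by linarith)

/-- `a₁` compared to the cubic. -/
lemma cmp (h : Shock m τ uS) (ζ : ℝ) :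
    deriv uS ζ ≤ 1.03 * ((uS ζ + 2 * m) * (m - uS ζ) ^ 2) ∧
    (uS ζ + 2 * m) * (m - uS ζ) ^ 2 ≤ 1.04 * deriv uS ζ := by
  have h1 := h.ode ζ
  obtain ⟨h2, h3⟩ := h.Dn_bd ζ
  have h4 := h.pos ζ
  constructor <;> nlinarith

lemma le5 (h : Shock m τ uS) (ζ : ℝ) : deriv uS ζ ≤ 5 * m ^ 3 := by
  have h1 := (h.cmp ζ).1
  have h2 : (uS ζ + 2 * m) * (m - uS ζ) ^ 2 ≤ 4 * m ^ 3 := by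
    have := h.lo ζ; have := h.hi ζ; have := h.hm
    have : 0 ≤ (2 * m - uS ζ) * (uS ζ + m) ^ 2 := by
      apply mul_nonneg; linarith; positivity
    nlinarith
  have := pow_pos h.hm 3
  linarith

lemma ode2 (h : Shock m τ uS) (ζ : ℝ) :
    (1 + 9 * τ * m ^ 2 * ((uS ζ) ^ 2 - m ^ 2)) * deriv (deriv uS) ζ
      = (3 * (uS ζ) ^ 2 - 3 * m ^ 2) * deriv uS ζ - 18 * τ * m ^ 2 * uS ζ * (deriv uS ζ) ^ 2 := by
  have hl : HasDerivAt (fun ζ => (1 + 9 * τ * m ^ 2 * ((uS ζ) ^ 2 - m ^ 2)) * deriv uS ζ)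
      _ ζ := ((((((h.d1 ζ).pow 2).sub_const (m ^ 2)).const_mul (9 * τ * m ^ 2)).const_add 1)).mul (h.d2 ζ)
  have hr : HasDerivAt (fun ζ => (uS ζ + 2 * m) * (m - uS ζ) ^ 2) _ ζ :=
    ((h.d1 ζ).add_const (2 * m)).mul (((h.d1 ζ).const_sub m).pow 2)
  have e : (fun ζ => (1 + 9 * τ * m ^ 2 * ((uS ζ) ^ 2 - m ^ 2)) * deriv uS ζ)
    = (fun ζ => (uS ζ + 2 * m) * (m - uS ζ) ^ 2) := funext h.ode
  rw [e] at hl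
  have := hl.unique hr
  simp at this
  linear_combination this

lemma ode3 (h : Shock m τ uS) (ζ : ℝ) :
    (1 + 9 * τ * m ^ 2 * ((uS ζ) ^ 2 - m ^ 2)) * deriv (deriv (deriv uS)) ζ
      = 6 * uS ζ * (deriv uS ζ) ^ 2 + (3 * (uS ζ) ^ 2 - 3 * m ^ 2) * deriv (deriv uS) ζ
        - 18 * τ * m ^ 2 * ((deriv uS ζ) ^ 3 + 3 * uS ζ * deriv uS ζ * deriv (deriv uS) ζ) := by
  have hl : HasDerivAt (fun ζ => (1 + 9 * τ * m ^ 2 * ((uS ζ) ^ 2 - m ^ 2)) * deriv (deriv uS) ζ)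
      _ ζ := ((((((h.d1 ζ).pow 2).sub_const (m ^ 2)).const_mul (9 * τ * m ^ 2)).const_add 1)).mul (h.d3 ζ)
  have hr : HasDerivAt (fun ζ => (3 * (uS ζ) ^ 2 - 3 * m ^ 2) * deriv uS ζ - 18 * τ * m ^ 2 * uS ζ * (deriv uS ζ) ^ 2) _ ζ :=
    (((((h.d1 ζ).pow 2).const_mul 3).sub_const (3 * m ^ 2)).mul (h.d2 ζ)).sub
      (((h.d1 ζ).const_mul (18 * τ * m ^ 2)).mul ((h.d2 ζ).pow 2))
  have e := funext h.ode2
  rw [e] at hl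
  have := hl.unique hr
  simp at this
  linear_combination this

lemma a2_bd (h : Shock m τ uS) (ζ : ℝ) : |deriv (deriv uS) ζ| ≤ 10 * m ^ 2 * deriv uS ζ := by
  have e := h.ode2 ζ
  have hp := h.pos ζ
  have h5 := h.le5 ζ
  obtain ⟨hd, -⟩ := h.Dn_bd ζ
  obtain ⟨s1, s2⟩ := h.sq_bd ζ
  set D := 1 + 9 * τ * m ^ 2 * ((uS ζ) ^ 2 - m ^ 2)
  set a1 := deriv uS ζ
  set a2 := deriv (deriv uS) ζ
  have hm := h.hm
  have ha : |uS ζ| ≤ 2 * m := abs_le.mpr ⟨by linarith [h.lo ζ], by linarith [h.hi ζ]⟩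
  have k1 : |D * a2| ≤ (9.5 * m ^ 2) * a1 := by
    rw [e]
    have e2 : (3 * (uS ζ) ^ 2 - 3 * m ^ 2) * a1 - 18 * τ * m ^ 2 * uS ζ * a1 ^ 2
      = (3 * ((uS ζ) ^ 2 - m ^ 2) - 18 * (τ * m ^ 2) * (uS ζ * a1)) * a1 := by ring
    rw [e2, abs_mul, abs_of_pos hp]
    refine mul_le_mul_of_nonneg_right ?_ hp.le
    have k2 : |18 * (τ * m ^ 2) * (uS ζ * a1)| ≤ 0.3 * m ^ 2 := by
      have hq : 0 ≤ τ * m ^ 2 := mul_nonneg h.hτ.le (sq_nonneg m)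
      rw [abs_mul, abs_mul 18, abs_mul (uS ζ), abs_of_nonneg hq, abs_of_pos hp]
      calc |(18:ℝ)| * (τ * m ^ 2) * (|uS ζ| * a1) ≤ |(18:ℝ)| * (τ * m ^ 2) * ((2 * m) * (5 * m ^ 3)) := by
            gcongr
        _ = 180 * (τ * m ^ 4) * m ^ 2 := by rw [abs_of_pos (by norm_num : (0:ℝ) < 18)]; ring
        _ ≤ 180 * (1 / 756) * m ^ 2 := by gcongr; exact h.hτm
        _ ≤ _ := by nlinarith [sq_nonneg m]
    have k3 := abs_le.mp k2
    rw [abs_le]; constructor <;> nlinarith [k3.1, k3.2]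
  rw [abs_mul, abs_of_pos (by linarith)] at k1
  have : 0.98 * |a2| ≤ D * |a2| := mul_le_mul_of_nonneg_right hd (abs_nonneg _)
  have : 0 ≤ m ^ 2 * a1 := by positivity
  linarith

lemma a3_bd (h : Shock m τ uS) (ζ : ℝ) : |deriv (deriv (deriv uS)) ζ| ≤ 200 * m ^ 4 * deriv uS ζ := by
  have e := h.ode3 ζ
  have hp := h.pos ζ
  have h5 := h.le5 ζ
  have h2 := h.a2_bd ζ
  obtain ⟨hd, -⟩ := h.Dn_bd ζ
  obtain ⟨s1, s2⟩ := h.sq_bd ζ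
  set D := 1 + 9 * τ * m ^ 2 * ((uS ζ) ^ 2 - m ^ 2)
  set a1 := deriv uS ζ
  set a2 := deriv (deriv uS) ζ
  set a3 := deriv (deriv (deriv uS)) ζ
  have hm := h.hm
  have ha : |uS ζ| ≤ 2 * m := abs_le.mpr ⟨by linarith [h.lo ζ], by linarith [h.hi ζ]⟩
  have hq : 0 ≤ τ * m ^ 2 := mul_nonneg h.hτ.le (sq_nonneg m)
  have hs : |(uS ζ) ^ 2 - m ^ 2| ≤ 3 * m ^ 2 := abs_le.mpr ⟨by nlinarith, s2⟩
  have k1 : |6 * uS ζ * a1 ^ 2| ≤ 60 * m ^ 4 * a1 := by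
    rw [abs_mul, abs_mul, abs_of_pos (by norm_num : (0:ℝ) < 6), abs_of_nonneg (sq_nonneg a1)]
    calc 6 * |uS ζ| * a1 ^ 2 = 6 * |uS ζ| * a1 * a1 := by ring
      _ ≤ 6 * (2 * m) * (5 * m ^ 3) * a1 := by gcongr
      _ = _ := by ring
  have k2 : |(3 * (uS ζ) ^ 2 - 3 * m ^ 2) * a2| ≤ 90 * m ^ 4 * a1 := by
    have : (3 * (uS ζ) ^ 2 - 3 * m ^ 2) = 3 * ((uS ζ) ^ 2 - m ^ 2) := by ring
    rw [this, abs_mul, abs_mul, abs_of_pos (by norm_num : (0:ℝ) < 3)]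
    calc 3 * |(uS ζ) ^ 2 - m ^ 2| * |a2| ≤ 3 * (3 * m ^ 2) * (10 * m ^ 2 * a1) := by gcongr
      _ = _ := by ring
  have k3 : |a1 ^ 3| ≤ 25 * m ^ 6 * a1 := by
    rw [abs_of_pos (by positivity)]
    calc a1 ^ 3 = a1 * a1 * a1 := by ring
      _ ≤ (5 * m ^ 3) * (5 * m ^ 3) * a1 := by gcongr
      _ = _ := by ring
  have k4 : |3 * uS ζ * a1 * a2| ≤ 300 * m ^ 6 * a1 := by
    rw [abs_mul, abs_mul, abs_mul, abs_of_pos (by norm_num : (0:ℝ) < 3), abs_of_pos hp]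
    calc 3 * |uS ζ| * a1 * |a2| ≤ 3 * (2 * m) * (5 * m ^ 3) * (10 * m ^ 2 * a1) := by gcongr
      _ = _ := by ring
  have k5 : |18 * τ * m ^ 2 * (a1 ^ 3 + 3 * uS ζ * a1 * a2)| ≤ 8 * m ^ 4 * a1 := by
    have : 18 * τ * m ^ 2 * (a1 ^ 3 + 3 * uS ζ * a1 * a2) = 18 * (τ * m ^ 2) * (a1 ^ 3 + 3 * uS ζ * a1 * a2) := by ring
    rw [this, abs_mul, abs_of_nonneg (by positivity : 0 ≤ 18 * (τ * m ^ 2))]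
    calc 18 * (τ * m ^ 2) * |a1 ^ 3 + 3 * uS ζ * a1 * a2| ≤ 18 * (τ * m ^ 2) * (25 * m ^ 6 * a1 + 300 * m ^ 6 * a1) := by
          gcongr; exact (abs_add_le _ _).trans (add_le_add k3 k4)
      _ = 5850 * (τ * m ^ 4) * (m ^ 4 * a1) := by ring
      _ ≤ 5850 * (1 / 756) * (m ^ 4 * a1) := by gcongr; exact h.hτm
      _ ≤ _ := by
        have : 0 ≤ m ^ 4 * a1 := by positivity
        linarith
  have k6 : |D * a3| ≤ 158 * m ^ 4 * a1 := by
    rw [e, abs_le]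
    have := abs_le.mp k1; have := abs_le.mp k2; have := abs_le.mp k5
    constructor <;> linarith
  rw [abs_mul, abs_of_pos (by linarith)] at k6
  have : 0.98 * |a3| ≤ D * |a3| := mul_le_mul_of_nonneg_right hd (abs_nonneg _)
  have : 0 ≤ m ^ 4 * a1 := by positivity
  linarith

lemma exists_zero (h : Shock m τ uS) : ∃ ξ₀, uS ξ₀ = 0 := by
  have hm := h.hm
  have h1 := h.prof.2.2.2.1
  have h2 := h.prof.2.2.2.2
  obtain ⟨x, hx⟩ := (h1.eventually (gt_mem_nhds (show -2 * m < 0 by linarith))).exists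
  obtain ⟨y, hy⟩ := (h2.eventually (lt_mem_nhds hm)).exists
  have := mem_range_of_exists_le_of_exists_ge h.smooth.continuous ⟨x, hx.le⟩ ⟨y, hy.le⟩
  exact this

lemma mono (h : Shock m τ uS) : StrictMono uS := strictMono_of_deriv_pos h.pos

/-- Algebraic decay of the profile. -/
lemma decay (h : Shock m τ uS) {ξ₀ : ℝ} (h0 : uS ξ₀ = 0) (ζ : ℝ) :
    (ζ - ξ₀) ^ 2 * ((uS ζ + 2 * m) * (m - uS ζ) ^ 2) ≤ 80 / m := by
  have hm := h.hm
  have lo := h.lo; have hi := h.hi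
  rcases le_total ξ₀ ζ with hz | hz
  · -- right side
    have hpos : ∀ x, 0 < m - uS x := fun x => by linarith [hi x]
    have hd : ∀ x, HasDerivAt (fun x => (m - uS x)⁻¹ - 1.9 * m * x)
        (deriv uS x / (m - uS x) ^ 2 - 1.9 * m) x := by
      intro x
      have h1 := ((h.d1 x).const_sub m).inv (hpos x).ne'
      have h2 := (hasDerivAt_id x).const_mul (1.9 * m)
      have := h1.sub h2
      exact this.congr_deriv (by simp)
    have hmono : MonotoneOn (fun x => (m - uS x)⁻¹ - 1.9 * m * x) (Set.Ici ξ₀) := by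
      apply monotoneOn_of_deriv_nonneg (convex_Ici _)
      · exact fun x _ => (hd x).continuousAt.continuousWithinAt
      · exact fun x _ => (hd x).differentiableAt.differentiableWithinAt
      · intro x hx
        rw [interior_Ici] at hx
        rw [(hd x).deriv]
        have hx0 : 0 ≤ uS x := by rw [← h0]; exact h.mono.monotone (le_of_lt hx)
        have hc := (h.cmp x).2
        rw [sub_nonneg, le_div_iff₀ (pow_pos (hpos x) 2)]
        have := pow_pos (hpos x) 2
        nlinarith [mul_nonneg hx0 this.le, mul_pos hm this]
    have := hmono (Set.self_mem_Ici) (Set.mem_Ici.mpr hz) hz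
    simp only [h0, sub_zero] at this
    have hmi : 0 < m⁻¹ := inv_pos.mpr hm
    have k : 1.9 * m * (ζ - ξ₀) ≤ (m - uS ζ)⁻¹ := by linarith
    have k2 : 1.9 * m * (ζ - ξ₀) * (m - uS ζ) ≤ 1 := by
      calc _ ≤ (m - uS ζ)⁻¹ * (m - uS ζ) := mul_le_mul_of_nonneg_right k (hpos ζ).le
        _ = 1 := inv_mul_cancel₀ (hpos ζ).ne'
    have k3 : 0 ≤ 1.9 * m * (ζ - ξ₀) * (m - uS ζ) := by
      have := sub_nonneg.mpr hz; have := (hpos ζ).le; positivity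
    have k4 : (1.9 * m * (ζ - ξ₀) * (m - uS ζ)) ^ 2 ≤ 1 := by nlinarith
    rw [le_div_iff₀ hm]
    have k5 : m ^ 2 * ((ζ - ξ₀) ^ 2 * (m - uS ζ) ^ 2) ≤ 1 := by nlinarith
    have k6 : 0 ≤ m * ((ζ - ξ₀) ^ 2 * (m - uS ζ) ^ 2) := by positivity
    nlinarith [mul_le_mul_of_nonneg_right (show uS ζ + 2 * m ≤ 3 * m by linarith [hi ζ]) k6]
  · -- left side
    set c : ℝ := 0.48 * m ^ 2 with hc
    have hd : ∀ x, HasDerivAt (fun x => (1 + c * (ξ₀ - x)) ^ 2 * (uS x + 2 * m))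
        (-(2 * c * (1 + c * (ξ₀ - x)) * (uS x + 2 * m)) + (1 + c * (ξ₀ - x)) ^ 2 * deriv uS x) x := by
      intro x
      have h1 := ((((hasDerivAt_id x).const_sub ξ₀).const_mul c).const_add 1).pow 2
      have := h1.mul ((h.d1 x).add_const (2 * m))
      exact this.congr_deriv (by simp only [Pi.pow_apply, id]; push_cast; ring)
    have hcp : 0 ≤ c := by positivity
    have hmono : MonotoneOn (fun x => (1 + c * (ξ₀ - x)) ^ 2 * (uS x + 2 * m)) (Set.Iic ξ₀) := by
      apply monotoneOn_of_deriv_nonneg (convex_Iic _)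
      · exact fun x _ => (hd x).continuousAt.continuousWithinAt
      · exact fun x _ => (hd x).differentiableAt.differentiableWithinAt
      · intro x hx
        rw [interior_Iic] at hx
        rw [(hd x).deriv]
        have hx0 : uS x ≤ 0 := by rw [← h0]; exact h.mono.monotone (le_of_lt hx)
        have hcm := (h.cmp x).2
        have hl : 0 ≤ ξ₀ - x := by linarith [show x < ξ₀ from hx]
        have hf : 0 < uS x + 2 * m := by linarith [lo x]
        have hge : m ^ 2 ≤ (m - uS x) ^ 2 := by nlinarith
        have h3 : 2 * c * (uS x + 2 * m) ≤ deriv uS x := by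
          have := mul_le_mul_of_nonneg_left hge hf.le
          nlinarith [mul_pos hf (pow_pos hm 2)]
        have h4 : 1 ≤ 1 + c * (ξ₀ - x) := by have := mul_nonneg hcp hl; linarith
        set q := 1 + c * (ξ₀ - x)
        have : 2 * c * q * (uS x + 2 * m) ≤ q * deriv uS x := by
          have := mul_le_mul_of_nonneg_left h3 (by linarith : 0 ≤ q)
          linarith
        have h6 := h.pos x
        have : q * deriv uS x ≤ q ^ 2 * deriv uS x := by
          apply mul_le_mul_of_nonneg_right _ h6.le
          nlinarith
        linarith
    have := hmono (Set.mem_Iic.mpr hz) (Set.self_mem_Iic) hz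
    simp only [h0, sub_self, mul_zero, add_zero, one_pow, zero_add, one_mul] at this
    have hl : 0 ≤ ξ₀ - ζ := by linarith
    have hf : 0 < uS ζ + 2 * m := by linarith [lo ζ]
    have k1 : (c * (ξ₀ - ζ)) ^ 2 * (uS ζ + 2 * m) ≤ 2 * m := by
      refine le_trans ?_ this
      apply mul_le_mul_of_nonneg_right _ hf.le
      have := mul_nonneg hcp hl
      nlinarith
    have k2 : m ^ 3 * ((ξ₀ - ζ) ^ 2 * (uS ζ + 2 * m)) ≤ 8.7 := by
      have e : (c * (ξ₀ - ζ)) ^ 2 * (uS ζ + 2 * m) = 0.2304 * m * (m ^ 3 * ((ξ₀ - ζ) ^ 2 * (uS ζ + 2 * m))) := by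
        rw [hc]; ring
      rw [e] at k1
      by_contra hcon
      push Not at hcon
      nlinarith
    have k3 : (m - uS ζ) ^ 2 ≤ 9 * m ^ 2 := by nlinarith [lo ζ, hi ζ]
    rw [le_div_iff₀ hm]
    have k4 : 0 ≤ m * ((ξ₀ - ζ) ^ 2 * (uS ζ + 2 * m)) := by positivity
    nlinarith [mul_le_mul_of_nonneg_right k3 k4]

end Shock
end

noncomputable section

open scoped ContDiff

/-! ### Small absolute value calculus -/

lemma bA {x y a b : ℝ} (hx : |x| ≤ a) (hy : |y| ≤ b) : |x + y| ≤ a + b :=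
  (abs_add_le x y).trans (add_le_add hx hy)

lemma bS {x y a b : ℝ} (hx : |x| ≤ a) (hy : |y| ≤ b) : |x - y| ≤ a + b :=
  (abs_sub x y).trans (add_le_add hx hy)

lemma bM {x y a b : ℝ} (hx : |x| ≤ a) (hy : |y| ≤ b) : |x * y| ≤ a * b := by
  rw [abs_mul]; exact mul_le_mul hx hy (abs_nonneg y) ((abs_nonneg x).trans hx)

lemma bC (c : ℝ) {x a : ℝ} (hx : |x| ≤ a) : |c * x| ≤ |c| * a := by
  rw [abs_mul]; exact mul_le_mul_of_nonneg_left hx (abs_nonneg c)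

/-! ### Rarefaction wave -/

/-- Characteristics for Burgers. -/
lemma burgers_char {w : ℝ → ℝ → ℝ} (hw : ContDiff ℝ ∞ (fun p : ℝ × ℝ => w p.1 p.2))
    (hB : ∀ t x : ℝ, 0 ≤ t → deriv (fun s => w s x) t + w t x * deriv (fun y => w t y) x = 0)
    {t : ℝ} (ht : 0 ≤ t) (x : ℝ) : w t x = w 0 (x - t * w t x) := by
  set v := w t x with hv
  have hs : SmoothOn Set.univ w := hw.contDiffOn
  have hU : IsOpen (Set.univ : Set (ℝ × ℝ)) := isOpen_univ
  have hX : ∀ s, HasDerivAt (fun s => v * (s - t)) v s := by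
    intro s
    have := ((hasDerivAt_id s).sub_const t).const_mul v
    exact this.congr_deriv (by ring)
  set p : ℝ → ℝ := fun s => dx w s (x + v * (s - t)) with hp
  have hpc : Continuous p := by
    have h1 : Continuous (fun q : ℝ × ℝ => dx w q.1 q.2) :=
      continuousOn_univ.mp ((hs.dx hU).contOn)
    exact h1.comp (by fun_prop : Continuous fun s : ℝ => (s, x + v * (s - t)))
  set A : ℝ → ℝ := fun s => ∫ u in (0:ℝ)..s, p u with hA
  have hAd : ∀ s, HasDerivAt A (p s) s := fun s =>
    intervalIntegral.integral_hasDerivAt_right (hpc.intervalIntegrable _ _)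
      (hpc.stronglyMeasurableAtFilter _ _) hpc.continuousAt
  have hZ : ∀ s, 0 ≤ s → HasDerivAt (fun s => (w s (x + v * (s - t)) - v) * Real.exp (A s)) 0 s := by
    intro s hs0
    have h1 := (hs.hasDerivAt_shift (ξ := x) hU (hX s) (by simp)).sub_const v
    have h2 := (hAd s).exp
    refine (h1.mul h2).congr_deriv ?_
    have := hB s (x + v * (s - t)) hs0
    have e1 : dt w s (x + v * (s - t)) = - (w s (x + v * (s - t)) * p s) := by
      unfold dt; rw [hp]; unfold dx; linarith
    simp only [e1]
    rw [hp]; ring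
  have hc : ∀ s ∈ Set.Icc (0:ℝ) t, (w s (x + v * (s - t)) - v) * Real.exp (A s)
      = (w 0 (x + v * (0 - t)) - v) * Real.exp (A 0) := by
    refine constant_of_has_deriv_right_zero ?_ ?_
    · exact fun s h => (hZ s h.1).continuousAt.continuousWithinAt
    · exact fun s h => (hZ s h.1).hasDerivWithinAt
  have := hc t ⟨ht, le_rfl⟩
  simp only [sub_self, mul_zero, add_zero, ← hv, zero_mul] at this
  have h0 : w 0 (x + v * (0 - t)) - v = 0 := by
    rcases mul_eq_zero.mp this.symm with h | h
    · exact h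
    · exact absurd h (Real.exp_pos _).ne'
  have e : x - t * v = x + v * (0 - t) := by ring
  rw [e]; linarith

lemma hasDerivAt_tanh (x : ℝ) : HasDerivAt Real.tanh (1 - Real.tanh x ^ 2) x := by
  have h := (Real.hasDerivAt_sinh x).div (Real.hasDerivAt_cosh x) (Real.cosh_pos x).ne'
  have e : Real.tanh = fun x => Real.sinh x / Real.cosh x := funext Real.tanh_eq_sinh_div_cosh
  rw [e]
  refine h.congr_deriv ?_
  have := (Real.cosh_pos x).ne'
  field_simp

lemma tanh_sq_lt (x : ℝ) : Real.tanh x ^ 2 < 1 := by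
  rw [Real.tanh_eq_sinh_div_cosh, div_pow, div_lt_one (by have := Real.cosh_pos x; positivity)]
  have := Real.cosh_sq x
  linarith

/-- Hypotheses on the rarefaction. -/
structure Rare (m : ℝ) (wR : ℝ → ℝ → ℝ) : Prop where
  hm : 0 < m
  hs : m ≤ 1 / 100
  sol : BurgersSol (3 * (m + 9 * m ^ 2) ^ 2) (3 * m ^ 2) wR

/-- Half the speed gap. -/
def Dl (m : ℝ) : ℝ := (3 * (m + 9 * m ^ 2) ^ 2 - 3 * m ^ 2) / 2
/-- Mean speed. -/
def Cm (m : ℝ) : ℝ := (3 * (m + 9 * m ^ 2) ^ 2 + 3 * m ^ 2) / 2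

/-- The half-space of times on which the rarefaction is smooth. -/
def UU : Set (ℝ × ℝ) := {p | -1 < p.1}

lemma UU_open : IsOpen UU := isOpen_lt continuous_const continuous_fst

lemma Dl_pos {m : ℝ} (hm : 0 < m) : 0 < Dl m := by
  unfold Dl
  have : 0 < 3 * (m + 9 * m ^ 2) ^ 2 - 3 * m ^ 2 := by
    have e : 3 * (m + 9 * m ^ 2) ^ 2 - 3 * m ^ 2 = 54 * m ^ 3 + 243 * m ^ 4 := by ring
    rw [e]; positivity
  linarith

lemma Dl_le {m : ℝ} (hm : 0 < m) (hs : m ≤ 1 / 100) : Dl m ≤ 30 * m ^ 3 := by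
  unfold Dl
  have : 0 < m ^ 3 := by positivity
  nlinarith

/-- The decay rate of the rarefaction. -/
def th (m t : ℝ) : ℝ := Dl m / (1 + (1 + t) * Dl m)

namespace Rare
variable {m : ℝ} {wR : ℝ → ℝ → ℝ}

/-- normalized profile value -/
def TT (m : ℝ) (wR : ℝ → ℝ → ℝ) (t ζ : ℝ) : ℝ := (3 * (tuR m wR t ζ) ^ 2 - Cm m) / Dl m
/-- the compression factor -/
def kap (m : ℝ) (wR : ℝ → ℝ → ℝ) (t ζ : ℝ) : ℝ :=
  1 - 6 * (1 + t) * tuR m wR t ζ * dx (tuR m wR) t ζ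

lemma char (h : Rare m wR) {t : ℝ} (ht : 0 ≤ t) (x : ℝ) :
    wR t x = Cm m + Dl m * Real.tanh (x - t * wR t x) := by
  have := burgers_char h.sol.1 h.sol.2.1 ht x
  rw [h.sol.2.2] at this
  exact this

lemma w_gt (h : Rare m wR) {t : ℝ} (ht : 0 ≤ t) (x : ℝ) :
    3 * m ^ 2 < wR t x ∧ wR t x < 3 * (m + 9 * m ^ 2) ^ 2 := by
  have h1 := h.char ht x
  have h2 := tanh_sq_lt (x - t * wR t x)
  have h3 := Dl_pos h.hm
  obtain ⟨h4, h5⟩ := abs_lt.mp ((sq_lt_one_iff_abs_lt_one _).mp h2)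
  rw [h1]
  have e1 : 3 * m ^ 2 = Cm m - Dl m := by unfold Cm Dl; ring
  have e2 : 3 * (m + 9 * m ^ 2) ^ 2 = Cm m + Dl m := by unfold Cm Dl; ring
  rw [e1, e2]
  constructor <;> nlinarith

lemma sq_eq (h : Rare m wR) {t : ℝ} (ht : -1 < t) (ζ : ℝ) :
    3 * (tuR m wR t ζ) ^ 2 = wR (1 + t) (ζ + 3 * m ^ 2 * t) := by
  unfold tuR
  have h1 := (h.w_gt (show 0 ≤ 1 + t by linarith) (ζ + 3 * m ^ 2 * t)).1
  have := pow_pos h.hm 2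
  rw [Real.sq_sqrt (by linarith)]
  ring

lemma b_bd (h : Rare m wR) {t : ℝ} (ht : -1 < t) (ζ : ℝ) :
    m < tuR m wR t ζ ∧ tuR m wR t ζ < m + 9 * m ^ 2 := by
  have h1 := h.w_gt (show 0 ≤ 1 + t by linarith) (ζ + 3 * m ^ 2 * t)
  rw [← h.sq_eq ht] at h1
  have h2 : 0 ≤ tuR m wR t ζ := Real.sqrt_nonneg _
  have := h.hm
  constructor
  · nlinarith
  · by_contra hc
    push Not at hc
    have : (m + 9 * m ^ 2) ^ 2 ≤ (tuR m wR t ζ) ^ 2 := by gcongr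
    linarith

lemma b_pos (h : Rare m wR) {t : ℝ} (ht : -1 < t) (ζ : ℝ) : 0 < tuR m wR t ζ :=
  h.hm.trans (h.b_bd ht ζ).1

lemma smooth (h : Rare m wR) : SmoothOn UU (tuR m wR) := by
  have h1 : ContDiff ℝ ∞ (fun p : ℝ × ℝ => wR (1 + p.1) (p.2 + 3 * m ^ 2 * p.1) / 3) := by
    have : ContDiff ℝ ∞ (fun p : ℝ × ℝ => ((1 + p.1, p.2 + 3 * m ^ 2 * p.1) : ℝ × ℝ)) := by fun_prop
    exact (h.sol.1.comp this).div_const 3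
  refine ContDiffOn.sqrt h1.contDiffOn ?_
  rintro ⟨t, x⟩ hp
  have := (h.w_gt (show 0 ≤ 1 + t by have : -1 < t := hp; linarith) (x + 3 * m ^ 2 * t)).1
  have := pow_pos h.hm 2
  simp only [ne_eq]
  linarith

lemma cont (h : Rare m wR) : Continuous (fun p : ℝ × ℝ => tuR m wR p.1 p.2) := by
  have h1 : ContDiff ℝ ∞ (fun p : ℝ × ℝ => wR (1 + p.1) (p.2 + 3 * m ^ 2 * p.1) / 3) := by
    have : ContDiff ℝ ∞ (fun p : ℝ × ℝ => ((1 + p.1, p.2 + 3 * m ^ 2 * p.1) : ℝ × ℝ)) := by fun_prop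
    exact (h.sol.1.comp this).div_const 3
  exact h1.continuous.sqrt

lemma mem {t : ℝ} (ht : -1 < t) (ζ : ℝ) : (t, ζ) ∈ UU := ht

lemma db (h : Rare m wR) {t : ℝ} (ht : -1 < t) (ζ : ℝ) :
    HasDerivAt (tuR m wR t) (dx (tuR m wR) t ζ) ζ := h.smooth.hasDerivAt_x UU_open (mem ht ζ)
lemma dD (h : Rare m wR) {t : ℝ} (ht : -1 < t) (ζ : ℝ) :
    HasDerivAt (dx (tuR m wR) t) (dx (dx (tuR m wR)) t ζ) ζ :=
  (h.smooth.dx UU_open).hasDerivAt_x UU_open (mem ht ζ)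
lemma dD1 (h : Rare m wR) {t : ℝ} (ht : -1 < t) (ζ : ℝ) :
    HasDerivAt (dx (dx (tuR m wR)) t) (dx (dx (dx (tuR m wR))) t ζ) ζ :=
  ((h.smooth.dx UU_open).dx UU_open).hasDerivAt_x UU_open (mem ht ζ)
lemma dD2 (h : Rare m wR) {t : ℝ} (ht : -1 < t) (ζ : ℝ) :
    HasDerivAt (dx (dx (dx (tuR m wR))) t) (dx (dx (dx (dx (tuR m wR)))) t ζ) ζ :=
  (((h.smooth.dx UU_open).dx UU_open).dx UU_open).hasDerivAt_x UU_open (mem ht ζ)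

lemma TT_eq (h : Rare m wR) {t : ℝ} (ht : -1 < t) (ζ : ℝ) :
    TT m wR t ζ = Real.tanh (ζ + 3 * m ^ 2 * t - (1 + t) * (3 * (tuR m wR t ζ) ^ 2)) := by
  have h1 := h.char (show 0 ≤ 1 + t by linarith) (ζ + 3 * m ^ 2 * t)
  rw [← h.sq_eq ht] at h1
  unfold TT
  have h3 := Dl_pos h.hm
  rw [div_eq_iff h3.ne']
  linarith

lemma TT_sq (h : Rare m wR) {t : ℝ} (ht : -1 < t) (ζ : ℝ) : TT m wR t ζ ^ 2 < 1 := by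
  rw [h.TT_eq ht]; exact tanh_sq_lt _

lemma dT' (h : Rare m wR) {t : ℝ} (ht : -1 < t) (ζ : ℝ) :
    HasDerivAt (TT m wR t) (6 * tuR m wR t ζ * dx (tuR m wR) t ζ / Dl m) ζ := by
  have := ((((h.db ht ζ).pow 2).const_mul 3).sub_const (Cm m)).div_const (Dl m)
  refine this.congr_deriv ?_
  push_cast; ring

/-- first implicit relation -/
lemma rel (h : Rare m wR) {t : ℝ} (ht : -1 < t) (ζ : ℝ) :
    6 * tuR m wR t ζ * dx (tuR m wR) t ζ = Dl m * (1 - TT m wR t ζ ^ 2) * kap m wR t ζ := by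
  have h3 := Dl_pos h.hm
  have d1 := h.dT' ht ζ
  have e : TT m wR t = fun ζ => Real.tanh (ζ + 3 * m ^ 2 * t - (1 + t) * (3 * (tuR m wR t ζ) ^ 2)) :=
    funext (h.TT_eq ht)
  have d2 : HasDerivAt (fun ζ => ζ + 3 * m ^ 2 * t - (1 + t) * (3 * (tuR m wR t ζ) ^ 2))
      (kap m wR t ζ) ζ := by
    have := ((hasDerivAt_id ζ).add_const (3 * m ^ 2 * t)).sub
      ((((h.db ht ζ).pow 2).const_mul 3).const_mul (1 + t))
    refine this.congr_deriv ?_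
    unfold kap; push_cast; ring
  have d3 := (hasDerivAt_tanh _).comp ζ d2
  have e2 : (Real.tanh ∘ fun ζ => ζ + 3 * m ^ 2 * t - (1 + t) * (3 * (tuR m wR t ζ) ^ 2)) = TT m wR t := by
    rw [e]; rfl
  rw [e2] at d3
  have := d1.unique d3
  rw [div_eq_iff h3.ne', ← h.TT_eq ht] at this
  linarith

lemma kap_rel (h : Rare m wR) {t : ℝ} (ht : -1 < t) (ζ : ℝ) :
    kap m wR t ζ * (1 + (1 + t) * (Dl m * (1 - TT m wR t ζ ^ 2))) = 1 := by
  have := h.rel ht ζ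
  have e : kap m wR t ζ = 1 - (1 + t) * (6 * tuR m wR t ζ * dx (tuR m wR) t ζ) := by
    unfold kap; ring
  rw [this] at e
  linear_combination e

lemma kap_bd (h : Rare m wR) {t : ℝ} (ht : -1 < t) (ζ : ℝ) :
    0 < kap m wR t ζ ∧ kap m wR t ζ ≤ 1 := by
  have h1 := h.kap_rel ht ζ
  have h2 : 0 ≤ (1 + t) * (Dl m * (1 - TT m wR t ζ ^ 2)) := by
    have := h.TT_sq ht ζ; have := Dl_pos h.hm
    apply mul_nonneg (by linarith) (mul_nonneg (by linarith) (by linarith))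
  set k := kap m wR t ζ
  set z := (1 + t) * (Dl m * (1 - TT m wR t ζ ^ 2))
  have hk : 0 < k := by
    by_contra hc; push Not at hc
    nlinarith
  exact ⟨hk, by nlinarith⟩

lemma D_pos (h : Rare m wR) {t : ℝ} (ht : -1 < t) (ζ : ℝ) : 0 < dx (tuR m wR) t ζ := by
  have h1 := h.rel ht ζ
  have h2 := (h.kap_bd ht ζ).1
  have h3 := h.TT_sq ht ζ
  have h4 := Dl_pos h.hm
  have h5 := h.b_pos ht ζ
  have : 0 < Dl m * (1 - TT m wR t ζ ^ 2) * kap m wR t ζ :=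
    mul_pos (mul_pos h4 (by linarith)) h2
  rw [← h1] at this
  exact pos_of_mul_pos_right this (by positivity)

lemma D_le (h : Rare m wR) {t : ℝ} (ht : -1 < t) (ζ : ℝ) :
    dx (tuR m wR) t ζ ≤ 5 * m ^ 2 * kap m wR t ζ := by
  have h1 := h.rel ht ζ
  have h2 := (h.kap_bd ht ζ).1
  have h4 := Dl_pos h.hm
  have h6 := Dl_le h.hm h.hs
  have h7 := (h.b_bd ht ζ).1
  have h8 := h.D_pos ht ζ
  have hm := h.hm
  have k1 : Dl m * (1 - TT m wR t ζ ^ 2) * kap m wR t ζ ≤ 30 * m ^ 3 * kap m wR t ζ := by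
    apply mul_le_mul_of_nonneg_right _ h2.le
    nlinarith [sq_nonneg (TT m wR t ζ), h.TT_sq ht ζ]
  have k2 : 6 * m * dx (tuR m wR) t ζ ≤ 6 * tuR m wR t ζ * dx (tuR m wR) t ζ := by gcongr
  have k3 : 6 * m * dx (tuR m wR) t ζ ≤ 6 * m * (5 * m ^ 2 * kap m wR t ζ) := by linarith
  exact le_of_mul_le_mul_left k3 (by positivity)

lemma th_pos (h : Rare m wR) {t : ℝ} (ht : -1 < t) : 0 < th m t := by
  have := Dl_pos h.hm
  have : 0 < (1 + t) * Dl m := mul_pos (by linarith) this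
  unfold th; positivity

lemma D_le_th (h : Rare m wR) {t : ℝ} (ht : -1 < t) (ζ : ℝ) :
    dx (tuR m wR) t ζ ≤ th m t / (6 * m) := by
  have h1 := h.rel ht ζ
  have h2 := (h.kap_bd ht ζ).1
  have h4 := Dl_pos h.hm
  have h7 := (h.b_bd ht ζ).1
  have h8 := h.D_pos ht ζ
  have hm := h.hm
  have k0 := h.kap_rel ht ζ
  have hT := h.TT_sq ht ζ
  have k1 : Dl m * (1 - TT m wR t ζ ^ 2) * kap m wR t ζ ≤ th m t := by
    unfold th
    have : 0 < (1 + t) * Dl m := mul_pos (by linarith) h4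
    rw [le_div_iff₀ (by linarith)]
    have hT0 := sq_nonneg (TT m wR t ζ)
    set T2 := TT m wR t ζ ^ 2
    set k := kap m wR t ζ
    have : Dl m * (1 - T2) * k * (1 + (1 + t) * Dl m)
      = Dl m * (k * (1 + (1 + t) * (Dl m * (1 - T2)))) - Dl m * k * T2 := by ring
    rw [this, k0]
    have : 0 ≤ Dl m * k * T2 := by positivity
    linarith
  have k2 : 6 * m * dx (tuR m wR) t ζ ≤ 6 * tuR m wR t ζ * dx (tuR m wR) t ζ := by gcongr
  rw [le_div_iff₀ (by positivity)]
  linarith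

lemma b_lip (h : Rare m wR) {t : ℝ} (ht : -1 < t) (ζ ξ : ℝ) :
    |tuR m wR t ζ - tuR m wR t ξ| ≤ |ζ - ξ| * (th m t / (6 * m)) := by
  have := (convex_univ : Convex ℝ (Set.univ : Set ℝ)).norm_image_sub_le_of_norm_hasDerivWithin_le
    (f := tuR m wR t) (f' := dx (tuR m wR) t) (C := th m t / (6 * m)) (x := ξ) (y := ζ)
    (fun x _ => (h.db ht x).hasDerivWithinAt)
    (fun x _ => by rw [Real.norm_eq_abs, abs_of_pos (h.D_pos ht x)]; exact h.D_le_th ht x)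
    trivial trivial
  rw [Real.norm_eq_abs, Real.norm_eq_abs] at this
  linarith

lemma dT (h : Rare m wR) {t : ℝ} (ht : -1 < t) (ζ : ℝ) :
    HasDerivAt (TT m wR t) ((1 - TT m wR t ζ ^ 2) * kap m wR t ζ) ζ := by
  refine (h.dT' ht ζ).congr_deriv ?_
  rw [h.rel ht ζ]
  have := (Dl_pos h.hm).ne'
  field_simp

lemma dk (h : Rare m wR) {t : ℝ} (ht : -1 < t) (ζ : ℝ) :
    HasDerivAt (kap m wR t)
      (2 * TT m wR t ζ * kap m wR t ζ ^ 2 * (1 - kap m wR t ζ)) ζ := by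
  have e : ∀ ζ, kap m wR t ζ = (1 + (1 + t) * (Dl m * (1 - TT m wR t ζ ^ 2)))⁻¹ := fun ζ =>
    eq_inv_of_mul_eq_one_left (h.kap_rel ht ζ)
  have hne : (1 + (1 + t) * (Dl m * (1 - TT m wR t ζ ^ 2))) ≠ 0 := by
    intro h0; have := h.kap_rel ht ζ; rw [h0] at this; simp at this
  have d := ((((((h.dT ht ζ).pow 2).const_sub 1).const_mul (Dl m)).const_mul (1 + t)).const_add 1).inv hne
  have d' := d.congr_of_eventuallyEq (f₁ := kap m wR t) (Filter.Eventually.of_forall e)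
  refine d'.congr_deriv ?_
  have k := h.kap_rel ht ζ
  simp only [Pi.pow_apply]
  rw [div_eq_mul_inv, ← inv_pow, ← e ζ]
  push_cast
  set K := kap m wR t ζ
  set T := TT m wR t ζ
  linear_combination (2 * T * K ^ 2) * k

/-- `d = D / b`. -/
def dd (m : ℝ) (wR : ℝ → ℝ → ℝ) (t ζ : ℝ) : ℝ := dx (tuR m wR) t ζ / tuR m wR t ζ

def E0 (T k d : ℝ) : ℝ := -2 * T * k ^ 2 - d
def E1 (T k d : ℝ) : ℝ :=
  -2 * (1 - T ^ 2) * k ^ 3 - 8 * T ^ 2 * k ^ 3 * (1 - k) + 2 * d * T * k ^ 2 + 2 * d ^ 2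
def E2 (T k d : ℝ) : ℝ :=
  -2 * (-2 * T * ((1 - T ^ 2) * k) * k ^ 3 + (1 - T ^ 2) * (3 * k ^ 2 * (2 * T * k ^ 2 * (1 - k))))
  - 8 * (2 * T * ((1 - T ^ 2) * k) * (k ^ 3 * (1 - k))
      + T ^ 2 * (3 * k ^ 2 * (2 * T * k ^ 2 * (1 - k)) * (1 - k) - k ^ 3 * (2 * T * k ^ 2 * (1 - k))))
  + 2 * (d * (E0 T k d - d) * (T * k ^ 2) + d * ((1 - T ^ 2) * k * k ^ 2
      + T * (2 * k * (2 * T * k ^ 2 * (1 - k)))))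
  + 4 * d * (d * (E0 T k d - d))

lemma D1_eq (h : Rare m wR) {t : ℝ} (ht : -1 < t) (ζ : ℝ) :
    dx (dx (tuR m wR)) t ζ
      = dx (tuR m wR) t ζ * E0 (TT m wR t ζ) (kap m wR t ζ) (dd m wR t ζ) := by
  have hb := (h.b_pos ht ζ).ne'
  have dl : HasDerivAt (fun ζ => 6 * tuR m wR t ζ * dx (tuR m wR) t ζ) _ ζ :=
    ((h.db ht ζ).const_mul 6).mul (h.dD ht ζ)
  have e := funext (h.rel ht)
  rw [e] at dl
  have dr : HasDerivAt (fun ζ => Dl m * (1 - TT m wR t ζ ^ 2) * kap m wR t ζ) _ ζ :=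
    ((((h.dT ht ζ).pow 2).const_sub 1).const_mul (Dl m)).mul (h.dk ht ζ)
  have u := dl.unique dr
  have r := h.rel ht ζ
  unfold E0 dd
  field_simp
  simp only [Pi.pow_apply] at u
  push_cast at u
  set b := tuR m wR t ζ
  set D := dx (tuR m wR) t ζ
  set D1 := dx (dx (tuR m wR)) t ζ
  set T := TT m wR t ζ
  set k := kap m wR t ζ
  linear_combination (1/6) * u + (1 / 6) * (2 * T * k ^ 2) * r

lemma dd_der (h : Rare m wR) {t : ℝ} (ht : -1 < t) (ζ : ℝ) :
    HasDerivAt (dd m wR t)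
      (dd m wR t ζ * (E0 (TT m wR t ζ) (kap m wR t ζ) (dd m wR t ζ) - dd m wR t ζ)) ζ := by
  have hb := (h.b_pos ht ζ).ne'
  have := (h.dD ht ζ).div (h.db ht ζ) hb
  refine this.congr_deriv ?_
  rw [h.D1_eq ht ζ]
  set e := E0 (TT m wR t ζ) (kap m wR t ζ) (dd m wR t ζ)
  unfold dd
  field_simp

lemma E0_der (h : Rare m wR) {t : ℝ} (ht : -1 < t) (ζ : ℝ) :
    HasDerivAt (fun ζ => E0 (TT m wR t ζ) (kap m wR t ζ) (dd m wR t ζ))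
      (E1 (TT m wR t ζ) (kap m wR t ζ) (dd m wR t ζ)) ζ := by
  have := (((h.dT ht ζ).const_mul (-2)).mul ((h.dk ht ζ).pow 2)).sub (h.dd_der ht ζ)
  refine this.congr_deriv ?_
  simp only [Pi.pow_apply]
  unfold E1 E0
  push_cast; ring

lemma E1_der (h : Rare m wR) {t : ℝ} (ht : -1 < t) (ζ : ℝ) :
    HasDerivAt (fun ζ => E1 (TT m wR t ζ) (kap m wR t ζ) (dd m wR t ζ))
      (E2 (TT m wR t ζ) (kap m wR t ζ) (dd m wR t ζ)) ζ := by
  have a1 := ((((h.dT ht ζ).pow 2).const_sub 1).const_mul (-2)).mul ((h.dk ht ζ).pow 3)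
  have a2 := ((((h.dT ht ζ).pow 2).const_mul 8).mul ((h.dk ht ζ).pow 3)).mul ((h.dk ht ζ).const_sub 1)
  have a3 := (((h.dd_der ht ζ).const_mul 2).mul (h.dT ht ζ)).mul ((h.dk ht ζ).pow 2)
  have a4 := ((h.dd_der ht ζ).pow 2).const_mul 2
  have := ((a1.sub a2).add a3).add a4
  refine this.congr_deriv ?_
  simp only [Pi.pow_apply, Pi.mul_apply]
  unfold E2 E0
  push_cast; ring

lemma D2_eq (h : Rare m wR) {t : ℝ} (ht : -1 < t) (ζ : ℝ) :
    dx (dx (dx (tuR m wR))) t ζ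
      = dx (tuR m wR) t ζ * (E0 (TT m wR t ζ) (kap m wR t ζ) (dd m wR t ζ) ^ 2
        + E1 (TT m wR t ζ) (kap m wR t ζ) (dd m wR t ζ)) := by
  have dl := h.dD1 ht ζ
  have dr := (h.dD ht ζ).mul (h.E0_der ht ζ)
  have e : dx (dx (tuR m wR)) t = (dx (tuR m wR) t) *
    (fun ζ => E0 (TT m wR t ζ) (kap m wR t ζ) (dd m wR t ζ)) := funext (h.D1_eq ht)
  rw [← e] at dr
  rw [dl.unique dr, h.D1_eq ht ζ]; ring

lemma D3_eq (h : Rare m wR) {t : ℝ} (ht : -1 < t) (ζ : ℝ) :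
    dx (dx (dx (dx (tuR m wR)))) t ζ
      = dx (tuR m wR) t ζ * (E0 (TT m wR t ζ) (kap m wR t ζ) (dd m wR t ζ) ^ 3
        + 3 * E0 (TT m wR t ζ) (kap m wR t ζ) (dd m wR t ζ) * E1 (TT m wR t ζ) (kap m wR t ζ) (dd m wR t ζ)
        + E2 (TT m wR t ζ) (kap m wR t ζ) (dd m wR t ζ)) := by
  have dl := h.dD2 ht ζ
  have dr := (h.dD ht ζ).mul (((h.E0_der ht ζ).pow 2).add (h.E1_der ht ζ))
  have e : dx (dx (dx (tuR m wR))) t = (dx (tuR m wR) t) *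
    ((fun ζ => E0 (TT m wR t ζ) (kap m wR t ζ) (dd m wR t ζ)) ^ 2
    + (fun ζ => E1 (TT m wR t ζ) (kap m wR t ζ) (dd m wR t ζ))) := funext (h.D2_eq ht)
  rw [← e] at dr
  rw [dl.unique dr, h.D1_eq ht ζ]
  simp only [Pi.pow_apply, Pi.add_apply]
  push_cast; ring

lemma E_bd {T k d : ℝ} (hT : |T| ≤ 1) (hk0 : 0 ≤ k) (hk1 : k ≤ 1) (hd0 : 0 ≤ d) (hd : d ≤ k / 10) :
    |E0 T k d| ≤ 3 * k ∧ |E1 T k d| ≤ 12 * k ∧ |E2 T k d| ≤ 150 * k := by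
  have hk : |k| ≤ 1 := by rw [abs_of_nonneg hk0]; exact hk1
  have hkk : |k| ≤ k := (abs_of_nonneg hk0).le
  have hdk : |d| ≤ 0.1 * k := by rw [abs_of_nonneg hd0]; linarith
  have hd1 : |d| ≤ 0.1 := by linarith
  have hT2 : |T ^ 2| ≤ 1 := by rw [abs_pow]; exact pow_le_one₀ (abs_nonneg _) hT
  have h1T : |1 - T ^ 2| ≤ 1 := by
    rw [abs_of_nonneg (sq_nonneg T)] at hT2
    rw [abs_le]; constructor <;> nlinarith [sq_nonneg T]
  have h1k : |1 - k| ≤ 1 := by rw [abs_le]; constructor <;> linarith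
  have hk2 : |k ^ 2| ≤ 1 := by rw [abs_pow]; exact pow_le_one₀ (abs_nonneg _) hk
  have hk3 : |k ^ 3| ≤ 1 := by rw [abs_pow]; exact pow_le_one₀ (abs_nonneg _) hk
  have hk2k : |k ^ 2| ≤ k := by rw [abs_of_nonneg (by positivity)]; nlinarith
  have hk3k : |k ^ 3| ≤ k := by
    rw [abs_of_nonneg (by positivity)]
    have := pow_le_one₀ (n := 2) hk0 hk1
    nlinarith
  have h2 : |(2:ℝ)| ≤ 2 := by norm_num
  have hm2 : |(-2:ℝ)| ≤ 2 := by norm_num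
  have h3 : |(3:ℝ)| ≤ 3 := by norm_num
  have h4 : |(4:ℝ)| ≤ 4 := by norm_num
  have h8 : |(8:ℝ)| ≤ 8 := by norm_num
  have b0 : |E0 T k d| ≤ 3 * k := by
    have : |E0 T k d| ≤ 2 * 1 * k + 0.1 * k := bS (bM (bM hm2 hT) hk2k) hdk
    linarith
  have b0' : |E0 T k d| ≤ 3 := by linarith
  refine ⟨b0, ?_, ?_⟩
  · have hdd : |d ^ 2| ≤ 0.1 * k := by rw [sq]; exact (bM hdk hd1).trans (by linarith)
    have : |E1 T k d| ≤ 2 * 1 * k + 8 * 1 * k * 1 + 2 * 0.1 * 1 * k + 2 * (0.1 * k) :=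
      bA (bA (bS (bM (bM hm2 h1T) hk3k) (bM (bM (bM h8 hT2) hk3k) h1k)) (bM (bM (bM h2 hd1) hT) hk2k)) (bM h2 hdd)
    linarith
  · have q : |2 * T * k ^ 2 * (1 - k)| ≤ 2 * 1 * k * 1 := bM (bM (bM h2 hT) hk2k) h1k
    have t1 : |-2 * (-2 * T * ((1 - T ^ 2) * k) * k ^ 3 + (1 - T ^ 2) * (3 * k ^ 2 * (2 * T * k ^ 2 * (1 - k))))|
        ≤ 2 * (2 * 1 * (1 * k) * 1 + 1 * (3 * 1 * (2 * 1 * k * 1))) :=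
      bM hm2 (bA (bM (bM (bM hm2 hT) (bM h1T hkk)) hk3) (bM h1T (bM (bM h3 hk2) q)))
    have t2 : |8 * (2 * T * ((1 - T ^ 2) * k) * (k ^ 3 * (1 - k))
      + T ^ 2 * (3 * k ^ 2 * (2 * T * k ^ 2 * (1 - k)) * (1 - k) - k ^ 3 * (2 * T * k ^ 2 * (1 - k))))|
        ≤ 8 * (2 * 1 * (1 * k) * (1 * 1) + 1 * (3 * 1 * (2 * 1 * k * 1) * 1 + 1 * (2 * 1 * k * 1))) :=
      bM h8 (bA (bM (bM (bM h2 hT) (bM h1T hkk)) (bM hk3 h1k))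
        (bM hT2 (bS (bM (bM (bM h3 hk2) q) h1k) (bM hk3 q))))
    have t3 : |2 * (d * (E0 T k d - d) * (T * k ^ 2) + d * ((1 - T ^ 2) * k * k ^ 2
      + T * (2 * k * (2 * T * k ^ 2 * (1 - k)))))| ≤ 2 * (0.1 * (3 + 0.1) * (1 * k) + 0.1 * (1 * k * 1 + 1 * (2 * 1 * (2 * 1 * k * 1)))) :=
      bM h2 (bA (bM (bM hd1 (bS b0' hd1)) (bM hT hk2k)) (bM hd1 (bA (bM (bM h1T hkk) hk2) (bM hT (bM (bM h2 hk) q)))))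
    have t4 : |4 * d * (d * (E0 T k d - d))| ≤ 4 * 0.1 * (0.1 * k * (3 + 0.1)) :=
      bM (bM h4 hd1) (bM hdk (bS b0' hd1))
    have := bA (bA (bS t1 t2) t3) t4
    unfold E2
    refine this.trans ?_
    linarith

lemma D_bds (h : Rare m wR) {t : ℝ} (ht : -1 < t) (ζ : ℝ) :
    |dx (dx (tuR m wR)) t ζ| ≤ 3 * (dx (tuR m wR) t ζ * kap m wR t ζ) ∧
    |dx (dx (dx (tuR m wR))) t ζ| ≤ 21 * (dx (tuR m wR) t ζ * kap m wR t ζ) ∧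
    |dx (dx (dx (dx (tuR m wR)))) t ζ| ≤ 300 * (dx (tuR m wR) t ζ * kap m wR t ζ) := by
  obtain ⟨hk0, hk1⟩ := h.kap_bd ht ζ
  have hD := h.D_pos ht ζ
  have hb := h.b_pos ht ζ
  have hT : |TT m wR t ζ| ≤ 1 := (sq_le_one_iff_abs_le_one _).mp (h.TT_sq ht ζ).le
  have hd0 : 0 ≤ dd m wR t ζ := by unfold dd; positivity
  have hd : dd m wR t ζ ≤ kap m wR t ζ / 10 := by
    unfold dd
    rw [div_le_iff₀ hb]
    have h1 := h.D_le ht ζ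
    have h2 := (h.b_bd ht ζ).1
    have hm := h.hm
    have hs := h.hs
    have : kap m wR t ζ * m ≤ kap m wR t ζ * tuR m wR t ζ := by gcongr
    nlinarith [mul_pos hk0 hm]
  obtain ⟨e0, e1, e2⟩ := E_bd hT hk0.le hk1 hd0 hd
  rw [h.D1_eq ht, h.D2_eq ht, h.D3_eq ht]
  set k := kap m wR t ζ
  set D := dx (tuR m wR) t ζ
  set a := E0 (TT m wR t ζ) k (dd m wR t ζ)
  set b := E1 (TT m wR t ζ) k (dd m wR t ζ)
  set c := E2 (TT m wR t ζ) k (dd m wR t ζ)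
  have hDD : |D| ≤ D := (abs_of_pos hD).le
  have a1 : |a| ≤ 3 := by linarith
  have aa : |a ^ 2| ≤ 3 * (3 * k) := by rw [sq]; exact bM a1 e0
  have aaa : |a ^ 3| ≤ 3 * (3 * (3 * k)) := by
    have : a ^ 3 = a * a ^ 2 := by ring
    rw [this]; exact bM a1 aa
  have h3 : |(3:ℝ)| ≤ 3 := by norm_num
  refine ⟨(bM hDD e0).trans (le_of_eq (by ring)), (bM hDD (bA aa e1)).trans (le_of_eq (by ring)),
    (bM hDD (bA (bA aaa (bM (bM h3 a1) e1)) e2)).trans ?_⟩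
  nlinarith [mul_pos hD hk0]

/-- The rarefaction equation in the moving frame. -/
lemma bt (h : Rare m wR) {t : ℝ} (ht : -1 < t) (ζ : ℝ) :
    dt (tuR m wR) t ζ = -((3 * (tuR m wR t ζ) ^ 2 - 3 * m ^ 2) * dx (tuR m wR) t ζ) := by
  have hb := h.b_pos ht ζ
  have hs : SmoothOn Set.univ wR := h.sol.1.contDiffOn
  have hU : IsOpen (Set.univ : Set (ℝ × ℝ)) := isOpen_univ
  -- time derivative of `3 b²`
  have l1 : HasDerivAt (fun s => 3 * (tuR m wR s ζ) ^ 2) _ t :=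
    ((h.smooth.hasDerivAt_t UU_open (mem ht ζ)).pow 2).const_mul 3
  have F : HasFDerivAt (fun p : ℝ × ℝ => wR p.1 p.2)
      (fderiv ℝ (fun p : ℝ × ℝ => wR p.1 p.2) (1 + t, ζ + 3 * m ^ 2 * t)) (1 + t, ζ + 3 * m ^ 2 * t) :=
    (hs.diffAt hU (by simp)).hasFDerivAt
  have c1 : HasDerivAt (fun s : ℝ => ((1 + s, ζ + 3 * m ^ 2 * s) : ℝ × ℝ)) ((1 : ℝ), 3 * m ^ 2) t := by
    refine ((hasDerivAt_id t).const_add 1).prodMk ?_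
    have := ((hasDerivAt_id t).const_mul (3 * m ^ 2)).const_add ζ
    exact this.congr_deriv (by ring)
  have r1 := F.comp_hasDerivAt t c1
  have ev : (fun s => 3 * (tuR m wR s ζ) ^ 2) =ᶠ[nhds t]
      ((fun p : ℝ × ℝ => wR p.1 p.2) ∘ fun s : ℝ => ((1 + s, ζ + 3 * m ^ 2 * s) : ℝ × ℝ)) := by
    filter_upwards [Ioi_mem_nhds ht] with s hs'
    exact h.sq_eq hs' ζ
  have u1 := (l1.congr_of_eventuallyEq ev.symm).unique r1
  have l2 : HasDerivAt (fun z => 3 * (tuR m wR t z) ^ 2) _ ζ := ((h.db ht ζ).pow 2).const_mul 3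
  have r2 : HasDerivAt (fun z => wR (1 + t) (z + 3 * m ^ 2 * t)) (dx wR (1 + t) (ζ + 3 * m ^ 2 * t)) ζ :=
    (hs.hasDerivAt_x hU (by simp) : HasDerivAt (wR (1 + t)) _ (ζ + 3 * m ^ 2 * t)).comp_add_const ζ (3 * m ^ 2 * t)
  have e2 : (fun z => 3 * (tuR m wR t z) ^ 2) = fun z => wR (1 + t) (z + 3 * m ^ 2 * t) :=
    funext (h.sq_eq ht)
  rw [e2] at l2
  have u2 := l2.unique r2
  have split : ((1 : ℝ), 3 * m ^ 2) = (1, 0) + (3 * m ^ 2) • ((0 : ℝ), (1 : ℝ)) := by simp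
  rw [split, map_add, map_smul, smul_eq_mul, ← hs.dt_eq hU (by simp), ← hs.dx_eq hU (by simp)] at u1
  have bu := h.sol.2.1 (1 + t) (ζ + 3 * m ^ 2 * t) (by linarith)
  have bu' : dt wR (1 + t) (ζ + 3 * m ^ 2 * t) + wR (1 + t) (ζ + 3 * m ^ 2 * t) * dx wR (1 + t) (ζ + 3 * m ^ 2 * t) = 0 := bu
  rw [← h.sq_eq ht, ← u2] at bu'
  rw [← u2] at u1
  push_cast at u1 bu'
  set b := tuR m wR t ζ
  set D := dx (tuR m wR) t ζ
  have : 6 * b * dt (tuR m wR) t ζ = 6 * b * -((3 * b ^ 2 - 3 * m ^ 2) * D) := by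
    linear_combination u1 + bu'
  exact mul_left_cancel₀ (by positivity) this

lemma Dt (h : Rare m wR) {t : ℝ} (ht : -1 < t) (ζ : ℝ) :
    dt (dx (tuR m wR)) t ζ = -((3 * (tuR m wR t ζ) ^ 2 - 3 * m ^ 2) * dx (dx (tuR m wR)) t ζ
      + 6 * tuR m wR t ζ * dx (tuR m wR) t ζ ^ 2) := by
  rw [h.smooth.comm UU_open (mem ht ζ)]
  have d := ((((((h.db ht ζ).pow 2).const_mul 3).sub_const (3 * m ^ 2))).mul (h.dD ht ζ)).neg
  have d2 := d.congr_of_eventuallyEq (f₁ := dt (tuR m wR) t) (Filter.Eventually.of_forall (h.bt ht))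
  show deriv (dt (tuR m wR) t) ζ = _
  rw [d2.deriv]
  simp only [Pi.pow_apply]
  push_cast; ring

end Rare
end

noncomputable section

/-! ### Pointwise inequality -/

/-- All pointwise assumptions. -/
structure Pt (m τ N0 N1 φ φ1 a a1 a2 a3 b D D1 D2 D3 κ B Bt θ Y ω ω1 l : ℝ) : Prop where
  m0 : 0 < m
  ms : m ≤ 1 / 10 ^ 8
  t0 : 0 < τ
  t1 : τ ≤ 1
  p0 : |φ| ≤ N0
  p1 : |φ1| ≤ N1
  n0 : N0 ≤ 1
  n1 : N1 ≤ 1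
  alo : -2 * m < a
  ahi : a < m
  a1p : 0 < a1
  a1l : a1 ≤ 5 * m ^ 3
  cmp1 : a1 ≤ 1.03 * ((a + 2 * m) * (m - a) ^ 2)
  cmp2 : (a + 2 * m) * (m - a) ^ 2 ≤ 1.04 * a1
  a2b : |a2| ≤ 10 * m ^ 2 * a1
  a3b : |a3| ≤ 200 * m ^ 4 * a1
  blo : m < b
  bhi : b < m + 9 * m ^ 2
  Dp : 0 < D
  Dl : D ≤ 5 * m ^ 2 * κ
  Dth : D ≤ θ / (6 * m)
  kp : 0 < κ
  kl : κ ≤ 1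
  D1b : |D1| ≤ 3 * (D * κ)
  D2b : |D2| ≤ 21 * (D * κ)
  D3b : |D3| ≤ 300 * (D * κ)
  Bp : 0 < B
  Bl : B < 9 * m ^ 2
  Btn : Bt ≤ 0
  bB : |b - m - B| ≤ l * (θ / (6 * m))
  dec : l ^ 2 * ((a + 2 * m) * (m - a) ^ 2) ≤ 80 / m
  lp : 0 ≤ l
  thp : 0 < θ
  Yb : |Y| ≤ 30 * m
  wlo : 15 / 8 * m ^ 2 ≤ ω
  whi : ω ≤ 15 / 2 * m ^ 2
  w1b : |ω1| ≤ 5 / 2 * m * a1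

/-- The quantity controlling the brackets. -/
def Xi (m N0 N1 f f1 f2 β a1 D k y : ℝ) : ℝ :=
  (N0 + 3 * m) * m ^ 2 * a1 * f + (N0 + 3 * m) * D * f + m ^ 3 * β * a1 + m ^ 2 * k + a1 * D
    + y * (m ^ 2 * a1 + D) + (N1 + m ^ 2) * (f1 + f2)

namespace Pt
variable {m τ N0 N1 φ φ1 a a1 a2 a3 b D D1 D2 D3 κ B Bt θ Y ω ω1 l : ℝ}


lemma bas (h : Pt m τ N0 N1 φ φ1 a a1 a2 a3 b D D1 D2 D3 κ B Bt θ Y ω ω1 l) : 0 < m ^ 2 ∧ m ^ 2 ≤ m / 10 ^ 8 ∧ 0 < m ^ 3 ∧ m ^ 3 ≤ m ^ 2 / 10 ^ 8 ∧ m ^ 4 ≤ m ^ 3 / 10 ^ 8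
    ∧ 0 < m ^ 4 := by
  have h0 := h.m0; have h1 := h.ms
  refine ⟨by positivity, ?_, by positivity, ?_, ?_, by positivity⟩
  · nlinarith
  · have : 0 < m ^ 2 := by positivity
    nlinarith
  · have : 0 < m ^ 3 := by positivity
    nlinarith

lemma N0n (h : Pt m τ N0 N1 φ φ1 a a1 a2 a3 b D D1 D2 D3 κ B Bt θ Y ω ω1 l) : 0 ≤ N0 := (abs_nonneg _).trans h.p0
lemma N1n (h : Pt m τ N0 N1 φ φ1 a a1 a2 a3 b D D1 D2 D3 κ B Bt θ Y ω ω1 l) : 0 ≤ N1 := (abs_nonneg _).trans h.p1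

lemma kD (h : Pt m τ N0 N1 φ φ1 a a1 a2 a3 b D D1 D2 D3 κ B Bt θ Y ω ω1 l) : 0 < D * κ ∧ D * κ ≤ D := by
  have := h.Dp; have := h.kp; have := h.kl
  exact ⟨by positivity, by nlinarith⟩

lemma Dl2 (h : Pt m τ N0 N1 φ φ1 a a1 a2 a3 b D D1 D2 D3 κ B Bt θ Y ω ω1 l) : D ≤ 5 * m ^ 2 := by
  have := h.Dl; have := h.kl; have := h.bas.1
  nlinarith

lemma DD (h : Pt m τ N0 N1 φ φ1 a a1 a2 a3 b D D1 D2 D3 κ B Bt θ Y ω ω1 l) : D * D ≤ 5 * m ^ 2 * (D * κ) := by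
  have := h.Dl; have := h.Dp
  nlinarith

lemma Ub (h : Pt m τ N0 N1 φ φ1 a a1 a2 a3 b D D1 D2 D3 κ B Bt θ Y ω ω1 l) : |φ + a + b - m| ≤ |φ| + 3 * m := by
  have e : φ + a + b - m = φ + (a + (b - m)) := by ring
  rw [e]
  refine bA le_rfl ?_
  rw [abs_le]
  have := h.bas
  constructor <;> linarith [h.alo, h.ahi, h.blo, h.bhi, h.m0]

lemma UP (h : Pt m τ N0 N1 φ φ1 a a1 a2 a3 b D D1 D2 D3 κ B Bt θ Y ω ω1 l) : |φ + a + b - m| ≤ N0 + 3 * m := h.Ub.trans (by linarith [h.p0])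

lemma UP' (h : Pt m τ N0 N1 φ φ1 a a1 a2 a3 b D D1 D2 D3 κ B Bt θ Y ω ω1 l) : |φ + a + b - m| ≤ 1.1 := h.UP.trans (by linarith [h.n0, h.ms])

lemma sB (h : Pt m τ N0 N1 φ φ1 a a1 a2 a3 b D D1 D2 D3 κ B Bt θ Y ω ω1 l) : 0 < a1 + D ∧ a1 + D ≤ 6 * m ^ 2 := by
  have := h.bas; have := h.Dl2; have := h.a1l; have := h.a1p; have := h.Dp
  constructor <;> linarith

lemma U1b (h : Pt m τ N0 N1 φ φ1 a a1 a2 a3 b D D1 D2 D3 κ B Bt θ Y ω ω1 l) : |φ1 + (a1 + D)| ≤ N1 + 6 * m ^ 2 := by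
  refine bA h.p1 ?_
  rw [abs_of_pos h.sB.1]; exact h.sB.2

lemma p1b (h : Pt m τ N0 N1 φ φ1 a a1 a2 a3 b D D1 D2 D3 κ B Bt θ Y ω ω1 l) : |(φ + a + b - m) ^ 2 - a ^ 2| ≤ 2 * (N0 + 3 * m) * |φ| + 5 * m * (b - m) := by
  have e : (φ + a + b - m) ^ 2 - a ^ 2 = (φ + (2 * a + 2 * (b - m))) * φ + (2 * a + (b - m)) * (b - m) := by ring
  rw [e]
  have b1 := h.blo; have b2 := h.bhi; have := h.bas; have := h.m0; have := h.alo; have := h.ahi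
  refine bA (bM ?_ le_rfl) (bM ?_ (abs_of_pos (by linarith)).le)
  · have : |φ + (2 * a + 2 * (b - m))| ≤ N0 + 6 * m :=
      bA h.p0 (abs_le.mpr ⟨by linarith, by linarith⟩)
    linarith [h.N0n]
  · rw [abs_le]; constructor <;> linarith

lemma p2b (h : Pt m τ N0 N1 φ φ1 a a1 a2 a3 b D D1 D2 D3 κ B Bt θ Y ω ω1 l) : |(φ + a + b - m) ^ 2 - b ^ 2| ≤ 2 * (N0 + 3 * m) * |φ| + 9 * m ^ 2 := by
  have e : (φ + a + b - m) ^ 2 - b ^ 2 = (φ + (2 * a + 2 * (b - m))) * φ + (a - m) * (a - m + 2 * b) := by ring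
  rw [e]
  have b1 := h.blo; have b2 := h.bhi; have := h.bas; have := h.m0; have := h.alo; have := h.ahi
  have k1 : |a - m| ≤ 3 * m := abs_le.mpr ⟨by linarith, by linarith⟩
  have k2 : |a - m + 2 * b| ≤ 3 * m := abs_le.mpr ⟨by linarith, by linarith⟩
  have k3 : |φ + (2 * a + 2 * (b - m))| ≤ 2 * (N0 + 3 * m) := by
    have : |φ + (2 * a + 2 * (b - m))| ≤ N0 + 6 * m :=
      bA h.p0 (abs_le.mpr ⟨by linarith, by linarith⟩)
    linarith [h.N0n]
  exact (bA (bM k3 le_rfl) (bM k1 k2)).trans (le_of_eq (by ring))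

lemma Ua (h : Pt m τ N0 N1 φ φ1 a a1 a2 a3 b D D1 D2 D3 κ B Bt θ Y ω ω1 l) : |φ + a + b - m - a| ≤ |φ| + (b - m) := by
  have e : φ + a + b - m - a = φ + (b - m) := by ring
  rw [e]; exact bA le_rfl (abs_of_pos (by linarith [h.blo])).le

lemma Ubb (h : Pt m τ N0 N1 φ φ1 a a1 a2 a3 b D D1 D2 D3 κ B Bt θ Y ω ω1 l) : |φ + a + b - m - b| ≤ |φ| + 3 * m := by
  have e : φ + a + b - m - b = φ + (a - m) := by ring
  rw [e]; exact bA le_rfl (abs_le.mpr ⟨by linarith [h.alo, h.m0], by linarith [h.ahi, h.m0]⟩)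

/-- Bound of the first bracket. -/
lemma S1b (h : Pt m τ N0 N1 φ φ1 a a1 a2 a3 b D D1 D2 D3 κ B Bt θ Y ω ω1 l) (φ2 : ℝ) :
    |-3 * (φ + a + b - m) ^ 2 * (a2 + D1) - 6 * (φ + a + b - m) * (φ1 + (a1 + D)) ^ 2
      + 3 * a ^ 2 * a2 + 6 * a * a1 ^ 2 + 3 * b ^ 2 * D1 + 6 * b * D ^ 2 - Y * (a2 + D1)
      + 3 * (φ + a + b - m) * (φ1 + (a1 + D)) * φ1|
    ≤ 1000 * Xi m N0 N1 |φ| |φ1| |φ2| (b - m) a1 D (D * κ) |Y| := by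
  have hU := h.UP; have hU' := h.UP'; have hUb := h.Ub; have hU1 := h.U1b
  have hp1 := h.p1b; have hp2 := h.p2b; have hUa := h.Ua; have hUbb := h.Ubb
  set U := φ + a + b - m with hUdef
  have e : -3 * U ^ 2 * (a2 + D1) - 6 * U * (φ1 + (a1 + D)) ^ 2
      + 3 * a ^ 2 * a2 + 6 * a * a1 ^ 2 + 3 * b ^ 2 * D1 + 6 * b * D ^ 2 - Y * (a2 + D1)
      + 3 * U * (φ1 + (a1 + D)) * φ1
    = -3 * ((U ^ 2 - a ^ 2) * a2) + -3 * ((U ^ 2 - b ^ 2) * D1) + -6 * ((U - a) * (a1 * a1))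
      + -6 * ((U - b) * (D * D)) + -6 * (U * ((φ1 + 2 * (a1 + D)) * φ1))
      + -12 * (U * (a1 * D)) + 3 * (U * ((φ1 + (a1 + D)) * φ1)) + -1 * (Y * (a2 + D1)) := by ring
  rw [e]
  have hm := h.m0; have hDp := h.Dp; have ha1 := h.a1p
  obtain ⟨c1, c2, c3, c4, c5, c6⟩ := h.bas
  obtain ⟨k1, k2⟩ := h.kD
  have hN0 := h.N0n; have hN1 := h.N1n
  have hf := abs_nonneg φ; have hf1 := abs_nonneg φ1; have hf2 := abs_nonneg φ2; have hy := abs_nonneg Y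
  have hβ : 0 < b - m := by linarith [h.blo]
  have A1 := bC (-3) (bM hp1 h.a2b)
  have A2 := bC (-3) (bM hp2 h.D1b)
  have aa : |a1 * a1| ≤ 5 * m ^ 3 * a1 := by
    rw [abs_of_pos (by positivity)]; exact mul_le_mul_of_nonneg_right h.a1l ha1.le
  have dd : |D * D| ≤ 5 * m ^ 2 * (D * κ) := by
    rw [abs_of_pos (by positivity)]; exact h.DD
  have A3 := bC (-6) (bM hUa aa)
  have A4 := bC (-6) (bM hUbb dd)
  have s2 : |φ1 + 2 * (a1 + D)| ≤ N1 + 12 * m ^ 2 := by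
    refine bA h.p1 ?_
    rw [abs_of_pos (by linarith [h.sB.1])]; linarith [h.sB.2]
  have A5 := bC (-6) (bM hU' (bM s2 (le_refl |φ1|)))
  have aD : |a1 * D| ≤ a1 * D := (abs_of_pos (by positivity)).le
  have A6 := bC (-12) (bM hUb aD)
  have A7 := bC 3 (bM hU' (bM hU1 (le_refl |φ1|)))
  have yb : |a2 + D1| ≤ 10 * m ^ 2 * a1 + 3 * D := (bA h.a2b h.D1b).trans (by linarith)
  have A8 := bC (-1) (bM (le_refl |Y|) yb)
  refine (bA (bA (bA (bA (bA (bA (bA A1 A2) A3) A4) A5) A6) A7) A8).trans ?_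
  simp only [abs_neg, Nat.abs_ofNat, abs_one]
  unfold Xi
  set f := |φ|; set f1 := |φ1|; set f2 := |φ2|; set y := |Y|; set β := b - m; set k := D * κ
  -- comparisons
  have q1 : 3 * (m ^ 3 * a1 * f) ≤ (N0 + 3 * m) * m ^ 2 * a1 * f := by
    have : 0 ≤ N0 * m ^ 2 * a1 * f := by positivity
    linarith only [this]
  have q2 : (N0 + 3 * m) * f * k ≤ (N0 + 3 * m) * D * f := by
    have : (N0 + 3 * m) * f * k ≤ (N0 + 3 * m) * f * D := by gcongr
    linarith
  have q3 : m ^ 2 * f * k ≤ (N0 + 3 * m) * D * f := by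
    have : m ^ 2 * f * k ≤ (N0 + 3 * m) * f * D := by gcongr; linarith
    linarith
  have q4 : m ^ 3 * k ≤ m ^ 2 * k := mul_le_mul_of_nonneg_right (by linarith only [c4, c1]) k1.le
  have q5 : f * (a1 * D) ≤ (N0 + 3 * m) * D * f := by
    have : f * (a1 * D) ≤ f * ((N0 + 3 * m) * D) := by gcongr; linarith [h.a1l]
    linarith
  have q6 : m * (a1 * D) ≤ a1 * D := by
    have : m * (a1 * D) ≤ 1 * (a1 * D) := by gcongr; linarith [h.ms]
    linarith
  have r1 : 0 ≤ m ^ 3 * β * a1 := by positivity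
  have r2 : 0 ≤ y * (m ^ 2 * a1) := by positivity
  have r3 : 0 ≤ y * D := by positivity
  have r4 : 0 ≤ N1 * f1 := by positivity
  have r5 : 0 ≤ m ^ 2 * f1 := by positivity
  have r6 : 0 ≤ N1 * f2 := by positivity
  have r7 : 0 ≤ m ^ 2 * f2 := by positivity
  have r8 : 0 ≤ (N0 + 3 * m) * m ^ 2 * a1 * f := by positivity
  have r9 : 0 ≤ (N0 + 3 * m) * D * f := by positivity
  have r10 : 0 ≤ m ^ 2 * k := by positivity
  have r11 : 0 ≤ a1 * D := by positivity
  linarith only [q1, q2, q3, q4, q5, q6, r1, r2, r3, r4, r5, r6, r7, r8, r9, r10, r11]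

/-- Bound of the second bracket. -/
lemma S2b (h : Pt m τ N0 N1 φ φ1 a a1 a2 a3 b D D1 D2 D3 κ B Bt θ Y ω ω1 l) (φ2 : ℝ) :
    |-3 * (φ + a + b - m) ^ 2 * (a3 + D2)
      - 18 * (φ + a + b - m) * (φ1 + (a1 + D)) * (φ2 + (a2 + D1)) - 6 * (φ1 + (a1 + D)) ^ 3
      + 3 * a ^ 2 * a3 + 18 * a * a1 * a2 + 6 * a1 ^ 3 + 3 * b ^ 2 * D2 + 18 * b * D * D1 + 6 * D ^ 3
      - Y * (a3 + D2) + 3 * (φ + a + b - m) * (φ1 + (a1 + D)) * φ2|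
    ≤ 1000 * Xi m N0 N1 |φ| |φ1| |φ2| (b - m) a1 D (D * κ) |Y| := by
  have hU := h.UP; have hU' := h.UP'; have hUb := h.Ub; have hU1 := h.U1b
  have hp1 := h.p1b; have hp2 := h.p2b; have hUa := h.Ua; have hUbb := h.Ubb
  set U := φ + a + b - m with hUdef
  have e : -3 * U ^ 2 * (a3 + D2)
      - 18 * U * (φ1 + (a1 + D)) * (φ2 + (a2 + D1)) - 6 * (φ1 + (a1 + D)) ^ 3
      + 3 * a ^ 2 * a3 + 18 * a * a1 * a2 + 6 * a1 ^ 3 + 3 * b ^ 2 * D2 + 18 * b * D * D1 + 6 * D ^ 3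
      - Y * (a3 + D2) + 3 * U * (φ1 + (a1 + D)) * φ2
    = -3 * ((U ^ 2 - a ^ 2) * a3) + -3 * ((U ^ 2 - b ^ 2) * D2) + -18 * ((U - a) * (a1 * a2))
      + -18 * ((U - b) * (D * D1)) + -18 * (U * (φ1 * φ2 + (a2 + D1) * φ1)) + -18 * (U * ((a1 + D) * φ2))
      + -18 * (U * (a1 * D1 + a2 * D)) + -6 * ((φ1 * φ1 + 3 * ((a1 + D) * φ1) + 3 * ((a1 + D) * (a1 + D))) * φ1)
      + -18 * ((a1 * D) * (a1 + D))
      + 3 * (U * ((φ1 + (a1 + D)) * φ2)) + -1 * (Y * (a3 + D2)) := by ring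
  rw [e]
  have hm := h.m0; have hDp := h.Dp; have ha1 := h.a1p
  obtain ⟨c1, c2, c3, c4, c5, c6⟩ := h.bas
  obtain ⟨k1, k2⟩ := h.kD
  have hN0 := h.N0n; have hN1 := h.N1n
  have hf := abs_nonneg φ; have hf1 := abs_nonneg φ1; have hf2 := abs_nonneg φ2; have hy := abs_nonneg Y
  have hβ : 0 < b - m := by linarith [h.blo]
  have ha3 : |a3| ≤ 10 * m ^ 2 * a1 := h.a3b.trans (mul_le_mul_of_nonneg_right (by linarith [h.ms]) ha1.le)
  have A1 := bC (-3) (bM hp1 ha3)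
  have A2 := bC (-3) (bM hp2 h.D2b)
  have h10 : 10 * m ^ 2 ≤ 1 := by linarith [h.ms]
  have aa : |a1 * a2| ≤ 5 * m ^ 3 * a1 := by
    have ha2 : |a2| ≤ a1 := h.a2b.trans ((mul_le_mul_of_nonneg_right h10 ha1.le).trans (one_mul _).le)
    have := bM (abs_of_pos ha1).le ha2
    refine this.trans (mul_le_mul_of_nonneg_right h.a1l ha1.le)
  have dd : |D * D1| ≤ 15 * m ^ 2 * (D * κ) := by
    have := bM (abs_of_pos hDp).le h.D1b
    refine this.trans ?_
    have := mul_le_mul_of_nonneg_right h.Dl2 k1.le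
    linarith
  have A3 := bC (-18) (bM hUa aa)
  have A4 := bC (-18) (bM hUbb dd)
  have sp := h.sB
  have u2 : |a2 + D1| ≤ 16 * m ^ 2 := by
    refine (bA h.a2b h.D1b).trans ?_
    have := h.Dl2
    have : 10 * m ^ 2 * a1 ≤ 1 * a1 := by gcongr
    linarith [h.a1l]
  have A5 := bC (-18) (bM hU' (bA (bM h.p1 (le_refl |φ2|)) (bM u2 (le_refl |φ1|))))
  have sa : |a1 + D| ≤ 6 * m ^ 2 := by rw [abs_of_pos sp.1]; exact sp.2
  have A6 := bC (-18) (bM hU' (bM sa (le_refl |φ2|)))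
  have aD : |a1 * D1 + a2 * D| ≤ 4 * (a1 * D) := by
    refine (bA (bM (abs_of_pos ha1).le h.D1b) (bM h.a2b (abs_of_pos hDp).le)).trans ?_
    have : a1 * (3 * (D * κ)) ≤ a1 * (3 * D) := by gcongr
    have : 10 * m ^ 2 * a1 * D ≤ 1 * a1 * D := by gcongr
    linarith
  have A7 := bC (-18) (bM hUb aD)
  have h3 : |(3:ℝ)| ≤ 3 := by norm_num
  have pp : |φ1| ≤ 1 := h.p1.trans h.n1
  have cu : |φ1 * φ1 + 3 * ((a1 + D) * φ1) + 3 * ((a1 + D) * (a1 + D))| ≤ N1 * 1 + 3 * (6 * m ^ 2 * 1) + 3 * (6 * m ^ 2 * (6 * m ^ 2)) :=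
    bA (bA (bM h.p1 pp) (bM h3 (bM sa pp))) (bM h3 (bM sa sa))
  have A8 := bC (-6) (bM cu (le_refl |φ1|))
  have A9 := bC (-18) (bM (abs_of_pos (by positivity : 0 < a1 * D)).le sa)
  have A10 := bC 3 (bM hU' (bM hU1 (le_refl |φ2|)))
  have yb : |a3 + D2| ≤ 10 * m ^ 2 * a1 + 21 * D := (bA ha3 h.D2b).trans (by linarith)
  have A11 := bC (-1) (bM (le_refl |Y|) yb)
  refine (bA (bA (bA (bA (bA (bA (bA (bA (bA (bA A1 A2) A3) A4) A5) A6) A7) A8) A9) A10) A11).trans ?_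
  simp only [abs_neg, Nat.abs_ofNat, abs_one]
  unfold Xi
  set f := |φ|; set f1 := |φ1|; set f2 := |φ2|; set y := |Y|; set β := b - m; set k := D * κ
  have q1 : 3 * (m ^ 3 * a1 * f) ≤ (N0 + 3 * m) * m ^ 2 * a1 * f := by
    have : 0 ≤ N0 * m ^ 2 * a1 * f := by positivity
    linarith only [this]
  have q2 : (N0 + 3 * m) * f * k ≤ (N0 + 3 * m) * D * f := by
    have : (N0 + 3 * m) * f * k ≤ (N0 + 3 * m) * f * D := by gcongr
    linarith
  have q3 : m ^ 2 * f * k ≤ (N0 + 3 * m) * D * f := by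
    have : m ^ 2 * f * k ≤ (N0 + 3 * m) * f * D := by gcongr; linarith
    linarith
  have q4 : 100000 * (m ^ 3 * k) ≤ m ^ 2 * k := by
    have := mul_le_mul_of_nonneg_right (by linarith only [c4, c1] : 100000 * m ^ 3 ≤ m ^ 2) k1.le
    linarith only [this]
  have q5 : f * (a1 * D) ≤ (N0 + 3 * m) * D * f := by
    have : f * (a1 * D) ≤ f * ((N0 + 3 * m) * D) := by gcongr; linarith [h.a1l]
    linarith
  have q6 : m * (a1 * D) ≤ a1 * D := by
    have : m * (a1 * D) ≤ 1 * (a1 * D) := by gcongr; linarith [h.ms]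
    linarith
  have q7 : m ^ 2 * (a1 * D) ≤ a1 * D := by
    have : m ^ 2 * (a1 * D) ≤ 1 * (a1 * D) := by gcongr; linarith [h.ms]
    linarith
  have q8 : 1000 * (m ^ 4 * f1) ≤ m ^ 2 * f1 := by
    have := mul_le_mul_of_nonneg_right (by linarith only [c4, c5, c3, c1] : 1000 * m ^ 4 ≤ m ^ 2) hf1
    linarith only [this]
  have r1 : 0 ≤ m ^ 3 * β * a1 := by positivity
  have r2 : 0 ≤ y * (m ^ 2 * a1) := by positivity
  have r3 : 0 ≤ y * D := by positivity
  have r4 : 0 ≤ N1 * f1 := by positivity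
  have r5 : 0 ≤ m ^ 2 * f1 := by positivity
  have r6 : 0 ≤ N1 * f2 := by positivity
  have r7 : 0 ≤ m ^ 2 * f2 := by positivity
  have r8 : 0 ≤ (N0 + 3 * m) * m ^ 2 * a1 * f := by positivity
  have r9 : 0 ≤ (N0 + 3 * m) * D * f := by positivity
  have r10 : 0 ≤ m ^ 2 * k := by positivity
  have r11 : 0 ≤ a1 * D := by positivity
  linarith only [q1, q2, q3, q4, q5, q6, q7, q8, r1, r2, r3, r4, r5, r6, r7, r8, r9, r10, r11]

end Pt
end

noncomputable section

set_option linter.unusedVariables false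

lemma young1 (x y : ℝ) : x * y ≤ x ^ 2 + y ^ 2 / 4 := by nlinarith [sq_nonneg (x - y / 2)]

/-- The good quantity on the right-hand side. -/
def Gq (m N0 N1 f S a1 D y : ℝ) : ℝ :=
  m ^ 2 * (m ^ 2 + N0 + N1) * S + m ^ 4 * D * f ^ 2 + m ^ 2 * (m ^ 2 + N0) * f ^ 2 * a1
    + y ^ 2 * (m ^ 4 * a1 + m ^ 2 * D)

lemma beta_sq {m B θ l β a1 : ℝ} (m0 : 0 < m) (thp : 0 < θ) (lp : 0 ≤ l) (hβ : 0 < β)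
    (a1p : 0 < a1) (bB : |β - B| ≤ l * (θ / (6 * m))) (la : l ^ 2 * a1 ≤ 83 / m) :
    m ^ 2 * β ^ 2 * a1 ≤ 2 * (m ^ 2 * B ^ 2 * a1) + 5 * (θ ^ 2 / m) := by
  have h1 : β ≤ B + l * (θ / (6 * m)) := by linarith [(abs_le.mp bB).2]
  have h0 : 0 ≤ l * (θ / (6 * m)) := by positivity
  have h2 : β ^ 2 ≤ 2 * B ^ 2 + 2 * (l * (θ / (6 * m))) ^ 2 := by
    have : β ^ 2 ≤ (B + l * (θ / (6 * m))) ^ 2 := by gcongr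
    nlinarith [sq_nonneg (B - l * (θ / (6 * m)))]
  have h3 : m ^ 2 * a1 * (l * (θ / (6 * m))) ^ 2 ≤ 83 / 36 * (θ ^ 2 / m) := by
    have e : m ^ 2 * a1 * (l * (θ / (6 * m))) ^ 2 = θ ^ 2 / 36 * (l ^ 2 * a1) := by field_simp; ring
    rw [e]
    have := mul_le_mul_of_nonneg_left la (by positivity : 0 ≤ θ ^ 2 / 36)
    refine this.trans (le_of_eq (by field_simp))
  have h4 := mul_le_mul_of_nonneg_left h2 (by positivity : 0 ≤ m ^ 2 * a1)
  have : 0 ≤ θ ^ 2 / m := by positivity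
  linarith

set_option maxHeartbeats 400000 in
lemma xi_num {m N0 N1 f f1 f2 β a1 D k y B θ l : ℝ} (m0 : 0 < m) (ms : m ≤ 1 / 10 ^ 8)
    (hN0 : 0 ≤ N0) (n0 : N0 ≤ 1) (hN1 : 0 ≤ N1) (hf : 0 ≤ f) (hf1 : 0 ≤ f1) (hf2 : 0 ≤ f2)
    (hy : 0 ≤ y) (hβ : 0 < β) (a1p : 0 < a1) (a1l : a1 ≤ 5 * m ^ 3) (Dp : 0 < D)
    (Dl : D ≤ 5 * m ^ 2) (Dth : D ≤ θ / (6 * m)) (hk : 0 < k) (Bp : 0 < B) (thp : 0 < θ) (lp : 0 ≤ l)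
    (bB : |β - B| ≤ l * (θ / (6 * m))) (la : l ^ 2 * a1 ≤ 83 / m) :
    7500 * m ^ 2 * (f1 + f2) * Xi m N0 N1 f f1 f2 β a1 D k y
      ≤ 400000000 * Gq m N0 N1 f (f1 ^ 2 + f2 ^ 2) a1 D y + m ^ 8 * B ^ 2 * a1
        + m * θ ^ 2 * a1 + m ^ 2 * k ^ 2 := by
  obtain ⟨S, hS⟩ : ∃ S, S = f1 ^ 2 + f2 ^ 2 := ⟨_, rfl⟩
  obtain ⟨g, hg⟩ : ∃ g, g = f1 + f2 := ⟨_, rfl⟩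
  have hgS : g ^ 2 ≤ 2 * S := by rw [hg, hS]; linarith only [sq_nonneg (f1 - f2)]
  have hg0 : 0 ≤ g := by rw [hg]; positivity
  have hS0 : 0 ≤ S := by rw [hS]; positivity
  have c1 : 0 < m ^ 2 := by positivity
  have c2 : m ^ 2 ≤ m / 10 ^ 8 := by nlinarith
  have c3 : m ^ 3 ≤ m ^ 2 / 10 ^ 8 := by nlinarith
  have c3' : 0 < m ^ 3 := by positivity
  have T1 : m ^ 2 * g * ((N0 + 3 * m) * m ^ 2 * a1 * f)
      ≤ m ^ 4 * S + m ^ 2 * (m ^ 2 + N0) * f ^ 2 * a1 := by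
    have e : m ^ 2 * g * ((N0 + 3 * m) * m ^ 2 * a1 * f) = m ^ 4 * a1 * (N0 + 3 * m) * (f * g) := by ring
    have y1 : f * g ≤ f ^ 2 / 2 + S := by linarith only [sq_nonneg (f - g), hgS]
    have y2 := mul_le_mul_of_nonneg_left y1 (by positivity : 0 ≤ m ^ 4 * a1 * (N0 + 3 * m))
    have y3 : m ^ 4 * a1 * (N0 + 3 * m) * S ≤ m ^ 4 * S := by
      have : a1 * (N0 + 3 * m) ≤ 1 := by
        have : a1 * (N0 + 3 * m) ≤ 1 / 2 * 2 := by gcongr <;> linarith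
        linarith
      have := mul_le_mul_of_nonneg_right this (by positivity : 0 ≤ m ^ 4 * S)
      linarith only [this]
    have y4 : m ^ 4 * a1 * (N0 + 3 * m) * (f ^ 2 / 2) ≤ m ^ 2 * (m ^ 2 + N0) * f ^ 2 * a1 := by
      have : m ^ 2 * (N0 + 3 * m) ≤ 2 * (m ^ 2 + N0) := by
        have := mul_le_mul_of_nonneg_right (by linarith only [c2, ms] : m ^ 2 ≤ 1) hN0
        linarith only [this, c3, hN0, c1]
      have := mul_le_mul_of_nonneg_right this (by positivity : 0 ≤ m ^ 2 * f ^ 2 * a1 / 2)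
      linarith only [this]
    linarith only [e, y2, y3, y4]
  have T2 : m ^ 2 * g * ((N0 + 3 * m) * D * f)
      ≤ 2 * (m ^ 4 * D * f ^ 2) + 15 * (m ^ 2 * (m ^ 2 + N0) * S) := by
    have y1 : 2 * ((m ^ 2 * f) * (N0 * g)) ≤ (m ^ 2 * f) ^ 2 + (N0 * g) ^ 2 := by
      linarith only [sq_nonneg (m ^ 2 * f - N0 * g)]
    have y2 := mul_le_mul_of_nonneg_left y1 Dp.le
    have y3 : D * (N0 * g) ^ 2 ≤ 5 * m ^ 2 * (N0 * (2 * S)) := by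
      have : (N0 * g) ^ 2 ≤ N0 * (2 * S) := by
        have : (N0 * g) ^ 2 = N0 * (N0 * g ^ 2) := by ring
        rw [this]
        have : N0 * g ^ 2 ≤ 1 * (2 * S) := by gcongr
        have := mul_le_mul_of_nonneg_left this hN0
        linarith only [this]
      gcongr
    have y4 : 2 * ((m * f) * g) ≤ (m * f) ^ 2 + 2 * S := by linarith only [sq_nonneg (m * f - g), hgS]
    have y5 := mul_le_mul_of_nonneg_left y4 (by positivity : 0 ≤ 3 / 2 * m ^ 2 * D)
    have y6 : m ^ 2 * D * S ≤ m ^ 2 * (5 * m ^ 2) * S := by gcongr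
    have y7 : 0 ≤ m ^ 2 * N0 * S := by positivity
    have y8 : 0 ≤ m ^ 4 * D * f ^ 2 := by positivity
    linarith only [y2, y3, y5, y6, y7, y8]
  have T3 := young1 (7500 * m ^ 2 * g) (m ^ 3 * β * a1)
  have T4 := young1 (7500 * m ^ 2 * g) (m ^ 2 * k)
  have T5 := young1 (7500 * m ^ 2 * g) (a1 * D)
  have T6 : m ^ 2 * g * (y * (m ^ 2 * a1 + D)) ≤ y ^ 2 * (m ^ 4 * a1 + m ^ 2 * D) + 6 * (m ^ 4 * S) := by
    have y1 : g * y ≤ y ^ 2 / 2 + S := by linarith only [sq_nonneg (y - g), hgS]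
    have y2 := mul_le_mul_of_nonneg_left y1 (by positivity : 0 ≤ m ^ 2 * (m ^ 2 * a1 + D))
    have y3 : m ^ 2 * a1 + D ≤ 6 * m ^ 2 := by
      have : m ^ 2 * a1 ≤ m ^ 2 * 1 := by gcongr; linarith
      linarith
    have y4 := mul_le_mul_of_nonneg_right y3 (by positivity : 0 ≤ m ^ 2 * S)
    have : 0 ≤ y ^ 2 * (m ^ 4 * a1 + m ^ 2 * D) := by positivity
    linarith only [y2, y4, this]
  have T7 : m ^ 2 * g * ((N1 + m ^ 2) * (f1 + f2)) ≤ 2 * (m ^ 2 * (m ^ 2 + N1) * S) := by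
    rw [← hg]
    have := mul_le_mul_of_nonneg_left hgS (by positivity : 0 ≤ m ^ 2 * (N1 + m ^ 2))
    linarith only [this]
  have G2 : (7500 * m ^ 2 * g) ^ 2 ≤ 112500000 * (m ^ 4 * S) := by
    have := mul_le_mul_of_nonneg_left hgS (by positivity : 0 ≤ 56250000 * m ^ 4)
    linarith only [this]
  have b1 : (m ^ 3 * β * a1) ^ 2 ≤ m ^ 8 * B ^ 2 * a1 + m * θ ^ 2 * a1 := by
    have w1 := beta_sq m0 thp lp hβ a1p bB la
    have w2 : (m ^ 3 * β * a1) ^ 2 = m ^ 4 * a1 * (m ^ 2 * β ^ 2 * a1) := by ring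
    have w3 := mul_le_mul_of_nonneg_left w1 (by positivity : 0 ≤ m ^ 4 * a1)
    have w4 : 2 * a1 ≤ m ^ 2 := by linarith
    have w5 := mul_le_mul_of_nonneg_right w4 (by positivity : 0 ≤ m ^ 6 * B ^ 2 * a1)
    have w6 : m ^ 4 * a1 * (5 * (θ ^ 2 / m)) ≤ m * θ ^ 2 * a1 := by
      have : m ^ 4 * a1 * (5 * (θ ^ 2 / m)) = 5 * m ^ 3 * θ ^ 2 * a1 := by field_simp
      rw [this]
      have : 5 * m ^ 3 ≤ m := by linarith
      gcongr
    linarith only [w2, w3, w5, w6]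
  have b2 : (a1 * D) ^ 2 ≤ m * θ ^ 2 * a1 := by
    have w1 : D ^ 2 ≤ (θ / (6 * m)) ^ 2 := by gcongr
    have w2 : (a1 * D) ^ 2 ≤ a1 * (5 * m ^ 3) * (θ / (6 * m)) ^ 2 := by
      rw [mul_pow, sq a1]; gcongr
    have e : a1 * (5 * m ^ 3) * (θ / (6 * m)) ^ 2 = 5 / 36 * (m * θ ^ 2 * a1) := by field_simp; ring
    rw [e] at w2
    have : 0 ≤ m * θ ^ 2 * a1 := by positivity
    linarith
  have b3 : (m ^ 2 * k) ^ 2 ≤ m ^ 2 * k ^ 2 := by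
    have : m ^ 2 ≤ 1 := by linarith
    have := mul_le_mul_of_nonneg_right this (by positivity : 0 ≤ m ^ 2 * k ^ 2)
    linarith only [this]
  unfold Gq Xi
  rw [← hS]
  rw [← hg] at *
  have z1 : 0 ≤ m ^ 4 * S := by positivity
  have z2 : 0 ≤ m ^ 2 * N0 * S := by positivity
  have z3 : 0 ≤ m ^ 2 * N1 * S := by positivity
  have z4 : 0 ≤ m ^ 4 * D * f ^ 2 := by positivity
  have z5 : 0 ≤ m ^ 2 * (m ^ 2 + N0) * f ^ 2 * a1 := by positivity
  have z6 : 0 ≤ y ^ 2 * (m ^ 4 * a1 + m ^ 2 * D) := by positivity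
  have z7 : 0 ≤ m ^ 2 * k ^ 2 := by positivity
  have z8 : 0 ≤ m * θ ^ 2 * a1 := by positivity
  have z9 : 0 ≤ m ^ 8 * B ^ 2 * a1 := by positivity
  linarith only [T1, T2, T3, T4, T5, T6, T7, G2, b1, b2, b3, z1, z2, z3, z4, z5, z6, z7, z8, z9]

end

noncomputable section

def Sone (φ φ1 a a1 a2 b m D D1 Y : ℝ) : ℝ :=
  -3 * (φ + a + b - m) ^ 2 * (a2 + D1) - 6 * (φ + a + b - m) * (φ1 + (a1 + D)) ^ 2
      + 3 * a ^ 2 * a2 + 6 * a * a1 ^ 2 + 3 * b ^ 2 * D1 + 6 * b * D ^ 2 - Y * (a2 + D1)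
      + 3 * (φ + a + b - m) * (φ1 + (a1 + D)) * φ1

def Stwo (φ φ1 φ2 a a1 a2 a3 b m D D1 D2 Y : ℝ) : ℝ :=
  -3 * (φ + a + b - m) ^ 2 * (a3 + D2)
      - 18 * (φ + a + b - m) * (φ1 + (a1 + D)) * (φ2 + (a2 + D1)) - 6 * (φ1 + (a1 + D)) ^ 3
      + 3 * a ^ 2 * a3 + 18 * a * a1 * a2 + 6 * a1 ^ 3 + 3 * b ^ 2 * D2 + 18 * b * D * D1 + 6 * D ^ 3
      - Y * (a3 + D2) + 3 * (φ + a + b - m) * (φ1 + (a1 + D)) * φ2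

def qtwo (m a a1 a2 : ℝ) : ℝ := 6 * a * a1 ^ 2 + 3 * (a ^ 2 - m ^ 2) * a2

def qthree (m a a1 a2 a3 : ℝ) : ℝ := 6 * a1 ^ 3 + 18 * a * a1 * a2 + 3 * (a ^ 2 - m ^ 2) * a3

/-- First part of the residual. -/
def Res1 (m τ φ φ1 φ2 a a1 a2 a3 b D D1 D2 D3 R1 R2 Y ω ω1 : ℝ) : ℝ :=
  ω * (-R1 ^ 2 - R2 ^ 2 + φ1 * Sone φ φ1 a a1 a2 b m D D1 Y
      + φ2 * Stwo φ φ1 φ2 a a1 a2 a3 b m D D1 D2 Y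
      + R1 * (-(τ * Y * qtwo m a a1 a2) + D1 - τ * (3 * m ^ 2) * D2)
      + R2 * (-(τ * Y * qthree m a a1 a2 a3) + D2 - τ * (3 * m ^ 2) * D3))
  + ω1 * (1 / 2 * (Y - 3 * m ^ 2) * (φ1 ^ 2 + φ2 ^ 2 + τ * R1 ^ 2 + τ * R2 ^ 2) - φ1 * R1 - φ2 * R2
      + 3 / 2 * (φ + a + b - m) ^ 2 * (φ1 ^ 2 + φ2 ^ 2))

namespace Pt
variable {m τ N0 N1 φ φ1 a a1 a2 a3 b D D1 D2 D3 κ B Bt θ Y ω ω1 l : ℝ}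

lemma la (h : Pt m τ N0 N1 φ φ1 a a1 a2 a3 b D D1 D2 D3 κ B Bt θ Y ω ω1 l) : l ^ 2 * a1 ≤ 83 / m := by
  have h1 := h.dec
  have h2 := mul_le_mul_of_nonneg_left h.cmp1 (sq_nonneg l)
  have h3 : 80 / m = 80 * (1 / m) := by ring
  have h4 : 83 / m = 83 * (1 / m) := by ring
  have : 0 < 1 / m := by have := h.m0; positivity
  rw [h3] at h1
  rw [h4]
  linarith only [h1, h2, this]

lemma qb (h : Pt m τ N0 N1 φ φ1 a a1 a2 a3 b D D1 D2 D3 κ B Bt θ Y ω ω1 l) :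
    |qtwo m a a1 a2| ≤ m * a1 ∧ |qthree m a a1 a2 a3| ≤ m * a1 := by
  have hm := h.m0; have ha1 := h.a1p; have ms := h.ms
  obtain ⟨c1, c2, c3, c4, c5, c6⟩ := h.bas
  have ha : |a| ≤ 2 * m := abs_le.mpr ⟨by linarith [h.alo], by linarith [h.ahi]⟩
  have haa : |a ^ 2 - m ^ 2| ≤ 3 * m ^ 2 := by
    have : a ^ 2 ≤ (2 * m) ^ 2 := by rw [← sq_abs a]; gcongr
    rw [abs_le]
    constructor <;> nlinarith
  have aa : |a1 * a1| ≤ 5 * m ^ 3 * a1 := by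
    rw [abs_of_pos (by positivity)]; exact mul_le_mul_of_nonneg_right h.a1l ha1.le
  have hp : 0 < m ^ 2 * a1 := by positivity
  have p3 : m ^ 4 * a1 ≤ m ^ 3 * a1 / 10 ^ 8 := by
    have := mul_le_mul_of_nonneg_right c5 ha1.le; linarith
  have p2 : m ^ 3 * a1 ≤ m ^ 2 * a1 / 10 ^ 8 := by
    have := mul_le_mul_of_nonneg_right c4 ha1.le; linarith
  have p1 : m ^ 2 * a1 ≤ m * a1 / 10 ^ 8 := by
    have := mul_le_mul_of_nonneg_right c2 ha1.le; linarith
  have a1u : |a1| ≤ 1 := by rw [abs_of_pos ha1]; linarith [h.a1l]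
  have ha3 : |a3| ≤ a1 := h.a3b.trans ((mul_le_mul_of_nonneg_right (by linarith : 200 * m ^ 4 ≤ 1) ha1.le).trans (one_mul _).le)
  have ha2 : |a2| ≤ a1 := h.a2b.trans ((mul_le_mul_of_nonneg_right (by linarith : 10 * m ^ 2 ≤ 1) ha1.le).trans (one_mul _).le)
  have aa2 : |a1 * a2| ≤ 5 * m ^ 3 * a1 :=
    (bM (abs_of_pos ha1).le ha2).trans (mul_le_mul_of_nonneg_right h.a1l ha1.le)
  constructor
  · have e : qtwo m a a1 a2 = 6 * (a * (a1 * a1)) + 3 * ((a ^ 2 - m ^ 2) * a2) := by unfold qtwo; ring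
    rw [e]
    refine (bA (bC 6 (bM ha aa)) (bC 3 (bM haa ha2))).trans ?_
    simp only [Nat.abs_ofNat]
    linarith only [p1, p2, p3, hp]
  · have e : qthree m a a1 a2 a3 = 6 * (a1 * (a1 * a1)) + 18 * (a * (a1 * a2)) + 3 * ((a ^ 2 - m ^ 2) * a3) := by unfold qthree; ring
    rw [e]
    refine (bA (bA (bC 6 (bM a1u aa)) (bC 18 (bM ha aa2))) (bC 3 (bM haa ha3))).trans ?_
    simp only [Nat.abs_ofNat]
    linarith only [p1, p2, p3, hp]


lemma Rz {ω R Z q y k c : ℝ} (hω : 0 ≤ ω) (hZ : |Z| ≤ y * q + c * k) :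
    ω * (R * Z) ≤ ω * R ^ 2 / 4 + ω * (2 * (y * q) ^ 2 + 2 * (c * k) ^ 2) := by
  have h1 : Z ^ 2 ≤ (y * q + c * k) ^ 2 := by rw [← sq_abs Z]; gcongr
  have h2 : R * Z ≤ R ^ 2 / 4 + (2 * (y * q) ^ 2 + 2 * (c * k) ^ 2) := by
    linarith only [h1, sq_nonneg (R / 2 - Z), sq_nonneg (y * q - c * k)]
  have := mul_le_mul_of_nonneg_left h2 hω
  linarith only [this]

lemma res1_b (h : Pt m τ N0 N1 φ φ1 a a1 a2 a3 b D D1 D2 D3 κ B Bt θ Y ω ω1 l) (φ2 R1 R2 : ℝ) :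
    Res1 m τ φ φ1 φ2 a a1 a2 a3 b D D1 D2 D3 R1 R2 Y ω ω1
      ≤ -(7 / 10) * (ω * (R1 ^ 2 + R2 ^ 2)) - ω * (D1 ^ 2 + D2 ^ 2)
        + 500000000 * Gq m N0 N1 φ (φ1 ^ 2 + φ2 ^ 2) a1 D Y + m ^ 8 * B ^ 2 * a1
        + m * θ ^ 2 * a1 + 20000 * (m ^ 2 * (D * κ) ^ 2) := by
  have hm := h.m0; have ha1 := h.a1p; have ms := h.ms; have hD := h.Dp
  obtain ⟨c1, c2, c3, c4, c5, c6⟩ := h.bas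
  obtain ⟨k1, k2⟩ := h.kD
  have wlo := h.wlo; have whi := h.whi
  have hω : 0 < ω := by linarith
  have hN0 := h.N0n; have hN1 := h.N1n
  have t0 := h.t0; have t1 := h.t1
  -- part one
  have P1 : ω * (φ1 * Sone φ φ1 a a1 a2 b m D D1 Y + φ2 * Stwo φ φ1 φ2 a a1 a2 a3 b m D D1 D2 Y)
      ≤ 400000000 * Gq m N0 N1 φ (φ1 ^ 2 + φ2 ^ 2) a1 D Y + m ^ 8 * B ^ 2 * a1
        + m * θ ^ 2 * a1 + m ^ 2 * (D * κ) ^ 2 := by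
    have s1 : |Sone φ φ1 a a1 a2 b m D D1 Y| ≤ _ := h.S1b φ2
    have s2 : |Stwo φ φ1 φ2 a a1 a2 a3 b m D D1 D2 Y| ≤ _ := h.S2b φ2
    have := xi_num (f := |φ|) (f1 := |φ1|) (f2 := |φ2|) (y := |Y|) (β := b - m) hm ms hN0 h.n0 hN1 (abs_nonneg _)
      (abs_nonneg _) (abs_nonneg _) (abs_nonneg _) (by linarith [h.blo]) ha1 h.a1l hD h.Dl2 h.Dth k1 h.Bp h.thp
      h.lp h.bB h.la
    simp only [sq_abs, Gq] at this
    refine le_trans ?_ this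
    set Ξ := Xi m N0 N1 |φ| |φ1| |φ2| (b - m) a1 D (D * κ) |Y|
    have hΞ : 0 ≤ Ξ := by linarith [abs_nonneg (Sone φ φ1 a a1 a2 b m D D1 Y)]
    have e1 := (le_abs_self _).trans (bM (le_refl |φ1|) s1)
    have e2 := (le_abs_self _).trans (bM (le_refl |φ2|) s2)
    have h0 : 0 ≤ (|φ1| + |φ2|) * (1000 * Ξ) := by positivity
    have := mul_le_mul_of_nonneg_left (add_le_add e1 e2) hω.le
    have := mul_le_mul_of_nonneg_right whi h0
    linarith
  -- part two
  obtain ⟨q2, q3⟩ := h.qb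
  have hm2 : τ * (3 * m ^ 2) ≤ 1 / 1000 := by
    have := mul_le_mul_of_nonneg_right t1 (by positivity : 0 ≤ 3 * m ^ 2)
    linarith
  have hm0 : 0 ≤ τ * (3 * m ^ 2) := by positivity
  have D2b := h.D2b; have D1b := h.D1b; have D3b := h.D3b
  have hτY : |τ * Y| ≤ |Y| := by
    rw [abs_mul, abs_of_pos t0]
    have := mul_le_mul_of_nonneg_right t1 (abs_nonneg Y)
    linarith
  have Z1 : |-(τ * Y * qtwo m a a1 a2) + D1 - τ * (3 * m ^ 2) * D2| ≤ |Y| * (m * a1) + 4 * (D * κ) := by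
    have := bS (bA ((abs_neg _).le.trans (bM hτY q2)) D1b) (bM ((abs_of_nonneg hm0).le.trans hm2) D2b)
    linarith
  have Z2 : |-(τ * Y * qthree m a a1 a2 a3) + D2 - τ * (3 * m ^ 2) * D3| ≤ |Y| * (m * a1) + 22 * (D * κ) := by
    have := bS (bA ((abs_neg _).le.trans (bM hτY q3)) D2b) (bM ((abs_of_nonneg hm0).le.trans hm2) D3b)
    linarith
  have P2 := Rz (R := R1) hω.le Z1
  have P3 := Rz (R := R2) hω.le Z2
  have y1 : ω * (|Y| * (m * a1)) ^ 2 ≤ Y ^ 2 * (m ^ 4 * a1) := by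
    rw [mul_pow, sq_abs]
    have w1 : ω * a1 ≤ m ^ 2 := by
      have : ω * a1 ≤ (15 / 2 * m ^ 2) * (1 / 10) := by
        gcongr; linarith [h.a1l]
      linarith
    have := mul_le_mul_of_nonneg_right w1 (by positivity : 0 ≤ Y ^ 2 * (m ^ 2 * a1))
    linarith only [this]
  have y2 : ω * (D * κ) ^ 2 ≤ 15 / 2 * m ^ 2 * (D * κ) ^ 2 := by gcongr
  have y3 : ω * D1 ^ 2 ≤ ω * (9 * (D * κ) ^ 2) := by
    have : D1 ^ 2 ≤ (3 * (D * κ)) ^ 2 := by rw [← sq_abs D1]; gcongr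
    exact mul_le_mul_of_nonneg_left (by linarith) hω.le
  have y4 : ω * D2 ^ 2 ≤ ω * (441 * (D * κ) ^ 2) := by
    have : D2 ^ 2 ≤ (21 * (D * κ)) ^ 2 := by rw [← sq_abs D2]; gcongr
    exact mul_le_mul_of_nonneg_left (by linarith) hω.le
  -- part three
  have P4 : ω1 * (1 / 2 * (Y - 3 * m ^ 2) * (φ1 ^ 2 + φ2 ^ 2 + τ * R1 ^ 2 + τ * R2 ^ 2) - φ1 * R1 - φ2 * R2
      + 3 / 2 * (φ + a + b - m) ^ 2 * (φ1 ^ 2 + φ2 ^ 2))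
      ≤ 13 * m ^ 4 * (3 * (φ1 ^ 2 + φ2 ^ 2) + (R1 ^ 2 + R2 ^ 2)) := by
    have w : |ω1| ≤ 13 * m ^ 4 := by
      have := mul_le_mul_of_nonneg_left h.a1l (by positivity : 0 ≤ 5 / 2 * m)
      linarith [h.w1b]
    refine (le_abs_self _).trans (bM w ?_)
    have hY : |1 / 2 * (Y - 3 * m ^ 2)| ≤ 1 / 10 := by
      obtain ⟨u1, u2⟩ := abs_le.mp h.Yb
      rw [abs_le]; constructor <;> linarith
    have hq : 0 ≤ φ1 ^ 2 + φ2 ^ 2 + τ * R1 ^ 2 + τ * R2 ^ 2 := by positivity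
    have w1 := bM hY (abs_of_nonneg hq).le
    have hU : (φ + a + b - m) ^ 2 ≤ 1.1 ^ 2 := by
      rw [← sq_abs]; have := h.UP'; gcongr
    have hS : 0 ≤ φ1 ^ 2 + φ2 ^ 2 := by positivity
    have w2 : |3 / 2 * (φ + a + b - m) ^ 2 * (φ1 ^ 2 + φ2 ^ 2)| ≤ 3 / 2 * 1.1 ^ 2 * (φ1 ^ 2 + φ2 ^ 2) := by
      rw [abs_of_nonneg (by positivity)]; gcongr
    have w3 : |φ1 * R1| ≤ φ1 ^ 2 / 2 + R1 ^ 2 / 2 := by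
      rw [abs_le]; constructor <;> linarith only [sq_nonneg (φ1 - R1), sq_nonneg (φ1 + R1)]
    have w4 : |φ2 * R2| ≤ φ2 ^ 2 / 2 + R2 ^ 2 / 2 := by
      rw [abs_le]; constructor <;> linarith only [sq_nonneg (φ2 - R2), sq_nonneg (φ2 + R2)]
    refine (bA (bS (bS w1 w3) w4) w2).trans ?_
    have u1 : τ * R1 ^ 2 ≤ 1 * R1 ^ 2 := by gcongr
    have u2 : τ * R2 ^ 2 ≤ 1 * R2 ^ 2 := by gcongr
    linarith only [u1, u2, sq_nonneg φ1, sq_nonneg φ2, sq_nonneg R1, sq_nonneg R2]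
  have P5 : 13 * m ^ 4 * (R1 ^ 2 + R2 ^ 2) ≤ 1 / 100 * (ω * (R1 ^ 2 + R2 ^ 2)) := by
    have : 13 * m ^ 4 ≤ 1 / 100 * ω := by linarith
    have := mul_le_mul_of_nonneg_right this (by positivity : 0 ≤ R1 ^ 2 + R2 ^ 2)
    linarith only [this]
  have hR : 0 ≤ ω * (R1 ^ 2 + R2 ^ 2) := by positivity
  have g1 : 0 ≤ m ^ 2 * (N0 + N1) * (φ1 ^ 2 + φ2 ^ 2) := by positivity
  have g2 : 0 ≤ m ^ 4 * D * φ ^ 2 := by positivity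
  have g3 : 0 ≤ m ^ 2 * (m ^ 2 + N0) * φ ^ 2 * a1 := by positivity
  have g4 : 0 ≤ Y ^ 2 * (m ^ 4 * a1) := by positivity
  have g5 : 0 ≤ Y ^ 2 * (m ^ 2 * D) := by positivity
  have g6 : 0 ≤ m ^ 4 * (φ1 ^ 2 + φ2 ^ 2) := by positivity
  have g7 : 0 ≤ m ^ 2 * (D * κ) ^ 2 := by positivity
  unfold Res1
  unfold Gq at *
  generalize Sone φ φ1 a a1 a2 b m D D1 Y = s1 at *
  generalize Stwo φ φ1 φ2 a a1 a2 a3 b m D D1 D2 Y = s2 at *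
  generalize -(τ * Y * qtwo m a a1 a2) + D1 - τ * (3 * m ^ 2) * D2 = z1 at *
  generalize -(τ * Y * qthree m a a1 a2 a3) + D2 - τ * (3 * m ^ 2) * D3 = z2 at *
  generalize ω1 * (1 / 2 * (Y - 3 * m ^ 2) * (φ1 ^ 2 + φ2 ^ 2 + τ * R1 ^ 2 + τ * R2 ^ 2) - φ1 * R1 - φ2 * R2
      + 3 / 2 * (φ + a + b - m) ^ 2 * (φ1 ^ 2 + φ2 ^ 2)) = x at *
  generalize D * κ = k at *
  linarith only [P1, P2, P3, P4, P5, y1, y2, y3, y4, hR, g1, g2, g3, g4, g5, g6, g7]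

end Pt
end

noncomputable section

def gps (m a : ℝ) : ℝ := a * (a + 2 * m) ^ 2 * (m - a) ^ 2
def gps' (m a : ℝ) : ℝ := (a + 2 * m) * (m - a) * (2 * m ^ 2 - 3 * a * m - 5 * a ^ 2)
def cbar (m : ℝ) : ℝ := 54 / 35 * m ^ 6
def HH (m a β : ℝ) : ℝ := 3 * (a ^ 2 - m ^ 2) * β + 3 * (a - m) * β ^ 2

/-- Second part of the residual. -/
def Res2 (m φ a a1 b D R1 Y B Bt : ℝ) : ℝ :=
  m ^ 2 * (Bt * φ * gps m a + B * (Y - 3 * m ^ 2) * φ * (gps' m a * a1) - B * Y * (a1 + D) * gps m a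
    + B * R1 * gps m a + B * ((φ + a + b - m) ^ 3 - (a + b - m) ^ 3) * (gps' m a * a1)
    + B * (HH m a (b - m) - HH m a B) * (gps' m a * a1) - 6 * B ^ 2 * cbar m * a1
    - 3 * B ^ 3 * a1 * gps m a)

/-- The total residual. -/
def Res (m τ φ φ1 φ2 a a1 a2 a3 b D D1 D2 D3 κ R1 R2 Y ω ω1 B Bt θ : ℝ) : ℝ :=
  Res1 m τ φ φ1 φ2 a a1 a2 a3 b D D1 D2 D3 R1 R2 Y ω ω1 + Res2 m φ a a1 b D R1 Y B Bt
    + (7 * m ^ 4 * Bt - 1000 * m * θ ^ 2) * a1 - 1000 * ((6 * b * D) ^ 2 * κ)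

namespace Pt
variable {m τ N0 N1 φ φ1 a a1 a2 a3 b D D1 D2 D3 κ B Bt θ Y ω ω1 l : ℝ}

lemma gb (h : Pt m τ N0 N1 φ φ1 a a1 a2 a3 b D D1 D2 D3 κ B Bt θ Y ω ω1 l) :
    |gps m a| ≤ 4 * (m ^ 2 * a1) ∧ |gps' m a| ≤ 12 * m ^ 2 * ((a + 2 * m) * (m - a)) ∧
     (a + 2 * m) * (m - a) ≤ 9 / 4 * m ^ 2 ∧ 0 < (a + 2 * m) * (m - a) := by
  have hm := h.m0; have ha1 := h.a1p
  have x1 : 0 < a + 2 * m := by linarith [h.alo]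
  have x2 : 0 < m - a := by linarith [h.ahi]
  have hh : 0 < (a + 2 * m) * (m - a) := by positivity
  refine ⟨?_, ?_, ?_, hh⟩
  · have e : gps m a = (a * (a + 2 * m)) * ((a + 2 * m) * (m - a) ^ 2) := by unfold gps; ring
    rw [e]
    have w1 : |a * (a + 2 * m)| ≤ 3 * m ^ 2 := by
      rw [abs_le]; constructor <;> nlinarith
    have w2 : |(a + 2 * m) * (m - a) ^ 2| ≤ 1.04 * a1 := by
      rw [abs_of_pos (by positivity)]; exact h.cmp2
    refine (bM w1 w2).trans ?_
    have : 0 < m ^ 2 * a1 := by positivity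
    linarith
  · have w1 : |2 * m ^ 2 - 3 * a * m - 5 * a ^ 2| ≤ 12 * m ^ 2 := by
      rw [abs_le]; constructor <;> nlinarith
    have := bM (abs_of_pos hh).le w1
    unfold gps'
    linarith
  · nlinarith [sq_nonneg (2 * a + m)]

lemma res2_b (h : Pt m τ N0 N1 φ φ1 a a1 a2 a3 b D D1 D2 D3 κ B Bt θ Y ω ω1 l) (S R1 : ℝ) (hS : 0 ≤ S) :
    Res2 m φ a a1 b D R1 Y B Bt + 7 * m ^ 4 * Bt * a1
      ≤ 1 / 10 * (ω * R1 ^ 2) + 100000 * Gq m N0 N1 φ S a1 D Y - 2 * (m ^ 8 * B ^ 2 * a1)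
        + 500 * (m * θ ^ 2 * a1) := by
  have hm := h.m0; have ha1 := h.a1p; have ms := h.ms; have hD := h.Dp; have a1l := h.a1l
  obtain ⟨c1, c2, c3, c4, c5, c6⟩ := h.bas
  have hN0 := h.N0n; have hN1 := h.N1n; have n0 := h.n0
  have Bp := h.Bp; have Bl := h.Bl; have thp := h.thp
  obtain ⟨g1, g2, g3, hh⟩ := h.gb
  have x1 : 0 < a + 2 * m := by linarith [h.alo]
  have x2 : 0 < m - a := by linarith [h.ahi]
  have g4 : |gps' m a * a1| ≤ 27 * (m ^ 4 * a1) := by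
    refine (bM g2 (abs_of_pos ha1).le).trans ?_
    have := mul_le_mul_of_nonneg_left g3 (by positivity : 0 ≤ 12 * m ^ 2 * a1)
    linarith only [this]
  have hBa : |B| ≤ B := (abs_of_pos Bp).le
  have hfn := abs_nonneg φ; have hyn := abs_nonneg Y
  -- term a
  have Ta : m ^ 2 * (Bt * φ * gps m a) + 7 * m ^ 4 * Bt * a1 ≤ 0 := by
    have w1 : |φ * gps m a| ≤ 1 * (4 * (m ^ 2 * a1)) := bM (h.p0.trans n0) g1
    have w2 := (abs_le.mp w1).1
    have w3 : 0 ≤ φ * gps m a + 7 * (m ^ 2 * a1) := by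
      have : 0 < m ^ 2 * a1 := by positivity
      linarith
    have := mul_nonneg (by linarith [mul_nonneg c1.le (neg_nonneg.mpr h.Btn)] : 0 ≤ m ^ 2 * -Bt) w3
    linarith only [this]
  -- term b
  have Tb : m ^ 2 * (B * (Y - 3 * m ^ 2) * φ * (gps' m a * a1))
      ≤ m ^ 8 * B ^ 2 * a1 + 3000 * (m ^ 4 * φ ^ 2 * a1) + 1000 * (Y ^ 2 * (m ^ 4 * a1)) := by
    have w0 : |Y - 3 * m ^ 2| ≤ |Y| + 3 * m ^ 2 := bS le_rfl (abs_of_pos (by positivity)).le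
    have w1 := (le_abs_self _).trans (bM (bM (bM hBa w0) (le_refl |φ|)) g4)
    have w2 := mul_le_mul_of_nonneg_left w1 c1.le
    have w3 : m ^ 6 * a1 * (B * (|Y| * |φ|)) ≤ m ^ 4 * a1 * (φ ^ 2 + Y ^ 2) := by
      have u1 : |Y| * |φ| ≤ φ ^ 2 + Y ^ 2 := by
        linarith only [sq_nonneg (|Y| - |φ|), sq_abs φ, sq_abs Y, sq_nonneg (|Y|), sq_nonneg (|φ|)]
      have u2 : B * (|Y| * |φ|) ≤ 1 * (φ ^ 2 + Y ^ 2) := by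
        gcongr; linarith
      have u3 : m ^ 6 ≤ m ^ 4 := by
        have : m ^ 2 * m ^ 4 ≤ 1 * m ^ 4 := by gcongr; linarith
        linarith only [this]
      have u4 : m ^ 6 * a1 * (B * (|Y| * |φ|)) ≤ m ^ 6 * a1 * (1 * (φ ^ 2 + Y ^ 2)) := by gcongr
      have u5 := mul_le_mul_of_nonneg_right u3 (by positivity : 0 ≤ a1 * (φ ^ 2 + Y ^ 2))
      linarith only [u4, u5]
    have w4 : 81 * (m ^ 8 * a1 * (B * |φ|)) ≤ m ^ 8 * B ^ 2 * a1 + 2000 * (m ^ 4 * φ ^ 2 * a1) := by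
      have u1 : 81 * (B * |φ|) ≤ B ^ 2 + 2000 * φ ^ 2 := by
        linarith only [sq_nonneg (B - 81 / 2 * |φ|), sq_abs φ, sq_nonneg (|φ|)]
      have u2 := mul_le_mul_of_nonneg_left u1 (by positivity : 0 ≤ m ^ 8 * a1)
      have u3 : m ^ 8 ≤ m ^ 4 := by
        have : m ^ 4 * m ^ 4 ≤ 1 * m ^ 4 := by gcongr; linarith
        linarith only [this]
      have u5 := mul_le_mul_of_nonneg_right u3 (by positivity : 0 ≤ a1 * φ ^ 2)
      linarith only [u2, u5]
    have p1 : 0 ≤ m ^ 4 * φ ^ 2 * a1 := by positivity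
    have p2 : 0 ≤ Y ^ 2 * (m ^ 4 * a1) := by positivity
    linarith only [w2, w3, w4, p1, p2]
  -- term c
  have Tc : m ^ 2 * -(B * Y * (a1 + D) * gps m a) ≤ m ^ 8 * B ^ 2 * a1 + 1000 * (Y ^ 2 * (m ^ 4 * a1)) := by
    have sa : |a1 + D| ≤ 6 * m ^ 2 := by rw [abs_of_pos h.sB.1]; exact h.sB.2
    have w1 := (neg_le_abs _).trans (bM (bM (bM hBa (le_refl |Y|)) sa) g1)
    have w2 := mul_le_mul_of_nonneg_left w1 c1.le
    have w3 : 24 * (m ^ 2 * B * |Y|) ≤ m ^ 4 * B ^ 2 + 1000 * Y ^ 2 := by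
      linarith only [sq_nonneg (m ^ 2 * B - 12 * |Y|), sq_abs Y, sq_nonneg (|Y|)]
    have w4 := mul_le_mul_of_nonneg_left w3 (by positivity : 0 ≤ m ^ 4 * a1)
    linarith only [w2, w4]
  -- term d
  have Td : m ^ 2 * (B * R1 * gps m a) ≤ 1 / 10 * (ω * R1 ^ 2) + m ^ 8 * B ^ 2 * a1 := by
    have w1 := (le_abs_self _).trans (bM (bM hBa (le_refl |R1|)) g1)
    have w2 := mul_le_mul_of_nonneg_left w1 c1.le
    have w3 : 4 * (m * B * a1 * (m * |R1|)) * m ^ 2 ≤ 1 / 10 * (m ^ 2 * R1 ^ 2) + 40 * (m ^ 4 * (m * B * a1) ^ 2) := by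
      have e : (m * |R1|) ^ 2 = m ^ 2 * R1 ^ 2 := by rw [mul_pow, sq_abs]
      linarith only [sq_nonneg (m ^ 2 * (m * B * a1) * 20 - m * |R1|), e]
    have w4 : m ^ 2 * R1 ^ 2 ≤ ω * R1 ^ 2 := by
      have := h.wlo
      gcongr; linarith
    have w5 : 40 * (m ^ 4 * (m * B * a1) ^ 2) ≤ m ^ 8 * B ^ 2 * a1 := by
      have := mul_le_mul_of_nonneg_right (by linarith : 40 * a1 ≤ m ^ 2) (by positivity : 0 ≤ m ^ 6 * B ^ 2 * a1)
      linarith only [this]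
    linarith only [w2, w3, w4, w5]
  -- term e
  have Te : m ^ 2 * (B * ((φ + a + b - m) ^ 3 - (a + b - m) ^ 3) * (gps' m a * a1))
      ≤ m ^ 8 * B ^ 2 * a1 + 20000 * (m ^ 2 * (m ^ 2 + N0) * φ ^ 2 * a1) := by
    have hU := h.UP
    have hu : |a + b - m| ≤ N0 + 3 * m := by
      have e : a + b - m = a + (b - m) := by ring
      rw [e, abs_le]
      constructor <;> linarith [h.alo, h.ahi, h.blo, h.bhi]
    have hN : N0 + 3 * m ≤ 1.1 := by linarith
    have w0 : |(φ + a + b - m) ^ 3 - (a + b - m) ^ 3| ≤ 4 * (N0 + 3 * m) * |φ| := by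
      have e : (φ + a + b - m) ^ 3 - (a + b - m) ^ 3
        = ((φ + a + b - m) * (φ + a + b - m) + (φ + a + b - m) * (a + b - m) + (a + b - m) * (a + b - m)) * φ := by ring
      rw [e]
      refine bM ((bA (bA (bM (hU.trans hN) hU) (bM (hU.trans hN) hu)) (bM (hu.trans hN) hu)).trans ?_) le_rfl
      linarith
    have w1 := (le_abs_self _).trans (bM (bM hBa w0) g4)
    have w2 := mul_le_mul_of_nonneg_left w1 c1.le
    have w3 : 108 * (m ^ 2 * B * ((N0 + 3 * m) * |φ|)) ≤ m ^ 4 * B ^ 2 + 3000 * ((N0 + 3 * m) ^ 2 * φ ^ 2) := by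
      have := sq_nonneg ((N0 + 3 * m) * |φ|)
      have e : ((N0 + 3 * m) * |φ|) ^ 2 = (N0 + 3 * m) ^ 2 * φ ^ 2 := by rw [mul_pow, sq_abs]
      linarith only [sq_nonneg (m ^ 2 * B - 54 * ((N0 + 3 * m) * |φ|)), e, this]
    have w4 := mul_le_mul_of_nonneg_left w3 (by positivity : 0 ≤ m ^ 4 * a1)
    have w5 : m ^ 4 * 3000 * (N0 + 3 * m) ^ 2 ≤ 20000 * (m ^ 2 * (m ^ 2 + N0)) := by
      have u1 : (N0 + 3 * m) ^ 2 ≤ 2 := by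
        have : (N0 + 3 * m) ^ 2 ≤ 1.1 ^ 2 := by gcongr
        linarith
      have u2 := mul_le_mul_of_nonneg_left u1 (by positivity : 0 ≤ 3000 * m ^ 4)
      have u3 : 0 ≤ m ^ 2 * N0 := by positivity
      linarith only [u2, u3, c6]
    have w6 := mul_le_mul_of_nonneg_right w5 (by positivity : 0 ≤ a1 * φ ^ 2)
    linarith only [w2, w4, w6]
  -- term f
  have Tf : m ^ 2 * (B * (HH m a (b - m) - HH m a B) * (gps' m a * a1))
      ≤ m ^ 8 * B ^ 2 * a1 + 500 * (m * θ ^ 2 * a1) := by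
    have hl := h.lp
    have lh : l * ((a + 2 * m) * (m - a)) ≤ 16 := by
      have : (l * ((a + 2 * m) * (m - a))) ^ 2 ≤ 16 ^ 2 := by
        have e : (l * ((a + 2 * m) * (m - a))) ^ 2 = (l ^ 2 * ((a + 2 * m) * (m - a) ^ 2)) * (a + 2 * m) := by ring
        rw [e]
        have : (l ^ 2 * ((a + 2 * m) * (m - a) ^ 2)) * (a + 2 * m) ≤ 80 / m * (3 * m) := by
          have := h.dec
          gcongr; linarith
        refine this.trans ?_
        have : 80 / m * (3 * m) = 240 := by field_simp; norm_num
        rw [this]; norm_num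
      exact le_of_sq_le_sq this (by norm_num)
    have e : HH m a (b - m) - HH m a B = 3 * ((a - m) * ((b - m - B) * (a + b + B))) := by unfold HH; ring
    have k1 : |a - m| ≤ 3 * m := abs_le.mpr ⟨by linarith [h.alo], by linarith [h.ahi]⟩
    have k2 : |a + b + B| ≤ 3 * m := abs_le.mpr ⟨by linarith [h.alo, h.blo], by linarith [h.ahi, h.bhi]⟩
    have w0 : |HH m a (b - m) - HH m a B| ≤ 27 * m ^ 2 * (l * (θ / (6 * m))) := by
      rw [e]
      refine (bC 3 (bM k1 (bM h.bB k2))).trans (le_of_eq ?_)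
      simp only [Nat.abs_ofNat]; ring
    have w1 := (le_abs_self _).trans (bM (bM hBa w0) (bM g2 (abs_of_pos ha1).le))
    have w2 := mul_le_mul_of_nonneg_left w1 c1.le
    have w3 : m ^ 2 * (B * (27 * m ^ 2 * (l * (θ / (6 * m)))) * (12 * m ^ 2 * ((a + 2 * m) * (m - a)) * a1))
      ≤ 864 * (m ^ 5 * B * θ * a1) := by
      have e : m ^ 2 * (B * (27 * m ^ 2 * (l * (θ / (6 * m)))) * (12 * m ^ 2 * ((a + 2 * m) * (m - a)) * a1))
        = 54 * (m ^ 5 * B * θ * a1) * (l * ((a + 2 * m) * (m - a))) := by field_simp; ring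
      rw [e]
      have := mul_le_mul_of_nonneg_left lh (by positivity : 0 ≤ 54 * (m ^ 5 * B * θ * a1))
      linarith only [this]
    have w4 : 864 * (m ^ 4 * B * (m * θ)) ≤ m ^ 8 * B ^ 2 + 200000 * (m ^ 2 * θ ^ 2) := by
      have : 0 ≤ m ^ 2 * θ ^ 2 := by positivity
      linarith only [sq_nonneg (m ^ 4 * B - 432 * (m * θ)), this]
    have w5 := mul_le_mul_of_nonneg_right w4 ha1.le
    have w6 := mul_le_mul_of_nonneg_right (by linarith : 200000 * m ^ 2 ≤ 500 * m) (by positivity : 0 ≤ θ ^ 2 * a1)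
    linarith only [w2, w3, w5, w6]
  -- term h
  have Th : m ^ 2 * -(3 * B ^ 3 * a1 * gps m a) ≤ m ^ 8 * B ^ 2 * a1 := by
    have w1 : |3 * B ^ 3 * a1 * gps m a| ≤ 3 * B ^ 3 * a1 * (4 * (m ^ 2 * a1)) :=
      bM (abs_of_pos (by positivity)).le g1
    have w2 := mul_le_mul_of_nonneg_left ((neg_le_abs _).trans w1) c1.le
    have w3 : 12 * (B * a1) ≤ m ^ 4 := by
      have : B * a1 ≤ 9 * m ^ 2 * (5 * m ^ 3) := by gcongr
      have : m ^ 5 ≤ m ^ 4 / 10 ^ 8 := by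
        have := mul_le_mul_of_nonneg_left ms c6.le
        linarith
      linarith
    have w4 := mul_le_mul_of_nonneg_right w3 (by positivity : 0 ≤ m ^ 4 * B ^ 2 * a1)
    linarith only [w2, w4]
  have p0 : 0 ≤ m ^ 2 * N0 * φ ^ 2 * a1 := by positivity
  have p1 : 0 ≤ m ^ 4 * φ ^ 2 * a1 := by positivity
  have p2 : 0 ≤ Y ^ 2 * (m ^ 4 * a1) := by positivity
  have p3 : 0 ≤ Y ^ 2 * (m ^ 2 * D) := by positivity
  have p4 : 0 ≤ m ^ 2 * (m ^ 2 + N0 + N1) * S := by positivity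
  have p5 : 0 ≤ m ^ 4 * D * φ ^ 2 := by positivity
  have p6 : 0 ≤ m ^ 8 * B ^ 2 * a1 := by positivity
  have ec : m ^ 2 * (6 * B ^ 2 * cbar m * a1) = 324 / 35 * (m ^ 8 * B ^ 2 * a1) := by unfold cbar; ring
  unfold Res2 Gq
  linarith only [Ta, Tb, Tc, Td, Te, Tf, Th, p0, p1, p2, p3, p4, p5, p6, ec]

/-- The combined pointwise inequality. -/
lemma res_b (h : Pt m τ N0 N1 φ φ1 a a1 a2 a3 b D D1 D2 D3 κ B Bt θ Y ω ω1 l) (φ2 R1 R2 : ℝ) :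
    Res m τ φ φ1 φ2 a a1 a2 a3 b D D1 D2 D3 κ R1 R2 Y ω ω1 B Bt θ
      ≤ -(1 / 2) * (ω * (R1 ^ 2 + R2 ^ 2)) - ω * (D1 ^ 2 + D2 ^ 2)
        + 1000000000 * Gq m N0 N1 φ (φ1 ^ 2 + φ2 ^ 2) a1 D Y := by
  have hm := h.m0; have ha1 := h.a1p; have hD := h.Dp; have hk := h.kp; have hkl := h.kl
  have hN0 := h.N0n; have hN1 := h.N1n; have thp := h.thp; have Bp := h.Bp
  have hω : 0 < ω := by have := h.wlo; have := h.bas.1; linarith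
  have h1 := h.res1_b φ2 R1 R2
  have h2 := h.res2_b (φ1 ^ 2 + φ2 ^ 2) R1 (by positivity)
  have h3 : 36 * (m ^ 2 * (D * κ) ^ 2) ≤ (6 * b * D) ^ 2 * κ := by
    have w1 : m ^ 2 ≤ b ^ 2 := by have := h.blo; gcongr
    have w2 : κ ^ 2 ≤ κ := by nlinarith
    have : m ^ 2 * κ ^ 2 ≤ b ^ 2 * κ := by gcongr
    have := mul_le_mul_of_nonneg_left this (by positivity : 0 ≤ 36 * D ^ 2)
    linarith only [this]
  have p1 : 0 ≤ m ^ 2 * (D * κ) ^ 2 := by positivity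
  have p2 : 0 ≤ m * θ ^ 2 * a1 := by positivity
  have p3 : 0 ≤ m ^ 8 * B ^ 2 * a1 := by positivity
  have p4 : 0 ≤ ω * R1 ^ 2 := by positivity
  have p5 : 0 ≤ ω * R2 ^ 2 := by positivity
  have p6 : 0 ≤ Gq m N0 N1 φ (φ1 ^ 2 + φ2 ^ 2) a1 D Y := by unfold Gq; positivity
  unfold Res
  generalize Gq m N0 N1 φ (φ1 ^ 2 + φ2 ^ 2) a1 D Y = G at *
  generalize Res1 m τ φ φ1 φ2 a a1 a2 a3 b D D1 D2 D3 R1 R2 Y ω ω1 = x1 at *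
  generalize Res2 m φ a a1 b D R1 Y B Bt = x2 at *
  linarith only [h1, h2, h3, p1, p2, p3, p4, p5, p6]

end Pt
end

noncomputable section


def en1 (τ φ1 φ2 R1 R2 ω : ℝ) : ℝ := 1 / 2 * (ω * (φ1 ^ 2 + φ2 ^ 2 + τ * R1 ^ 2 + τ * R2 ^ 2))
def en2 (m φ a B : ℝ) : ℝ := m ^ 2 * B * (φ * gps m a)
def en3 (m B θ a1 : ℝ) : ℝ := (7 * m ^ 4 * B + 1000 * m * θ) * a1
def en4 (b D s : ℝ) : ℝ := 1000 * (6 * b * D * (1 - 6 * (1 + s) * b * D))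

def kk (m a : ℝ) : ℝ := 4 / 3 * m ^ 4 * a ^ 3 - m ^ 3 * a ^ 4 - 3 / 5 * m ^ 2 * a ^ 5
  + 1 / 3 * m * a ^ 6 + 1 / 7 * a ^ 7 - 54 / 35 * m ^ 6 * a + 4 / 3 * m ^ 7

def fl1 (m τ φ φ1 φ2 R1 R2 a b ω : ℝ) : ℝ :=
  ω * (3 / 2 * m ^ 2 * (φ1 ^ 2 + φ2 ^ 2 + τ * R1 ^ 2 + τ * R2 ^ 2) + φ1 * R1 + φ2 * R2
    - 3 / 2 * (φ + a + b - m) ^ 2 * (φ1 ^ 2 + φ2 ^ 2))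
def fl2 (m B φ a b : ℝ) : ℝ :=
  m ^ 2 * B * (gps m a * (3 * m ^ 2 * φ - ((φ + a + b - m) ^ 3 - a ^ 3 - b ^ 3 + m ^ 3)
      + 3 * B * (a ^ 2 - m ^ 2) + 3 * B ^ 2 * (a - m)) - 6 * B * kk m a)
def fl3 (m B θ Y a1 : ℝ) : ℝ := (7 * m ^ 4 * B + 1000 * m * θ) * Y * a1
def fl4 (m Y b D s : ℝ) : ℝ :=
  -(1000 * ((3 * b ^ 2 - 3 * m ^ 2 - Y) * (6 * b * D * (1 - 6 * (1 + s) * b * D))))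

lemma gps_der (m a : ℝ) : HasDerivAt (gps m) (gps' m a) a := by
  have h := ((hasDerivAt_id a).mul (((hasDerivAt_id a).add_const (2 * m)).pow 2)).mul
    (((hasDerivAt_id a).const_sub m).pow 2)
  refine (h.congr_of_eventuallyEq (f₁ := gps m) (Filter.Eventually.of_forall ?_)).congr_deriv ?_
  · intro x; simp [gps]
  · unfold gps'; simp only [Pi.pow_apply, Pi.mul_apply, id]; push_cast; ring

def kk' (m a : ℝ) : ℝ := a * gps m a - cbar m

lemma kk_der (m a : ℝ) : HasDerivAt (kk m) (kk' m a) a := by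
  have p := fun n : ℕ => hasDerivAt_pow n a
  have h := (((((((p 3).const_mul (4 / 3 * m ^ 4)).sub ((p 4).const_mul (m ^ 3))).sub
    ((p 5).const_mul (3 / 5 * m ^ 2))).add ((p 6).const_mul (1 / 3 * m))).add
    ((p 7).const_mul (1 / 7))).sub ((hasDerivAt_id a).const_mul (54 / 35 * m ^ 6))).add_const
    (4 / 3 * m ^ 7)
  refine (h.congr_of_eventuallyEq (f₁ := kk m) (Filter.Eventually.of_forall ?_)).congr_deriv ?_
  · intro x; simp [kk]
  · unfold kk' gps cbar; push_cast; ring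

section gen
variable {m τ s Y : ℝ} {p p1 p2 R1 R2 a a1 b D w B θ : ℝ → ℝ}
  {p' p1' p2' R1' R2' a' a1' b' D' w' B' θ' : ℝ}

lemma en1_der (h1 : HasDerivAt p1 p1' s) (h2 : HasDerivAt p2 p2' s) (h3 : HasDerivAt R1 R1' s)
    (h4 : HasDerivAt R2 R2' s) (hw : HasDerivAt w w' s) :
    HasDerivAt (fun s => en1 τ (p1 s) (p2 s) (R1 s) (R2 s) (w s))
      (1 / 2 * w' * ((p1 s) ^ 2 + (p2 s) ^ 2 + τ * (R1 s) ^ 2 + τ * (R2 s) ^ 2)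
        + w s * (p1 s * p1' + p2 s * p2' + R1 s * (τ * R1') + R2 s * (τ * R2'))) s := by
  have h := ((hw.mul ((((h1.pow 2).add (h2.pow 2)).add ((h3.pow 2).const_mul τ)).add
    ((h4.pow 2).const_mul τ))).const_mul (1 / 2))
  refine (h.congr_of_eventuallyEq (Filter.Eventually.of_forall ?_)).congr_deriv ?_
  · intro x; simp [en1]
  · simp only [Pi.pow_apply, Pi.mul_apply, Pi.add_apply]; push_cast; ring

lemma en2_der (hB : HasDerivAt B B' s) (hp : HasDerivAt p p' s) (ha : HasDerivAt a a' s) :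
    HasDerivAt (fun s => en2 m (p s) (a s) (B s))
      (m ^ 2 * (B' * p s * gps m (a s) + B s * p' * gps m (a s)
        + B s * p s * (gps' m (a s) * a'))) s := by
  have h := (hB.const_mul (m ^ 2)).mul (hp.mul ((gps_der m (a s)).comp s ha))
  refine (h.congr_of_eventuallyEq (Filter.Eventually.of_forall ?_)).congr_deriv ?_
  · intro x; simp [en2]
  · simp only [Pi.mul_apply, Function.comp]; ring

lemma en3_der (hB : HasDerivAt B B' s) (hθ : HasDerivAt θ θ' s) (ha : HasDerivAt a1 a1' s) :
    HasDerivAt (fun s => en3 m (B s) (θ s) (a1 s))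
      ((7 * m ^ 4 * B' + 1000 * m * θ') * a1 s + (7 * m ^ 4 * B s + 1000 * m * θ s) * a1') s := by
  have h := ((hB.const_mul (7 * m ^ 4)).add (hθ.const_mul (1000 * m))).mul ha
  refine (h.congr_of_eventuallyEq (Filter.Eventually.of_forall ?_)).congr_deriv ?_
  · intro x; simp [en3]
  · simp only [Pi.add_apply]

lemma en4_der (hb : HasDerivAt b b' s) (hD : HasDerivAt D D' s) :
    HasDerivAt (fun s => en4 (b s) (D s) s)
      (6000 * ((b' * D s + b s * D') * (1 - 12 * (1 + s) * b s * D s)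
        - 6 * (b s * D s) ^ 2)) s := by
  have h1 : HasDerivAt (fun s : ℝ => 6 * (1 + s)) 6 s := by
    simpa using ((hasDerivAt_id s).const_add 1).const_mul 6
  have h := ((((hb.const_mul 6).mul hD).mul (((h1.mul hb).mul hD).const_sub 1))).const_mul 1000
  refine (h.congr_of_eventuallyEq (Filter.Eventually.of_forall ?_)).congr_deriv ?_
  · intro x; simp [en4]
  · simp only [Pi.mul_apply]; ring

lemma fl1_der (hp : HasDerivAt p p' s) (h1 : HasDerivAt p1 p1' s) (h2 : HasDerivAt p2 p2' s)
    (h3 : HasDerivAt R1 R1' s) (h4 : HasDerivAt R2 R2' s) (ha : HasDerivAt a a' s)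
    (hb : HasDerivAt b b' s) (hw : HasDerivAt w w' s) :
    HasDerivAt (fun s => fl1 m τ (p s) (p1 s) (p2 s) (R1 s) (R2 s) (a s) (b s) (w s))
      (w' * (3 / 2 * m ^ 2 * ((p1 s) ^ 2 + (p2 s) ^ 2 + τ * (R1 s) ^ 2 + τ * (R2 s) ^ 2)
          + p1 s * R1 s + p2 s * R2 s
          - 3 / 2 * (p s + a s + b s - m) ^ 2 * ((p1 s) ^ 2 + (p2 s) ^ 2))
        + w s * (3 * m ^ 2 * (p1 s * p1' + p2 s * p2' + τ * (R1 s * R1') + τ * (R2 s * R2'))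
          + p1' * R1 s + p1 s * R1' + p2' * R2 s + p2 s * R2'
          - 3 * (p s + a s + b s - m) * (p' + a' + b') * ((p1 s) ^ 2 + (p2 s) ^ 2)
          - 3 * (p s + a s + b s - m) ^ 2 * (p1 s * p1' + p2 s * p2'))) s := by
  have hU := ((((hp.add ha).add hb).sub_const m).pow 2).const_mul (3 / 2)
  have hq := ((((h1.pow 2).add (h2.pow 2)).add ((h3.pow 2).const_mul τ)).add
    ((h4.pow 2).const_mul τ)).const_mul (3 / 2 * m ^ 2)
  have h := hw.mul (((hq.add (h1.mul h3)).add (h2.mul h4)).sub (hU.mul ((h1.pow 2).add (h2.pow 2))))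
  refine (h.congr_of_eventuallyEq (Filter.Eventually.of_forall ?_)).congr_deriv ?_
  · intro x; simp [fl1]
  · simp only [Pi.pow_apply, Pi.mul_apply, Pi.add_apply, Pi.sub_apply]; push_cast; ring

lemma fl2_der {B : ℝ} (hp : HasDerivAt p p' s) (ha : HasDerivAt a a' s) (hb : HasDerivAt b b' s) :
    HasDerivAt (fun s => fl2 m B (p s) (a s) (b s))
      (m ^ 2 * B * ((gps' m (a s) * a') * (3 * m ^ 2 * p s
          - ((p s + a s + b s - m) ^ 3 - (a s) ^ 3 - (b s) ^ 3 + m ^ 3)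
          + 3 * B * ((a s) ^ 2 - m ^ 2) + 3 * B ^ 2 * (a s - m))
        + gps m (a s) * (3 * m ^ 2 * p' - (3 * (p s + a s + b s - m) ^ 2 * (p' + a' + b')
            - 3 * (a s) ^ 2 * a' - 3 * (b s) ^ 2 * b') + 6 * B * a s * a' + 3 * B ^ 2 * a')
        - 6 * B * (kk' m (a s) * a'))) s := by
  have hU := ((((hp.add ha).add hb).sub_const m).pow 3)
  have hq := ((((hp.const_mul (3 * m ^ 2)).sub (((hU.sub (ha.pow 3)).sub (hb.pow 3)).add_const (m ^ 3))).add
    (((ha.pow 2).sub_const (m ^ 2)).const_mul (3 * B))).add ((ha.sub_const m).const_mul (3 * B ^ 2)))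
  have h := ((((gps_der m (a s)).comp s ha).mul hq).sub
    (((kk_der m (a s)).comp s ha).const_mul (6 * B))).const_mul (m ^ 2 * B)
  refine (h.congr_of_eventuallyEq (Filter.Eventually.of_forall ?_)).congr_deriv ?_
  · intro x; simp [fl2]
  · simp only [Pi.pow_apply, Pi.add_apply, Pi.sub_apply, Function.comp]; push_cast; ring

lemma fl4_der {q : ℝ} (hb : HasDerivAt b b' s) (hD : HasDerivAt D D' s) :
    HasDerivAt (fun s => fl4 m Y (b s) (D s) q)
      (-(6000 * (6 * b s * b' * (b s * D s * (1 - 6 * (1 + q) * b s * D s))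
        + (3 * (b s) ^ 2 - 3 * m ^ 2 - Y) * ((b' * D s + b s * D') * (1 - 12 * (1 + q) * b s * D s))))) s := by
  have h := (((((((hb.pow 2).const_mul 3).sub_const (3 * m ^ 2)).sub_const Y).mul
    (((hb.const_mul 6).mul hD).mul (((hb.const_mul (6 * (1 + q))).mul hD).const_sub 1)))).const_mul 1000).neg
  refine (h.congr_of_eventuallyEq (Filter.Eventually.of_forall ?_)).congr_deriv ?_
  · intro x; simp [fl4]
  · simp only [Pi.pow_apply, Pi.mul_apply]; push_cast; ring

end gen

section alg
variable {m τ s Y B Bt θ φ φ1 φ2 φ3 R1 R2 R3 a a1 a2 a3 b D D1 D2 D3 ω ω1 pt p1t p2t R1t R2t bt Dt : ℝ}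

lemma alg1 (h1 : p1t = 3 * m ^ 2 * φ2
      - (3 * (φ + a + b - m) ^ 2 * (φ2 + (a2 + D1)) + 6 * (φ + a + b - m) * (φ1 + (a1 + D)) ^ 2)
      + (3 * a ^ 2 * a2 + 6 * a * a1 ^ 2) + (3 * b ^ 2 * D1 + 6 * b * D ^ 2) - Y * (a2 + D1) + R2)
    (h2 : p2t = 3 * m ^ 2 * φ3
      - (3 * (φ + a + b - m) ^ 2 * (φ3 + (a3 + D2))
        + 18 * (φ + a + b - m) * (φ1 + (a1 + D)) * (φ2 + (a2 + D1)) + 6 * (φ1 + (a1 + D)) ^ 3)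
      + (3 * a ^ 2 * a3 + 18 * a * a1 * a2 + 6 * a1 ^ 3)
      + (3 * b ^ 2 * D2 + 18 * b * D * D1 + 6 * D ^ 3) - Y * (a3 + D2) + R3)
    (h3 : τ * R1t = τ * (3 * m ^ 2) * R2 - R1 + φ2 - τ * Y * qtwo m a a1 a2 + D1 - τ * (3 * m ^ 2) * D2)
    (h4 : τ * R2t = τ * (3 * m ^ 2) * R3 - R2 + φ3 - τ * Y * qthree m a a1 a2 a3 + D2
      - τ * (3 * m ^ 2) * D3) :
    (1 / 2 * (Y * ω1) * (φ1 ^ 2 + φ2 ^ 2 + τ * R1 ^ 2 + τ * R2 ^ 2)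
        + ω * (φ1 * p1t + φ2 * p2t + R1 * (τ * R1t) + R2 * (τ * R2t)))
    - (ω1 * (3 / 2 * m ^ 2 * (φ1 ^ 2 + φ2 ^ 2 + τ * R1 ^ 2 + τ * R2 ^ 2)
          + φ1 * R1 + φ2 * R2 - 3 / 2 * (φ + a + b - m) ^ 2 * (φ1 ^ 2 + φ2 ^ 2))
        + ω * (3 * m ^ 2 * (φ1 * φ2 + φ2 * φ3 + τ * (R1 * R2) + τ * (R2 * R3))
          + φ2 * R1 + φ1 * R2 + φ3 * R2 + φ2 * R3
          - 3 * (φ + a + b - m) * (φ1 + a1 + D) * (φ1 ^ 2 + φ2 ^ 2)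
          - 3 * (φ + a + b - m) ^ 2 * (φ1 * φ2 + φ2 * φ3)))
    = Res1 m τ φ φ1 φ2 a a1 a2 a3 b D D1 D2 D3 R1 R2 Y ω ω1 := by
  rw [h1, h2, h3, h4]
  unfold Res1 Sone Stwo
  generalize φ + a + b - m = U
  ring

lemma alg2 (h0 : pt = 3 * m ^ 2 * φ1 - 3 * (φ + a + b - m) ^ 2 * (φ1 + (a1 + D)) + 3 * a ^ 2 * a1
      + 3 * b ^ 2 * D - Y * (a1 + D) + R1) :
    (m ^ 2 * (Bt * φ * gps m a + B * pt * gps m a + B * φ * (gps' m a * (Y * a1))))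
    - (m ^ 2 * B * ((gps' m a * a1) * (3 * m ^ 2 * φ
          - ((φ + a + b - m) ^ 3 - a ^ 3 - b ^ 3 + m ^ 3)
          + 3 * B * (a ^ 2 - m ^ 2) + 3 * B ^ 2 * (a - m))
        + gps m a * (3 * m ^ 2 * φ1 - (3 * (φ + a + b - m) ^ 2 * (φ1 + a1 + D)
            - 3 * a ^ 2 * a1 - 3 * b ^ 2 * D) + 6 * B * a * a1 + 3 * B ^ 2 * a1)
        - 6 * B * (kk' m a * a1)))
    = Res2 m φ a a1 b D R1 Y B Bt := by
  rw [h0]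
  unfold Res2 HH kk'
  ring

lemma alg4 (hb : bt = -((3 * b ^ 2 - 3 * m ^ 2) * D))
    (hD : Dt = -((3 * b ^ 2 - 3 * m ^ 2) * D1 + 6 * b * D ^ 2)) :
    (6000 * (((bt + Y * D) * D + b * (Dt + Y * D1)) * (1 - 12 * (1 + s) * b * D) - 6 * (b * D) ^ 2))
    - (-(6000 * (6 * b * D * (b * D * (1 - 6 * (1 + s) * b * D))
        + (3 * b ^ 2 - 3 * m ^ 2 - Y) * ((D * D + b * D1) * (1 - 12 * (1 + s) * b * D)))))
    = -(1000 * ((6 * b * D) ^ 2 * (1 - 6 * (1 + s) * b * D))) := by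
  rw [hb, hD]; ring

end alg
end

noncomputable section

def G0 (m φ φ1 a a1 b D Y R1 : ℝ) : ℝ :=
  3 * m ^ 2 * φ1 - 3 * (φ + a + b - m) ^ 2 * (φ1 + (a1 + D)) + 3 * a ^ 2 * a1
      + 3 * b ^ 2 * D - Y * (a1 + D) + R1

def G1 (m φ φ1 φ2 a a1 a2 b D D1 Y R2 : ℝ) : ℝ :=
  3 * m ^ 2 * φ2
      - (3 * (φ + a + b - m) ^ 2 * (φ2 + (a2 + D1)) + 6 * (φ + a + b - m) * (φ1 + (a1 + D)) ^ 2)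
      + (3 * a ^ 2 * a2 + 6 * a * a1 ^ 2) + (3 * b ^ 2 * D1 + 6 * b * D ^ 2) - Y * (a2 + D1) + R2

def G2 (m φ φ1 φ2 φ3 a a1 a2 a3 b D D1 D2 Y R3 : ℝ) : ℝ :=
  3 * m ^ 2 * φ3
      - (3 * (φ + a + b - m) ^ 2 * (φ3 + (a3 + D2))
        + 18 * (φ + a + b - m) * (φ1 + (a1 + D)) * (φ2 + (a2 + D1)) + 6 * (φ1 + (a1 + D)) ^ 3)
      + (3 * a ^ 2 * a3 + 18 * a * a1 * a2 + 6 * a1 ^ 3)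
      + (3 * b ^ 2 * D2 + 18 * b * D * D1 + 6 * D ^ 3) - Y * (a3 + D2) + R3

section gen
variable {m Y s : ℝ} {p p1 p2 R1 R2 a a1 a2 b D D1 : ℝ → ℝ}
  {p3 R3 a3 D2 : ℝ}

lemma G0_der (hp : HasDerivAt p (p1 s) s) (hp1 : HasDerivAt p1 (p2 s) s)
    (ha : HasDerivAt a (a1 s) s) (ha1 : HasDerivAt a1 (a2 s) s) (hb : HasDerivAt b (D s) s)
    (hD : HasDerivAt D (D1 s) s) (hR : HasDerivAt R1 (R2 s) s) :
    HasDerivAt (fun y => G0 m (p y) (p1 y) (a y) (a1 y) (b y) (D y) Y (R1 y))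
      (G1 m (p s) (p1 s) (p2 s) (a s) (a1 s) (a2 s) (b s) (D s) (D1 s) Y (R2 s)) s := by
  have hU := ((((hp.add ha).add hb).sub_const m).pow 2).const_mul 3
  have hu := ha1.add hD
  have h := ((((((hp1.const_mul (3 * m ^ 2)).sub (hU.mul (hp1.add hu))).add
    (((ha.pow 2).const_mul 3).mul ha1)).add (((hb.pow 2).const_mul 3).mul hD)).sub
    (hu.const_mul Y)).add hR)
  refine (h.congr_of_eventuallyEq (Filter.Eventually.of_forall ?_)).congr_deriv ?_
  · intro x; simp [G0]
  · simp only [Pi.pow_apply, Pi.mul_apply, Pi.add_apply]; push_cast; unfold G1; ring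

lemma G1_der (hp : HasDerivAt p (p1 s) s) (hp1 : HasDerivAt p1 (p2 s) s) (hp2 : HasDerivAt p2 p3 s)
    (ha : HasDerivAt a (a1 s) s) (ha1 : HasDerivAt a1 (a2 s) s) (ha2 : HasDerivAt a2 a3 s)
    (hb : HasDerivAt b (D s) s)
    (hD : HasDerivAt D (D1 s) s) (hD1 : HasDerivAt D1 D2 s) (hR : HasDerivAt R2 R3 s) :
    HasDerivAt (fun y => G1 m (p y) (p1 y) (p2 y) (a y) (a1 y) (a2 y) (b y) (D y) (D1 y) Y (R2 y))
      (G2 m (p s) (p1 s) (p2 s) p3 (a s) (a1 s) (a2 s) a3 (b s) (D s) (D1 s) D2 Y R3) s := by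
  have hU0 := (((hp.add ha).add hb).sub_const m)
  have hU := (hU0.pow 2).const_mul 3
  have hu := ha1.add hD
  have hu2 := ha2.add hD1
  have h := (((((hp2.const_mul (3 * m ^ 2)).sub ((hU.mul (hp2.add hu2)).add
      ((hU0.const_mul 6).mul ((hp1.add hu).pow 2)))).add
    ((((ha.pow 2).const_mul 3).mul ha2).add ((ha.const_mul 6).mul (ha1.pow 2)))).add
    ((((hb.pow 2).const_mul 3).mul hD1).add ((hb.const_mul 6).mul (hD.pow 2)))).sub
    (hu2.const_mul Y)).add hR
  refine (h.congr_of_eventuallyEq (Filter.Eventually.of_forall ?_)).congr_deriv ?_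
  · intro x; simp [G1]
  · simp only [Pi.pow_apply, Pi.mul_apply, Pi.add_apply]; push_cast; unfold G2; ring

end gen

structure Sys (m τ T ξ0 : ℝ) (uS : ℝ → ℝ) (wR φ r : ℝ → ℝ → ℝ) (X : ℝ → ℝ) : Prop where
  sh : Shock m τ uS
  ra : Rare m wR
  ms : m ≤ 1 / 10 ^ 8
  t1 : τ ≤ 1
  T0 : 0 ≤ T
  z0 : uS ξ0 = 0
  sol : PerturbSol m τ T uS wR φ r X
  ep : ∀ t ∈ Set.Icc 0 T,
    Real.sqrt (HnormSq 2 (φ t)) + Real.sqrt τ * Real.sqrt (HnormSq 2 (r t)) ≤ 1 / 2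

namespace Sys
variable {m τ T ξ0 : ℝ} {uS : ℝ → ℝ} {wR φ r : ℝ → ℝ → ℝ} {X : ℝ → ℝ}

lemma sf (h : Sys m τ T ξ0 uS wR φ r X) : SmoothOn Set.univ φ := h.sol.1.contDiffOn
lemma sr (h : Sys m τ T ξ0 uS wR φ r X) : SmoothOn Set.univ r := h.sol.2.1.contDiffOn
lemma sf1 (h : Sys m τ T ξ0 uS wR φ r X) : SmoothOn Set.univ (dx φ) := h.sf.dx isOpen_univ
lemma sr1 (h : Sys m τ T ξ0 uS wR φ r X) : SmoothOn Set.univ (dx r) := h.sr.dx isOpen_univ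
lemma sf2 (h : Sys m τ T ξ0 uS wR φ r X) : SmoothOn Set.univ (dx (dx φ)) := h.sf1.dx isOpen_univ
lemma sr2 (h : Sys m τ T ξ0 uS wR φ r X) : SmoothOn Set.univ (dx (dx r)) := h.sr1.dx isOpen_univ

lemma dX (h : Sys m τ T ξ0 uS wR φ r X) (t : ℝ) : HasDerivAt X (deriv X t) t :=
  (h.sol.2.2.2.2.1 t).differentiableAt.hasDerivAt

lemma X_cont (h : Sys m τ T ξ0 uS wR φ r X) : Continuous X :=
  continuous_iff_continuousAt.mpr fun t => (h.dX t).continuousAt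

lemma dsx {f : ℝ → ℝ → ℝ} (h : SmoothOn Set.univ f) (t ξ : ℝ) : HasDerivAt (f t) (dx f t ξ) ξ :=
  h.hasDerivAt_x isOpen_univ (Set.mem_univ _)
lemma dst {f : ℝ → ℝ → ℝ} (h : SmoothOn Set.univ f) (t ξ : ℝ) :
    HasDerivAt (fun s => f s ξ) (dt f t ξ) t :=
  h.hasDerivAt_t isOpen_univ (Set.mem_univ _)

lemma eq0 (h : Sys m τ T ξ0 uS wR φ r X) {t : ℝ} (ht : t ∈ Set.Icc 0 T) (ξ : ℝ) :
    dt φ t ξ = G0 m (φ t ξ) (dx φ t ξ) (uS (ξ + X t)) (deriv uS (ξ + X t)) (tuR m wR t (ξ + X t))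
      (dx (tuR m wR) t (ξ + X t)) (deriv X t) (dx r t ξ + dx (dx (tuR m wR)) t (ξ + X t)) := by
  have t1 : -1 < t := by linarith [ht.1]
  have e := h.sol.2.2.2.2.2.1 t ht ξ
  set ζ := ξ + X t with hζ
  have dtu : HasDerivAt (tu m uS wR t) (deriv uS ζ + dx (tuR m wR) t ζ) ζ :=
    ((h.sh.d1 ζ).add (h.ra.db t1 ζ)).sub_const m
  have dtu' : HasDerivAt (fun y => tu m uS wR t (y + X t)) (deriv uS ζ + dx (tuR m wR) t ζ) ξ :=
    dtu.comp_add_const ξ (X t)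
  have q1 := (((dsx h.sf t ξ).add dtu').pow 3).sub (dtu'.pow 3)
  have q2 := ((dtu.pow 3).sub ((h.sh.d1 ζ).pow 3)).sub ((h.ra.db t1 ζ).pow 3)
  have q1' : deriv (fun y => (φ t y + tu m uS wR t (y + X t)) ^ 3
          - (tu m uS wR t (y + X t)) ^ 3) ξ = _ := q1.deriv
  have q2' : deriv (fun z => (tu m uS wR t z) ^ 3 - (uS z) ^ 3 - (tuR m wR t z) ^ 3) ζ = _ := q2.deriv
  rw [q1', Ferr, q2', ← dx_dx_eq] at e
  change dt φ t ξ - 3 * m ^ 2 * dx φ t ξ + _ + deriv X t * (deriv uS ζ + dx (tuR m wR) t ζ) - dx r t ξ = _ at e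
  simp only [Pi.add_apply, tu, ← hζ] at e
  push_cast at e
  unfold G0
  linear_combination e

lemma ua (h : Sys m τ T ξ0 uS wR φ r X) (t ξ : ℝ) :
    HasDerivAt (fun y => uS (y + X t)) (deriv uS (ξ + X t)) ξ := (h.sh.d1 _).comp_add_const ξ (X t)
lemma ua1 (h : Sys m τ T ξ0 uS wR φ r X) (t ξ : ℝ) :
    HasDerivAt (fun y => deriv uS (y + X t)) (deriv (deriv uS) (ξ + X t)) ξ :=
  (h.sh.d2 _).comp_add_const ξ (X t)
lemma ua2 (h : Sys m τ T ξ0 uS wR φ r X) (t ξ : ℝ) :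
    HasDerivAt (fun y => deriv (deriv uS) (y + X t)) (deriv (deriv (deriv uS)) (ξ + X t)) ξ :=
  (h.sh.d3 _).comp_add_const ξ (X t)
lemma ub (h : Sys m τ T ξ0 uS wR φ r X) {t : ℝ} (ht : t ∈ Set.Icc 0 T) (ξ : ℝ) :
    HasDerivAt (fun y => tuR m wR t (y + X t)) (dx (tuR m wR) t (ξ + X t)) ξ :=
  (h.ra.db (by linarith [ht.1]) _).comp_add_const ξ (X t)
lemma uD (h : Sys m τ T ξ0 uS wR φ r X) {t : ℝ} (ht : t ∈ Set.Icc 0 T) (ξ : ℝ) :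
    HasDerivAt (fun y => dx (tuR m wR) t (y + X t)) (dx (dx (tuR m wR)) t (ξ + X t)) ξ :=
  (h.ra.dD (by linarith [ht.1]) _).comp_add_const ξ (X t)
lemma uD1 (h : Sys m τ T ξ0 uS wR φ r X) {t : ℝ} (ht : t ∈ Set.Icc 0 T) (ξ : ℝ) :
    HasDerivAt (fun y => dx (dx (tuR m wR)) t (y + X t)) (dx (dx (dx (tuR m wR))) t (ξ + X t)) ξ :=
  (h.ra.dD1 (by linarith [ht.1]) _).comp_add_const ξ (X t)
lemma uD2 (h : Sys m τ T ξ0 uS wR φ r X) {t : ℝ} (ht : t ∈ Set.Icc 0 T) (ξ : ℝ) :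
    HasDerivAt (fun y => dx (dx (dx (tuR m wR))) t (y + X t))
      (dx (dx (dx (dx (tuR m wR)))) t (ξ + X t)) ξ :=
  (h.ra.dD2 (by linarith [ht.1]) _).comp_add_const ξ (X t)

lemma eq1 (h : Sys m τ T ξ0 uS wR φ r X) {t : ℝ} (ht : t ∈ Set.Icc 0 T) (ξ : ℝ) :
    dt (dx φ) t ξ = G1 m (φ t ξ) (dx φ t ξ) (dx (dx φ) t ξ) (uS (ξ + X t)) (deriv uS (ξ + X t))
      (deriv (deriv uS) (ξ + X t)) (tuR m wR t (ξ + X t))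
      (dx (tuR m wR) t (ξ + X t)) (dx (dx (tuR m wR)) t (ξ + X t)) (deriv X t)
      (dx (dx r) t ξ + dx (dx (dx (tuR m wR))) t (ξ + X t)) := by
  rw [h.sf.comm isOpen_univ (Set.mem_univ _)]
  unfold dx
  rw [show dt φ t = _ from funext (fun y => h.eq0 ht y)]
  exact (G0_der (p2 := fun y => dx (dx φ) t y) (R2 := fun y => dx (dx r) t y + dx (dx (dx (tuR m wR))) t (y + X t))
    (D1 := fun y => dx (dx (tuR m wR)) t (y + X t)) (a2 := fun y => deriv (deriv uS) (y + X t))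
    (dsx h.sf t ξ) (dsx h.sf1 t ξ) (h.ua t ξ) (h.ua1 t ξ) (h.ub ht ξ) (h.uD ht ξ)
    ((dsx h.sr1 t ξ).add (h.uD1 ht ξ))).deriv

lemma eq2 (h : Sys m τ T ξ0 uS wR φ r X) {t : ℝ} (ht : t ∈ Set.Icc 0 T) (ξ : ℝ) :
    dt (dx (dx φ)) t ξ = G2 m (φ t ξ) (dx φ t ξ) (dx (dx φ) t ξ) (dx (dx (dx φ)) t ξ)
      (uS (ξ + X t)) (deriv uS (ξ + X t))
      (deriv (deriv uS) (ξ + X t)) (deriv (deriv (deriv uS)) (ξ + X t)) (tuR m wR t (ξ + X t))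
      (dx (tuR m wR) t (ξ + X t)) (dx (dx (tuR m wR)) t (ξ + X t)) (dx (dx (dx (tuR m wR))) t (ξ + X t))
      (deriv X t)
      (dx (dx (dx r)) t ξ + dx (dx (dx (dx (tuR m wR)))) t (ξ + X t)) := by
  rw [h.sf1.comm isOpen_univ (Set.mem_univ _)]
  change deriv (dt (dx φ) t) ξ = _
  rw [show dt (dx φ) t = _ from funext (fun y => h.eq1 ht y)]
  exact (G1_der (p2 := fun y => dx (dx φ) t y) (R2 := fun y => dx (dx r) t y + dx (dx (dx (tuR m wR))) t (y + X t))
    (D1 := fun y => dx (dx (tuR m wR)) t (y + X t)) (a2 := fun y => deriv (deriv uS) (y + X t))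
    (dsx h.sf t ξ) (dsx h.sf1 t ξ) (dsx h.sf2 t ξ) (h.ua t ξ) (h.ua1 t ξ) (h.ua2 t ξ)
    (h.ub ht ξ) (h.uD ht ξ) (h.uD1 ht ξ)
    ((dsx h.sr2 t ξ).add (h.uD2 ht ξ))).deriv

lemma er0 (h : Sys m τ T ξ0 uS wR φ r X) {t : ℝ} (ht : t ∈ Set.Icc 0 T) (ξ : ℝ) :
    τ * dt r t ξ = τ * (3 * m ^ 2) * dx r t ξ - r t ξ + dx φ t ξ
      - τ * deriv X t * (3 * ((uS (ξ + X t)) ^ 2 - m ^ 2) * deriv uS (ξ + X t)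
        + dx (dx (tuR m wR)) t (ξ + X t)) - τ * dt (dx (tuR m wR)) t (ξ + X t) := by
  have t1 : -1 < t := by linarith [ht.1]
  have e := h.sol.2.2.2.2.2.2 t ht ξ
  set ζ := ξ + X t with hζ
  have q := ((((h.sh.d1 ζ).pow 3).sub_const ((-2 * m) ^ 3)).sub
    (((h.sh.d1 ζ).sub_const (-2 * m)).const_mul (3 * m ^ 2))).add (h.ra.dD t1 ζ)
  have q' : deriv (tq m uS wR t) ζ = _ := q.deriv
  rw [q'] at e
  change τ * dt r t ξ - τ * (3 * m ^ 2) * dx r t ξ + r t ξ - dx φ t ξ + _ + τ * dt (dx (tuR m wR)) t ζ = 0 at e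
  push_cast at e
  linear_combination e

lemma drare (h : Sys m τ T ξ0 uS wR φ r X) {t : ℝ} (ht : t ∈ Set.Icc 0 T) {f : ℝ → ℝ → ℝ}
    (hf : SmoothOn UU f) (ξ : ℝ) : HasDerivAt (fun y => dt f t (y + X t)) (dt (dx f) t (ξ + X t)) ξ := by
  have t1 : -1 < t := by linarith [ht.1]
  rw [hf.comm UU_open (Rare.mem t1 _)]
  exact ((hf.dt UU_open).hasDerivAt_x UU_open (Rare.mem t1 _)).comp_add_const ξ (X t)

lemma sD (h : Sys m τ T ξ0 uS wR φ r X) : SmoothOn UU (dx (tuR m wR)) := h.ra.smooth.dx UU_open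
lemma sD1 (h : Sys m τ T ξ0 uS wR φ r X) : SmoothOn UU (dx (dx (tuR m wR))) := h.sD.dx UU_open
lemma sD2 (h : Sys m τ T ξ0 uS wR φ r X) : SmoothOn UU (dx (dx (dx (tuR m wR)))) := h.sD1.dx UU_open

lemma er1 (h : Sys m τ T ξ0 uS wR φ r X) {t : ℝ} (ht : t ∈ Set.Icc 0 T) (ξ : ℝ) :
    τ * dt (dx r) t ξ = τ * (3 * m ^ 2) * dx (dx r) t ξ - dx r t ξ + dx (dx φ) t ξ
      - τ * deriv X t * (qtwo m (uS (ξ + X t)) (deriv uS (ξ + X t)) (deriv (deriv uS) (ξ + X t))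
        + dx (dx (dx (tuR m wR))) t (ξ + X t)) - τ * dt (dx (dx (tuR m wR))) t (ξ + X t) := by
  rw [h.sr.comm isOpen_univ (Set.mem_univ _)]
  have e : HasDerivAt (fun y => τ * dt r t y) (τ * dx (dt r) t ξ) ξ :=
    (dsx (h.sr.dt isOpen_univ) t ξ).const_mul τ
  rw [show (fun y => τ * dt r t y) = _ from funext (fun y => h.er0 ht y)] at e
  have q := (((((dsx h.sr1 t ξ).const_mul (τ * (3 * m ^ 2))).sub (dsx h.sr t ξ)).add (dsx h.sf1 t ξ)).sub
    ((((((((h.ua t ξ).pow 2).sub_const (m ^ 2)).const_mul 3).mul (h.ua1 t ξ)).add (h.uD1 ht ξ))).const_mul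
    (τ * deriv X t))).sub ((h.drare ht h.sD ξ).const_mul τ)
  have := e.unique q
  rw [this]
  simp only [Pi.pow_apply]
  unfold qtwo
  push_cast
  ring

lemma er2 (h : Sys m τ T ξ0 uS wR φ r X) {t : ℝ} (ht : t ∈ Set.Icc 0 T) (ξ : ℝ) :
    τ * dt (dx (dx r)) t ξ = τ * (3 * m ^ 2) * dx (dx (dx r)) t ξ - dx (dx r) t ξ + dx (dx (dx φ)) t ξ
      - τ * deriv X t * (qthree m (uS (ξ + X t)) (deriv uS (ξ + X t)) (deriv (deriv uS) (ξ + X t))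
        (deriv (deriv (deriv uS)) (ξ + X t))
        + dx (dx (dx (dx (tuR m wR)))) t (ξ + X t)) - τ * dt (dx (dx (dx (tuR m wR)))) t (ξ + X t) := by
  rw [h.sr1.comm isOpen_univ (Set.mem_univ _)]
  have e : HasDerivAt (fun y => τ * dt (dx r) t y) (τ * dx (dt (dx r)) t ξ) ξ :=
    (dsx (h.sr1.dt isOpen_univ) t ξ).const_mul τ
  rw [show (fun y => τ * dt (dx r) t y) = _ from funext (fun y => h.er1 ht y)] at e
  unfold qtwo at e
  have q := (((((dsx h.sr2 t ξ).const_mul (τ * (3 * m ^ 2))).sub (dsx h.sr1 t ξ)).add (dsx h.sf2 t ξ)).sub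
    ((((((h.ua t ξ).const_mul 6).mul ((h.ua1 t ξ).pow 2)).add
    (((((h.ua t ξ).pow 2).sub_const (m ^ 2)).const_mul 3).mul (h.ua2 t ξ))).add (h.uD2 ht ξ)).const_mul
    (τ * deriv X t))).sub ((h.drare ht h.sD1 ξ).const_mul τ)
  have := e.unique q
  rw [this]
  simp only [Pi.pow_apply]
  unfold qthree
  push_cast
  ring

end Sys
end

noncomputable section

def fl1x (m τ φ φ1 φ2 φ3 R1 R2 R3 a a1 b D ω ω1 : ℝ) : ℝ :=
  ω1 * (3 / 2 * m ^ 2 * (φ1 ^ 2 + φ2 ^ 2 + τ * R1 ^ 2 + τ * R2 ^ 2)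
          + φ1 * R1 + φ2 * R2 - 3 / 2 * (φ + a + b - m) ^ 2 * (φ1 ^ 2 + φ2 ^ 2))
        + ω * (3 * m ^ 2 * (φ1 * φ2 + φ2 * φ3 + τ * (R1 * R2) + τ * (R2 * R3))
          + φ2 * R1 + φ1 * R2 + φ3 * R2 + φ2 * R3
          - 3 * (φ + a + b - m) * (φ1 + a1 + D) * (φ1 ^ 2 + φ2 ^ 2)
          - 3 * (φ + a + b - m) ^ 2 * (φ1 * φ2 + φ2 * φ3))

def fl2x (m B φ φ1 a a1 b D : ℝ) : ℝ :=
  (m ^ 2 * B * ((gps' m a * a1) * (3 * m ^ 2 * φ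
          - ((φ + a + b - m) ^ 3 - a ^ 3 - b ^ 3 + m ^ 3)
          + 3 * B * (a ^ 2 - m ^ 2) + 3 * B ^ 2 * (a - m))
        + gps m a * (3 * m ^ 2 * φ1 - (3 * (φ + a + b - m) ^ 2 * (φ1 + a1 + D)
            - 3 * a ^ 2 * a1 - 3 * b ^ 2 * D) + 6 * B * a * a1 + 3 * B ^ 2 * a1)
        - 6 * B * (kk' m a * a1)))

def fl4x (m Y b D D1 s : ℝ) : ℝ :=
  (-(6000 * (6 * b * D * (b * D * (1 - 6 * (1 + s) * b * D))
        + (3 * b ^ 2 - 3 * m ^ 2 - Y) * ((D * D + b * D1) * (1 - 12 * (1 + s) * b * D)))))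

/-- Energy density. -/
def En (m τ ξ0 : ℝ) (uS : ℝ → ℝ) (wR φ r : ℝ → ℝ → ℝ) (X : ℝ → ℝ) (t ξ : ℝ) : ℝ :=
  en1 τ (dx φ t ξ) (dx (dx φ) t ξ) (dx r t ξ + dx (dx (tuR m wR)) t (ξ + X t)) (dx (dx r) t ξ + dx (dx (dx (tuR m wR))) t (ξ + X t)) (W m (uS (ξ + X t))) + en2 m (φ t ξ) (uS (ξ + X t)) (tuR m wR t ξ0 - m) + en3 m (tuR m wR t ξ0 - m) (th m t) (deriv uS (ξ + X t)) + en4 (tuR m wR t (ξ + X t)) (dx (tuR m wR) t (ξ + X t)) t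

/-- Flux. -/
def Fl (m τ ξ0 : ℝ) (uS : ℝ → ℝ) (wR φ r : ℝ → ℝ → ℝ) (X : ℝ → ℝ) (t ξ : ℝ) : ℝ :=
  fl1 m τ (φ t ξ) (dx φ t ξ) (dx (dx φ) t ξ) (dx r t ξ + dx (dx (tuR m wR)) t (ξ + X t)) (dx (dx r) t ξ + dx (dx (dx (tuR m wR))) t (ξ + X t)) (uS (ξ + X t)) (tuR m wR t (ξ + X t)) (W m (uS (ξ + X t))) + fl2 m (tuR m wR t ξ0 - m) (φ t ξ) (uS (ξ + X t)) (tuR m wR t (ξ + X t)) + fl3 m (tuR m wR t ξ0 - m) (th m t) (deriv X t) (deriv uS (ξ + X t)) + fl4 m (deriv X t) (tuR m wR t (ξ + X t)) (dx (tuR m wR) t (ξ + X t)) t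

/-- Derivative of the flux. -/
def Flx (m τ ξ0 : ℝ) (uS : ℝ → ℝ) (wR φ r : ℝ → ℝ → ℝ) (X : ℝ → ℝ) (t ξ : ℝ) : ℝ :=
  fl1x m τ (φ t ξ) (dx φ t ξ) (dx (dx φ) t ξ) (dx (dx (dx φ)) t ξ) (dx r t ξ + dx (dx (tuR m wR)) t (ξ + X t)) (dx (dx r) t ξ + dx (dx (dx (tuR m wR))) t (ξ + X t)) (dx (dx (dx r)) t ξ + dx (dx (dx (dx (tuR m wR)))) t (ξ + X t)) (uS (ξ + X t)) (deriv uS (ξ + X t)) (tuR m wR t (ξ + X t)) (dx (tuR m wR) t (ξ + X t)) (W m (uS (ξ + X t))) (Wd m (uS (ξ + X t)) * deriv uS (ξ + X t))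
    + fl2x m (tuR m wR t ξ0 - m) (φ t ξ) (dx φ t ξ) (uS (ξ + X t)) (deriv uS (ξ + X t)) (tuR m wR t (ξ + X t)) (dx (tuR m wR) t (ξ + X t)) + fl3 m (tuR m wR t ξ0 - m) (th m t) (deriv X t) (deriv (deriv uS) (ξ + X t)) + fl4x m (deriv X t) (tuR m wR t (ξ + X t)) (dx (tuR m wR) t (ξ + X t)) (dx (dx (tuR m wR)) t (ξ + X t)) t

/-- Residual. -/
def Rs (m τ ξ0 : ℝ) (uS : ℝ → ℝ) (wR φ r : ℝ → ℝ → ℝ) (X : ℝ → ℝ) (t ξ : ℝ) : ℝ :=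
  Res m τ (φ t ξ) (dx φ t ξ) (dx (dx φ) t ξ) (uS (ξ + X t)) (deriv uS (ξ + X t)) (deriv (deriv uS) (ξ + X t)) (deriv (deriv (deriv uS)) (ξ + X t)) (tuR m wR t (ξ + X t)) (dx (tuR m wR) t (ξ + X t)) (dx (dx (tuR m wR)) t (ξ + X t)) (dx (dx (dx (tuR m wR))) t (ξ + X t)) (dx (dx (dx (dx (tuR m wR)))) t (ξ + X t)) (Rare.kap m wR t (ξ + X t)) (dx r t ξ + dx (dx (tuR m wR)) t (ξ + X t)) (dx (dx r) t ξ + dx (dx (dx (tuR m wR))) t (ξ + X t)) (deriv X t) (W m (uS (ξ + X t))) (Wd m (uS (ξ + X t)) * deriv uS (ξ + X t)) (tuR m wR t ξ0 - m) (dt (tuR m wR) t ξ0) (th m t)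

lemma th_der {m t : ℝ} (hm : 0 < m) (ht : -1 < t) : HasDerivAt (th m) (-(th m t) ^ 2) t := by
  have h0 := Dl_pos hm
  have h1 : 0 < 1 + (1 + t) * Dl m := by
    have : 0 < (1 + t) * Dl m := mul_pos (by linarith) h0
    linarith
  have h2 : HasDerivAt (fun s : ℝ => 1 + (1 + s) * Dl m) (Dl m) t := by
    simpa using (((hasDerivAt_id t).const_add 1).mul_const (Dl m)).const_add 1
  have h3 := (hasDerivAt_const t (Dl m)).div h2 h1.ne'
  refine (h3.congr_of_eventuallyEq (Filter.Eventually.of_forall ?_)).congr_deriv ?_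
  · intro x; simp [th]
  · unfold th; field_simp; ring

namespace Sys
variable {m τ T ξ0 : ℝ} {uS : ℝ → ℝ} {wR φ r : ℝ → ℝ → ℝ} {X : ℝ → ℝ}

lemma Fl_der (h : Sys m τ T ξ0 uS wR φ r X) {t : ℝ} (ht : t ∈ Set.Icc 0 T) (ξ : ℝ) :
    HasDerivAt (Fl m τ ξ0 uS wR φ r X t) (Flx m τ ξ0 uS wR φ r X t ξ) ξ := by
  have hw : HasDerivAt (fun y => W m (uS (y + X t))) (Wd m (uS (ξ + X t)) * deriv uS (ξ + X t)) ξ :=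
    (W_hasDerivAt h.sh.hm _).comp ξ (h.ua t ξ)
  exact ((((fl1_der (dsx h.sf t ξ) (dsx h.sf1 t ξ) (dsx h.sf2 t ξ)
    ((dsx h.sr1 t ξ).add (h.uD1 ht ξ)) ((dsx h.sr2 t ξ).add (h.uD2 ht ξ)) (h.ua t ξ)
    (h.ub ht ξ) hw).add (fl2_der (dsx h.sf t ξ) (h.ua t ξ) (h.ub ht ξ))).add
    ((h.ua1 t ξ).const_mul ((7 * m ^ 4 * (tuR m wR t ξ0 - m) + 1000 * m * (th m t)) * (deriv X t)))).add
    (fl4_der (h.ub ht ξ) (h.uD ht ξ)))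

lemma tshift (h : Sys m τ T ξ0 uS wR φ r X) {f : ℝ → ℝ} {f' t ξ : ℝ} (hf : HasDerivAt f f' (ξ + X t)) :
    HasDerivAt (fun s => f (ξ + X s)) ((deriv X t) * f') t := by
  have := hf.comp t ((h.dX t).const_add ξ)
  rw [mul_comm]; exact this

lemma En_der (h : Sys m τ T ξ0 uS wR φ r X) {t : ℝ} (ht : t ∈ Set.Icc 0 T) (ξ : ℝ) :
    HasDerivAt (fun s => En m τ ξ0 uS wR φ r X s ξ) (Flx m τ ξ0 uS wR φ r X t ξ + Rs m τ ξ0 uS wR φ r X t ξ) t := by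
  have t1 : -1 < t := by linarith [ht.1]
  have ha := h.tshift (h.sh.d1 (ξ + X t))
  have ha1 := h.tshift (h.sh.d2 (ξ + X t))
  have hw : HasDerivAt (fun s => W m (uS (ξ + X s))) ((deriv X t) * (Wd m (uS (ξ + X t)) * deriv uS (ξ + X t))) t := by
    have := (W_hasDerivAt h.sh.hm _).comp t ha
    refine this.congr_deriv ?_
    ring
  have hb := h.ra.smooth.hasDerivAt_shift UU_open (h.dX t) (Rare.mem t1 (ξ + X t))
  have hD := h.sD.hasDerivAt_shift UU_open (h.dX t) (Rare.mem t1 (ξ + X t))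
  have hD1 := h.sD1.hasDerivAt_shift UU_open (h.dX t) (Rare.mem t1 (ξ + X t))
  have hD2 := h.sD2.hasDerivAt_shift UU_open (h.dX t) (Rare.mem t1 (ξ + X t))
  have hB := (h.ra.smooth.hasDerivAt_t UU_open (Rare.mem t1 ξ0)).sub_const m
  have hR1 := (dst h.sr1 t ξ).add hD1
  have hR2 := (dst h.sr2 t ξ).add hD2
  have e1 := en1_der (τ := τ) (dst h.sf1 t ξ) (dst h.sf2 t ξ) hR1 hR2 hw
  have e2 := en2_der (m := m) hB (dst h.sf t ξ) ha
  have e3 := en3_der (m := m) hB (th_der h.sh.hm t1) ha1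
  have e4 := en4_der hb hD
  refine (((e1.add e2).add e3).add e4).congr_deriv ?_
  have k3 : τ * (dt (dx r) t ξ + (dt (dx (dx (tuR m wR))) t (ξ + X t) + (deriv X t) * (dx (dx (dx (tuR m wR))) t (ξ + X t))))
      = τ * (3 * m ^ 2) * (dx (dx r) t ξ + dx (dx (dx (tuR m wR))) t (ξ + X t)) - (dx r t ξ + dx (dx (tuR m wR)) t (ξ + X t)) + (dx (dx φ) t ξ) - τ * (deriv X t) * qtwo m (uS (ξ + X t)) (deriv uS (ξ + X t)) (deriv (deriv uS) (ξ + X t)) + (dx (dx (tuR m wR)) t (ξ + X t)) - τ * (3 * m ^ 2) * (dx (dx (dx (tuR m wR))) t (ξ + X t)) := by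
    linear_combination h.er1 ht ξ
  have k4 : τ * (dt (dx (dx r)) t ξ + (dt (dx (dx (dx (tuR m wR)))) t (ξ + X t) + (deriv X t) * (dx (dx (dx (dx (tuR m wR)))) t (ξ + X t))))
      = τ * (3 * m ^ 2) * (dx (dx (dx r)) t ξ + dx (dx (dx (dx (tuR m wR)))) t (ξ + X t)) - (dx (dx r) t ξ + dx (dx (dx (tuR m wR))) t (ξ + X t)) + (dx (dx (dx φ)) t ξ) - τ * (deriv X t) * qthree m (uS (ξ + X t)) (deriv uS (ξ + X t)) (deriv (deriv uS) (ξ + X t)) (deriv (deriv (deriv uS)) (ξ + X t)) + (dx (dx (dx (tuR m wR))) t (ξ + X t))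
        - τ * (3 * m ^ 2) * (dx (dx (dx (dx (tuR m wR)))) t (ξ + X t)) := by
    linear_combination h.er2 ht ξ
  have i1 := alg1 (ω := (W m (uS (ξ + X t)))) (ω1 := (Wd m (uS (ξ + X t)) * deriv uS (ξ + X t))) (h.eq1 ht ξ) (h.eq2 ht ξ) k3 k4
  have i2 := alg2 (B := (tuR m wR t ξ0 - m)) (Bt := (dt (tuR m wR) t ξ0)) (h.eq0 ht ξ)
  have i4 := alg4 (s := t) (Y := (deriv X t)) (h.ra.bt t1 (ξ + X t)) (h.ra.Dt t1 (ξ + X t))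
  unfold Flx Rs Res fl1x fl2x fl3 fl4x Rare.kap
  rw [← i1, ← i2]
  simp only [Pi.add_apply]
  linear_combination i4

end Sys
end

noncomputable section

lemma sob {g g' : ℝ → ℝ} (hd : ∀ x, HasDerivAt g (g' x) x) (hc : Continuous g')
    (h0 : Integrable (fun x => (g x) ^ 2)) (h1 : Integrable (fun x => (g' x) ^ 2)) (x : ℝ) :
    (g x) ^ 2 ≤ 2 * ((∫ x, (g x) ^ 2) + ∫ x, (g' x) ^ 2) := by
  have hg : Continuous g := continuous_iff_continuousAt.mpr fun t => (hd t).continuousAt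
  have hG : ∀ y, HasDerivAt (fun y => (g y) ^ 2 * (x + 1 - y))
      (2 * g y * g' y * (x + 1 - y) - (g y) ^ 2) y := by
    intro y
    have := ((hd y).pow 2).mul ((hasDerivAt_id y).const_sub (x + 1))
    refine (this.congr_of_eventuallyEq (Filter.Eventually.of_forall ?_)).congr_deriv ?_
    · intro x; simp
    · simp only [Pi.pow_apply, id]; push_cast; ring
  have hcont : Continuous (fun y => 2 * g y * g' y * (x + 1 - y) - (g y) ^ 2) := by fun_prop
  have ftc := intervalIntegral.integral_eq_sub_of_hasDerivAt (a := x) (b := x + 1) (fun y _ => hG y)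
    (hcont.intervalIntegrable _ _)
  have hle : (∫ y in x..(x + 1), -(2 * g y * g' y * (x + 1 - y) - (g y) ^ 2))
      ≤ ∫ y in x..(x + 1), (2 * (g y) ^ 2 + (g' y) ^ 2) := by
    apply intervalIntegral.integral_mono_on (by linarith)
    · exact hcont.neg.intervalIntegrable _ _
    · exact (by fun_prop : Continuous (fun y => 2 * (g y) ^ 2 + (g' y) ^ 2)).intervalIntegrable _ _
    · intro y hy
      have c0 : 0 ≤ x + 1 - y := by linarith [hy.2]
      have c1 : x + 1 - y ≤ 1 := by linarith [hy.1]
      have q : -(2 * g y * g' y * (x + 1 - y)) ≤ (x + 1 - y) * ((g y) ^ 2 + (g' y) ^ 2) := by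
        have := mul_nonneg c0 (sq_nonneg (g y + g' y))
        linarith
      have q2 := mul_le_mul_of_nonneg_right c1 (by positivity : 0 ≤ (g y) ^ 2 + (g' y) ^ 2)
      linarith
  have hI : Integrable (fun y => 2 * (g y) ^ 2 + (g' y) ^ 2) := (h0.const_mul 2).add h1
  have hle2 : (∫ y in x..(x + 1), (2 * (g y) ^ 2 + (g' y) ^ 2)) ≤ ∫ y, (2 * (g y) ^ 2 + (g' y) ^ 2) := by
    rw [intervalIntegral.integral_of_le (by linarith)]
    exact setIntegral_le_integral hI (Filter.Eventually.of_forall fun y => by positivity)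
  have e : (∫ y, (2 * (g y) ^ 2 + (g' y) ^ 2)) = 2 * (∫ y, (g y) ^ 2) + ∫ y, (g' y) ^ 2 := by
    rw [integral_add (h0.const_mul 2) h1, integral_const_mul]
  have p1 : 0 ≤ ∫ y, (g' y) ^ 2 := integral_nonneg fun y => by positivity
  rw [intervalIntegral.integral_neg, ftc] at hle
  simp only [sub_self, mul_zero] at hle
  have : (g x) ^ 2 * (x + 1 - x) = (g x) ^ 2 := by ring
  linarith

/-- Nonnegative derivative of a bounded function is integrable. -/
lemma int_mono {f g : ℝ → ℝ} {lo hi : ℝ} (hd : ∀ x, HasDerivAt f (g x) x) (hc : Continuous g)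
    (hp : ∀ x, 0 ≤ g x) (hlo : ∀ x, lo ≤ f x) (hhi : ∀ x, f x ≤ hi) :
    Integrable g ∧ ∫ x, g x ≤ hi - lo := by
  have key : ∀ n : ℝ, ∫ x in (-n)..n, g x ≤ hi - lo := fun n => by
    rw [intervalIntegral.integral_eq_sub_of_hasDerivAt (fun y _ => hd y) (hc.intervalIntegrable _ _)]
    linarith [hlo (-n), hhi n]
  have hI : Integrable g := by
    refine integrable_of_intervalIntegral_norm_bounded (hi - lo) (a := fun n : ℝ => -n)
      (b := fun n : ℝ => n) (l := atTop) (fun n => hc.integrableOn_Ioc)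
      tendsto_neg_atTop_atBot tendsto_id (Filter.Eventually.of_forall fun n => ?_)
    have : (fun x => ‖g x‖) = g := funext fun x => by rw [Real.norm_eq_abs, abs_of_nonneg (hp x)]
    rw [this]; exact key n
  refine ⟨hI, ?_⟩
  exact le_of_tendsto (intervalIntegral_tendsto_integral hI tendsto_neg_atTop_atBot tendsto_id)
    (Filter.Eventually.of_forall fun n : ℝ => key n)

lemma sup_b {f : ℝ → ℝ → ℝ} {T : ℝ} (hb : ∀ t ∈ Set.Icc 0 T, ∀ ξ, |f t ξ| ≤ 1) :
    (∀ t ∈ Set.Icc 0 T, ∀ ξ, |f t ξ| ≤ ⨆ a ∈ Set.Icc (0 : ℝ) T, ⨆ ξ : ℝ, |f a ξ|) ∧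
    (⨆ a ∈ Set.Icc (0 : ℝ) T, ⨆ ξ : ℝ, |f a ξ|) ≤ 1 := by
  have b1 : ∀ a, (⨆ (_ : a ∈ Set.Icc (0 : ℝ) T), ⨆ ξ : ℝ, |f a ξ|) ≤ 1 := by
    intro a
    by_cases ha : a ∈ Set.Icc (0 : ℝ) T
    · rw [ciSup_pos ha]; exact ciSup_le fun ξ => hb a ha ξ
    · rw [ciSup_neg ha]; simp
  refine ⟨fun t ht ξ => ?_, ciSup_le b1⟩
  have h1 : |f t ξ| ≤ ⨆ ξ : ℝ, |f t ξ| :=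
    le_ciSup (f := fun ξ => |f t ξ|) ⟨1, by rintro _ ⟨y, rfl⟩; exact hb t ht y⟩ ξ
  have h2 : (⨆ (_ : t ∈ Set.Icc (0 : ℝ) T), ⨆ ξ : ℝ, |f t ξ|) = ⨆ ξ : ℝ, |f t ξ| := ciSup_pos ht
  rw [← h2] at h1
  exact h1.trans (le_ciSup (f := fun a => ⨆ (_ : a ∈ Set.Icc (0 : ℝ) T), ⨆ ξ : ℝ, |f a ξ|)
    ⟨1, by rintro _ ⟨y, rfl⟩; exact b1 y⟩ t)

namespace Sys
variable {m τ T ξ0 : ℝ} {uS : ℝ → ℝ} {wR φ r : ℝ → ℝ → ℝ} {X : ℝ → ℝ}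

lemma cst {f : ℝ → ℝ → ℝ} (h : SmoothOn Set.univ f) : Continuous (fun p : ℝ × ℝ => f p.1 p.2) :=
  continuousOn_univ.mp h.contOn

lemma csx {f : ℝ → ℝ → ℝ} (h : SmoothOn Set.univ f) (t : ℝ) : Continuous (f t) :=
  (cst h).comp (by fun_prop : Continuous fun y : ℝ => (t, y))

lemma ip (h : Sys m τ T ξ0 uS wR φ r X) {t : ℝ} (ht : t ∈ Set.Icc 0 T) :
    Integrable (fun ξ => (φ t ξ) ^ 2) ∧ Integrable (fun ξ => (dx φ t ξ) ^ 2) ∧ Integrable (fun ξ => (dx (dx φ) t ξ) ^ 2) ∧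
    Integrable (fun ξ => (r t ξ) ^ 2) ∧ Integrable (fun ξ => (dx r t ξ) ^ 2) ∧ Integrable (fun ξ => (dx (dx r) t ξ) ^ 2) := by
  have i0 := h.sol.2.2.1 t ht 0 (by norm_num)
  have i1 := h.sol.2.2.1 t ht 1 (by norm_num)
  have i2 := h.sol.2.2.1 t ht 2 (by norm_num)
  simp only [iteratedDeriv_zero] at i0
  simp only [iteratedDeriv_one] at i1
  simp only [← dx_dx_eq] at i2
  exact ⟨i0.1, i1.1, i2.1, i0.2, i1.2, i2.2⟩

lemma Hn (f : ℝ → ℝ → ℝ) (t : ℝ) : HnormSq 2 (f t)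
    = (∫ ξ, (f t ξ) ^ 2) + (∫ ξ, (dx f t ξ) ^ 2) + ∫ ξ, (dx (dx f) t ξ) ^ 2 := by
  unfold HnormSq
  rw [Finset.sum_range_succ, Finset.sum_range_succ, Finset.sum_range_one]
  simp only [iteratedDeriv_zero, iteratedDeriv_one, ← dx_dx_eq]
  rfl

lemma nrm (h : Sys m τ T ξ0 uS wR φ r X) {t : ℝ} (ht : t ∈ Set.Icc 0 T) :
    (∫ ξ, (φ t ξ) ^ 2) + (∫ ξ, (dx φ t ξ) ^ 2) + (∫ ξ, (dx (dx φ) t ξ) ^ 2) ≤ 1 / 4 ∧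
    τ * ((∫ ξ, (r t ξ) ^ 2) + (∫ ξ, (dx r t ξ) ^ 2) + (∫ ξ, (dx (dx r) t ξ) ^ 2)) ≤ 1 / 4 := by
  have e := h.ep t ht
  rw [← Hn φ t, ← Hn r t]
  have n1 : 0 ≤ HnormSq 2 (φ t) := by
    unfold HnormSq; exact Finset.sum_nonneg fun i _ => integral_nonneg fun x => by positivity
  have n2 : 0 ≤ HnormSq 2 (r t) := by
    unfold HnormSq; exact Finset.sum_nonneg fun i _ => integral_nonneg fun x => by positivity
  have s1 := Real.sqrt_nonneg (HnormSq 2 (φ t))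
  have s2 := mul_nonneg (Real.sqrt_nonneg τ) (Real.sqrt_nonneg (HnormSq 2 (r t)))
  have q1 := Real.sq_sqrt n1
  have q2 := Real.sq_sqrt n2
  have q3 := Real.sq_sqrt h.sh.hτ.le
  constructor
  · nlinarith
  · have : τ * HnormSq 2 (r t) = (Real.sqrt τ * Real.sqrt (HnormSq 2 (r t))) ^ 2 := by
      rw [mul_pow, q2, q3]
    rw [this]; nlinarith

lemma p_le (h : Sys m τ T ξ0 uS wR φ r X) {t : ℝ} (ht : t ∈ Set.Icc 0 T) (ξ : ℝ) : |(φ t ξ)| ≤ 1 ∧ |(dx φ t ξ)| ≤ 1 := by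
  obtain ⟨i0, i1, i2, -⟩ := h.ip ht
  have n := (h.nrm ht).1
  have n0 : 0 ≤ ∫ ξ, (φ t ξ) ^ 2 := integral_nonneg fun x => by positivity
  have n2 : 0 ≤ ∫ ξ, (dx (dx φ) t ξ) ^ 2 := integral_nonneg fun x => by positivity
  have k1 := sob (fun y => dsx h.sf t y) (csx h.sf1 t) i0 i1 ξ
  have k2 := sob (fun y => dsx h.sf1 t y) (csx h.sf2 t) i1 i2 ξ
  constructor
  · rw [← sq_le_one_iff_abs_le_one]; linarith
  · rw [← sq_le_one_iff_abs_le_one]; linarith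

lemma ia (h : Sys m τ T ξ0 uS wR φ r X) : Integrable (deriv uS) ∧ ∫ x, deriv uS x ≤ 3 * m := by
  have := int_mono (fun x => h.sh.d1 x) h.sh.smooth1.continuous (fun x => (h.sh.pos x).le)
    (fun x => (h.sh.lo x).le) (fun x => (h.sh.hi x).le)
  exact ⟨this.1, this.2.trans (by linarith)⟩

lemma cD (h : Sys m τ T ξ0 uS wR φ r X) {t : ℝ} (ht : t ∈ Set.Icc 0 T) {f : ℝ → ℝ → ℝ} (hf : SmoothOn UU f) : Continuous (f t) := by
  have := hf.contOn.comp_continuous (by fun_prop : Continuous fun y : ℝ => (t, y))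
    (fun y => Rare.mem (by linarith [ht.1]) y)
  exact this

lemma iD (h : Sys m τ T ξ0 uS wR φ r X) {t : ℝ} (ht : t ∈ Set.Icc 0 T) :
    Integrable (dx (tuR m wR) t) ∧ ∫ x, dx (tuR m wR) t x ≤ 9 * m ^ 2 := by
  have t1 : -1 < t := by linarith [ht.1]
  have := int_mono (fun x => h.ra.db t1 x) (h.cD ht h.sD) (fun x => (h.ra.D_pos t1 x).le)
    (fun x => (h.ra.b_bd t1 x).1.le) (fun x => (h.ra.b_bd t1 x).2.le)
  exact ⟨this.1, this.2.trans (by linarith)⟩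

lemma Y_eq (h : Sys m τ T ξ0 uS wR φ r X) (t : ℝ) : (deriv X t) = (32 / (25 * m ^ 2)) *
    ∫ ζ : ℝ, φ t (ζ - X t) * W m (uS ζ) * deriv uS ζ := by
  rw [(h.sol.2.2.2.2.1 t).deriv]
  congr 1
  have e := integral_add_right_eq_self (μ := volume) (fun ζ => φ t (ζ - X t) * W m (uS ζ) * deriv uS ζ) (X t)
  rw [← e]
  simp only [add_sub_cancel_right]

lemma w_b (h : Sys m τ T ξ0 uS wR φ r X) (ζ : ℝ) : 15 / 8 * m ^ 2 ≤ W m (uS ζ) ∧ W m (uS ζ) ≤ 15 / 2 * m ^ 2 :=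
  W_bound h.sh.hm (h.sh.lo ζ) (h.sh.hi ζ)

lemma Y_int_b (h : Sys m τ T ξ0 uS wR φ r X) {t : ℝ} (ht : t ∈ Set.Icc 0 T) (ζ : ℝ) :
    ‖φ t (ζ - X t) * W m (uS ζ) * deriv uS ζ‖ ≤ 15 / 2 * m ^ 2 * deriv uS ζ := by
  have hm := h.sh.hm
  have hw := h.w_b ζ
  rw [Real.norm_eq_abs]
  have w1 : |W m (uS ζ)| ≤ 15 / 2 * m ^ 2 := by
    rw [abs_of_nonneg (by have : 0 < m ^ 2 := by positivity
                          linarith)]; exact hw.2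
  have := bM (bM (h.p_le ht (ζ - X t)).1 w1) (abs_of_pos (h.sh.pos ζ)).le
  linarith

lemma uS_cont (h : Sys m τ T ξ0 uS wR φ r X) : Continuous uS := h.sh.smooth.continuous

lemma Y_cont (h : Sys m τ T ξ0 uS wR φ r X) : ContinuousOn (deriv X) (Set.Icc 0 T) := by
  have e : deriv X = fun t => (32 / (25 * m ^ 2)) *
    ∫ ζ : ℝ, φ t (ζ - X t) * W m (uS ζ) * deriv uS ζ := funext fun t => h.Y_eq t
  rw [e]
  refine ContinuousOn.mul continuousOn_const ?_
  have c0 := cst h.sf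
  have c1 := h.uS_cont
  have c2 := h.sh.smooth1.continuous
  have c3 := W_cont h.sh.hm
  have c4 := h.X_cont
  refine continuousOn_of_dominated (bound := fun ζ => 15 / 2 * m ^ 2 * deriv uS ζ) ?_ ?_ ?_ ?_
  · intro t ht
    have : Continuous (fun ζ => φ t (ζ - X t)) :=
      c0.comp (by fun_prop : Continuous fun ζ : ℝ => (t, ζ - X t))
    exact ((this.mul (c3.comp c1)).mul c2).aestronglyMeasurable
  · exact fun t ht => Filter.Eventually.of_forall fun ζ => h.Y_int_b ht ζ
  · exact h.ia.1.const_mul _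
  · refine Filter.Eventually.of_forall fun ζ => Continuous.continuousOn ?_
    have : Continuous (fun t => φ t (ζ - X t)) :=
      c0.comp (by fun_prop : Continuous fun t : ℝ => (t, ζ - X t))
    exact (this.mul continuous_const).mul continuous_const

lemma Y_le (h : Sys m τ T ξ0 uS wR φ r X) {t : ℝ} (ht : t ∈ Set.Icc 0 T) : |(deriv X t)| ≤ 30 * m := by
  have hm := h.sh.hm
  rw [h.Y_eq, abs_mul, abs_of_nonneg (by positivity)]
  have k := norm_integral_le_of_norm_le (h.ia.1.const_mul (15 / 2 * m ^ 2))
    (Filter.Eventually.of_forall fun ζ => h.Y_int_b ht ζ)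
  rw [integral_const_mul, Real.norm_eq_abs] at k
  have k2 := mul_le_mul_of_nonneg_left h.ia.2 (by positivity : 0 ≤ 15 / 2 * m ^ 2)
  have k3 := mul_le_mul_of_nonneg_left (k.trans k2) (by positivity : 0 ≤ 32 / (25 * m ^ 2))
  refine k3.trans ?_
  have : 32 / (25 * m ^ 2) * (15 / 2 * m ^ 2 * (3 * m)) = 28.8 * m := by field_simp; norm_num
  rw [this]; linarith

def N0 (T : ℝ) (φ : ℝ → ℝ → ℝ) : ℝ := ⨆ a ∈ Set.Icc (0 : ℝ) T, ⨆ ξ : ℝ, |φ a ξ|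

lemma N0_b (h : Sys m τ T ξ0 uS wR φ r X) : (∀ t ∈ Set.Icc 0 T, ∀ ξ, |(φ t ξ)| ≤ N0 T φ) ∧ N0 T φ ≤ 1 :=
  sup_b fun t ht ξ => (h.p_le ht ξ).1
lemma N1_b (h : Sys m τ T ξ0 uS wR φ r X) : (∀ t ∈ Set.Icc 0 T, ∀ ξ, |(dx φ t ξ)| ≤ N0 T (dx φ)) ∧ N0 T (dx φ) ≤ 1 :=
  sup_b fun t ht ξ => (h.p_le ht ξ).2

/-- All pointwise hypotheses hold. -/
lemma pt (h : Sys m τ T ξ0 uS wR φ r X) {t : ℝ} (ht : t ∈ Set.Icc 0 T) (ξ : ℝ) :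
    Pt m τ (N0 T φ) (N0 T (dx φ)) (φ t ξ) (dx φ t ξ) (uS (ξ + X t)) (deriv uS (ξ + X t)) (deriv (deriv uS) (ξ + X t)) (deriv (deriv (deriv uS)) (ξ + X t)) (tuR m wR t (ξ + X t)) (dx (tuR m wR) t (ξ + X t)) (dx (dx (tuR m wR)) t (ξ + X t)) (dx (dx (dx (tuR m wR))) t (ξ + X t)) (dx (dx (dx (dx (tuR m wR)))) t (ξ + X t)) (Rare.kap m wR t (ξ + X t)) (tuR m wR t ξ0 - m) (dt (tuR m wR) t ξ0) (th m t) (deriv X t) (W m (uS (ξ + X t))) (Wd m (uS (ξ + X t)) * deriv uS (ξ + X t))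
      |ξ + X t - ξ0| := by
  have t1 : -1 < t := by linarith [ht.1]
  have hm := h.sh.hm
  have hw := h.w_b (ξ + X t)
  have hk := h.ra.kap_bd t1 (ξ + X t)
  have hB := h.ra.b_bd t1 ξ0
  have hDb := h.ra.D_bds t1 (ξ + X t)
  have hc := h.sh.cmp (ξ + X t)
  exact {
    m0 := hm
    ms := h.ms
    t0 := h.sh.hτ
    t1 := h.t1
    p0 := h.N0_b.1 t ht ξ
    p1 := h.N1_b.1 t ht ξ
    n0 := h.N0_b.2
    n1 := h.N1_b.2
    alo := h.sh.lo _
    ahi := h.sh.hi _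
    a1p := h.sh.pos _
    a1l := h.sh.le5 _
    cmp1 := hc.1
    cmp2 := hc.2
    a2b := h.sh.a2_bd _
    a3b := h.sh.a3_bd _
    blo := (h.ra.b_bd t1 _).1
    bhi := (h.ra.b_bd t1 _).2
    Dp := h.ra.D_pos t1 _
    Dl := h.ra.D_le t1 _
    Dth := h.ra.D_le_th t1 _
    kp := hk.1
    kl := hk.2
    D1b := hDb.1
    D2b := hDb.2.1
    D3b := hDb.2.2
    Bp := by linarith [hB.1]
    Bl := by linarith [hB.2]
    Btn := by
      rw [h.ra.bt t1]
      have := h.ra.D_pos t1 ξ0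
      have h2 : 0 ≤ 3 * (tuR m wR t ξ0) ^ 2 - 3 * m ^ 2 := by nlinarith [hB.1]
      linarith [mul_nonneg h2 this.le]
    bB := by
      have := h.ra.b_lip t1 (ξ + X t) ξ0
      rwa [show (tuR m wR t (ξ + X t)) - m - (tuR m wR t ξ0 - m) = (tuR m wR t (ξ + X t)) - tuR m wR t ξ0 by ring]
    dec := by rw [sq_abs]; exact h.sh.decay h.z0 _
    lp := abs_nonneg _
    thp := h.ra.th_pos t1
    Yb := h.Y_le ht
    wlo := hw.1
    whi := hw.2
    w1b := by
      rw [abs_mul, abs_of_pos (h.sh.pos _)]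
      refine mul_le_mul_of_nonneg_right ?_ (h.sh.pos _).le
      have := Wd_bound hm (uS (ξ + X t))
      rw [abs_le]; constructor <;> linarith [this.1, this.2] }

end Sys
end

noncomputable section

/-- Cutoff. -/
def chi (n : ℕ) (x : ℝ) : ℝ := 1 - (x / n) ^ 2

lemma chi_cont (n : ℕ) : Continuous (chi n) := by unfold chi; fun_prop

lemma chi_bd {n : ℕ} (hn : 1 ≤ n) {x : ℝ} (hx : x ∈ Set.Icc (-(n : ℝ)) n) :
    0 ≤ chi n x ∧ chi n x ≤ 1 := by
  have hn' : (0 : ℝ) < n := by exact_mod_cast hn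
  have h1 : |x / n| ≤ 1 := by
    rw [abs_div, abs_of_pos hn', div_le_one hn']
    exact abs_le.2 hx
  have h2 : (x / n) ^ 2 ≤ 1 := by
    rw [← sq_abs]; nlinarith [abs_nonneg (x / n)]
  unfold chi
  constructor
  · linarith
  · linarith [sq_nonneg (x / n)]

lemma chi_der (n : ℕ) (x : ℝ) : HasDerivAt (chi n) (-(2 * (x / n) / n)) x := by
  have h := (((hasDerivAt_id x).div_const (n : ℝ)).pow 2).const_sub 1
  refine (h.congr_of_eventuallyEq (Filter.Eventually.of_forall ?_)).congr_deriv ?_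
  · intro x; simp [chi]
  · simp; ring

lemma chi_tendsto {f : ℝ → ℝ} (hf : Integrable f) :
    Tendsto (fun n : ℕ => ∫ x in (-(n : ℝ))..n, chi n x * f x) atTop (nhds (∫ x, f x)) := by
  have e : ∀ n : ℕ, (∫ x in (-(n : ℝ))..n, chi n x * f x)
      = ∫ x, (Set.Ioc (-(n : ℝ)) n).indicator (fun x => chi n x * f x) x := by
    intro n
    have hn : (0 : ℝ) ≤ n := Nat.cast_nonneg n
    rw [intervalIntegral.integral_of_le (by linarith), integral_indicator measurableSet_Ioc]
  simp_rw [e]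
  refine tendsto_integral_filter_of_dominated_convergence (fun x => |f x|) ?_ ?_ hf.abs ?_
  · refine Filter.Eventually.of_forall fun n => ?_
    exact ((chi_cont n).aestronglyMeasurable.mul hf.1).indicator measurableSet_Ioc
  · filter_upwards [eventually_ge_atTop 1] with n hn
    refine Filter.Eventually.of_forall fun x => ?_
    by_cases hx : x ∈ Set.Ioc (-(n : ℝ)) n
    · rw [Set.indicator_of_mem hx]
      have := chi_bd hn (Set.Ioc_subset_Icc_self hx)
      rw [Real.norm_eq_abs, abs_mul, abs_of_nonneg this.1]
      nlinarith [abs_nonneg (f x)]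
    · rw [Set.indicator_of_notMem hx]; simp
  · refine Filter.Eventually.of_forall fun x => ?_
    have h1 : Tendsto (fun n : ℕ => chi n x * f x) atTop (nhds ((1 - 0 ^ 2) * f x)) := by
      unfold chi
      exact (((tendsto_const_div_atTop_nhds_zero_nat x).pow 2).const_sub 1).mul_const _
    have h2 : (1 - (0 : ℝ) ^ 2) * f x = f x := by ring
    rw [h2] at h1
    refine h1.congr' ?_
    filter_upwards [eventually_gt_atTop (Nat.ceil |x|)] with n hn
    have : |x| < n := lt_of_le_of_lt (Nat.le_ceil _) (by exact_mod_cast hn)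
    rw [Set.indicator_of_mem]
    have h3 := abs_lt.1 this
    exact ⟨h3.1, h3.2.le⟩

lemma chi_mono {n : ℕ} (hn : 1 ≤ n) {f g : ℝ → ℝ} (hf : ∀ x, f x ≤ g x)
    (if' : IntervalIntegrable f volume (-(n : ℝ)) n) (ig : IntervalIntegrable g volume (-(n : ℝ)) n) :
    (∫ x in (-(n : ℝ))..n, chi n x * f x) ≤ ∫ x in (-(n : ℝ))..n, chi n x * g x := by
  have hn' : (0 : ℝ) ≤ n := Nat.cast_nonneg n
  refine intervalIntegral.integral_mono_on (by linarith)
    (if'.continuousOn_mul (chi_cont n).continuousOn)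
    (ig.continuousOn_mul (chi_cont n).continuousOn) ?_
  intro x hx
  exact mul_le_mul_of_nonneg_left (hf x) (chi_bd hn hx).1

lemma chi_le {n : ℕ} (hn : 1 ≤ n) {f : ℝ → ℝ} (hf : ∀ x, 0 ≤ f x) (hi : Integrable f) :
    (∫ x in (-(n : ℝ))..n, chi n x * f x) ≤ ∫ x, f x := by
  have hn' : (0 : ℝ) ≤ n := Nat.cast_nonneg n
  calc (∫ x in (-(n : ℝ))..n, chi n x * f x) ≤ ∫ x in (-(n : ℝ))..n, f x := by
        refine intervalIntegral.integral_mono_on (by linarith)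
          (hi.intervalIntegrable.continuousOn_mul (chi_cont n).continuousOn)
          hi.intervalIntegrable ?_
        intro x hx
        have := chi_bd hn hx
        nlinarith [hf x]
    _ ≤ ∫ x, f x := by
        rw [intervalIntegral.integral_of_le (by linarith)]
        exact setIntegral_le_integral hi (Filter.Eventually.of_forall hf)

lemma chi_parts {n : ℕ} (hn : 1 ≤ n) {F Fx : ℝ → ℝ} (hd : ∀ x, HasDerivAt F (Fx x) x)
    (hc : Continuous Fx) {c : ℝ} (hb : ∫ x in (-(n : ℝ))..n, |F x| ≤ c) :
    ∫ x in (-(n : ℝ))..n, chi n x * Fx x ≤ 2 / n * c := by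
  have hn' : (0 : ℝ) < n := by exact_mod_cast hn
  have cF : Continuous F := continuous_iff_continuousAt.2 fun x => (hd x).continuousAt
  have h := intervalIntegral.integral_mul_deriv_eq_deriv_mul (a := -(n : ℝ)) (b := n)
    (u := chi n) (v := F) (u' := fun x => -(2 * (x / n) / n)) (v' := Fx)
    (fun x _ => chi_der n x) (fun x _ => hd x)
    ((by fun_prop : Continuous fun x : ℝ => -(2 * (x / n) / n)).intervalIntegrable _ _)
    (hc.intervalIntegrable _ _)
  rw [h]
  have e1 : chi n (n : ℝ) = 0 := by unfold chi; field_simp; ring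
  have e2 : chi n (-(n : ℝ)) = 0 := by unfold chi; field_simp; ring
  rw [e1, e2]
  have : -∫ x in (-(n : ℝ))..n, -(2 * (x / n) / n) * F x
      ≤ ∫ x in (-(n : ℝ))..n, 2 / n * |F x| := by
    rw [← intervalIntegral.integral_neg]
    refine intervalIntegral.integral_mono_on (by linarith)
      ((by fun_prop : Continuous fun x : ℝ => -(-(2 * (x / n) / n) * F x)).intervalIntegrable _ _)
      ((by fun_prop : Continuous fun x : ℝ => 2 / n * |F x|).intervalIntegrable _ _) ?_
    intro x hx
    have h1 : |x / n| ≤ 1 := by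
      rw [abs_div, abs_of_pos hn', div_le_one hn']
      exact abs_le.2 hx
    have h2 : -(-(2 * (x / n) / n) * F x) = 2 / n * ((x / n) * F x) := by ring
    rw [h2]
    refine mul_le_mul_of_nonneg_left ?_ (by positivity)
    calc (x / n) * F x ≤ |x / n * F x| := le_abs_self _
      _ = |x / n| * |F x| := abs_mul _ _
      _ ≤ |F x| := by nlinarith [abs_nonneg (F x)]
  rw [intervalIntegral.integral_const_mul] at this
  have h3 : 2 / (n : ℝ) * ∫ x in (-(n : ℝ))..n, |F x| ≤ 2 / n * c :=
    mul_le_mul_of_nonneg_left hb (by positivity)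
  linarith

/-- Extension of a function on a strip. -/
lemma strip_ext {t : ℝ} (ht : 0 ≤ t) {H : ℝ → ℝ → ℝ}
    (hH : ContinuousOn (fun p : ℝ × ℝ => H p.1 p.2) (Set.Icc 0 t ×ˢ Set.univ)) :
    ∃ G : ℝ → ℝ → ℝ, Continuous (fun p : ℝ × ℝ => G p.1 p.2) ∧
      ∀ s ∈ Set.Icc 0 t, ∀ x, G s x = H s x := by
  refine ⟨fun s x => H (Set.projIcc 0 t ht s) x, ?_, ?_⟩
  · have : Continuous (fun p : ℝ × ℝ => (((Set.projIcc 0 t ht p.1 : Set.Icc 0 t) : ℝ), p.2)) := by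
      have := continuous_projIcc (a := (0 : ℝ)) (b := t) (h := ht)
      fun_prop
    exact hH.comp_continuous this (fun p => ⟨(Set.projIcc 0 t ht p.1).2, trivial⟩)
  · intro s hs x
    simp only [Set.projIcc_of_mem ht hs]

lemma time_int {t : ℝ} (ht : 0 ≤ t) {H : ℝ → ℝ → ℝ}
    (hH : ContinuousOn (fun p : ℝ × ℝ => H p.1 p.2) (Set.Icc 0 t ×ˢ Set.univ))
    {M : ℝ} (hM : ∀ s ∈ Set.Icc 0 t, |∫ x, H s x| ≤ M) :
    IntervalIntegrable (fun s => ∫ x, H s x) volume 0 t := by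
  obtain ⟨G, hG, e⟩ := strip_ext ht hH
  have h1 : StronglyMeasurable (fun s => ∫ x, G s x) :=
    hG.stronglyMeasurable.integral_prod_right (ν := volume)
  rw [intervalIntegrable_iff_integrableOn_Icc_of_le ht]
  have e' : ∀ s ∈ Set.Icc 0 t, (∫ x, G s x) = ∫ x, H s x := fun s hs =>
    integral_congr_ae (Filter.Eventually.of_forall fun x => e s hs x)
  have h2 : IntegrableOn (fun s => ∫ x, G s x) (Set.Icc 0 t) volume := by
    refine Measure.integrableOn_of_bounded (M := M) (by simp) h1.aestronglyMeasurable ?_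
    filter_upwards [ae_restrict_mem measurableSet_Icc] with s hs
    rw [e' s hs]
    exact hM s hs
  exact h2.congr_fun e' measurableSet_Icc

lemma chi_ii (n : ℕ) {f : ℝ → ℝ} (hf : Continuous f) :
    IntervalIntegrable (fun x => chi n x * f x) volume (-(n : ℝ)) n :=
  ((chi_cont n).mul hf).intervalIntegrable _ _

lemma swap_id {t : ℝ} (ht : 0 ≤ t) (n : ℕ) {e G : ℝ → ℝ → ℝ}
    (hG : Continuous (fun p : ℝ × ℝ => G p.1 p.2))
    (hd : ∀ s ∈ Set.Icc 0 t, ∀ x, HasDerivAt (fun s => e s x) (G s x) s) :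
    (∫ x in (-(n : ℝ))..n, chi n x * (e t x - e 0 x))
      = ∫ s in (0 : ℝ)..t, ∫ x in (-(n : ℝ))..n, chi n x * G s x := by
  have h1 : ∀ x, chi n x * (e t x - e 0 x) = ∫ s in (0 : ℝ)..t, chi n x * G s x := by
    intro x
    rw [intervalIntegral.integral_const_mul]
    rw [intervalIntegral.integral_eq_sub_of_hasDerivAt]
    · intro s hs
      rw [Set.uIcc_of_le ht] at hs
      exact hd s hs x
    · exact ((hG.comp (by fun_prop : Continuous fun s : ℝ => (s, x)))).intervalIntegrable _ _
  simp_rw [h1]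
  refine intervalIntegral_intervalIntegral_swap (F := fun x s => chi n x * G s x) ?_
  have : Continuous (Function.uncurry fun x s => chi n x * G s x) := by
    have h3 := chi_cont n
    have h4 : Continuous (fun p : ℝ × ℝ => G p.2 p.1) :=
      hG.comp (by fun_prop : Continuous fun p : ℝ × ℝ => (p.2, p.1))
    exact (h3.comp continuous_fst).mul h4
  refine (this.continuousOn.integrableOn_compact (μ := volume) (K := Set.uIcc (-(n : ℝ)) n ×ˢ Set.uIcc 0 t)
    (isCompact_uIcc.prod isCompact_uIcc)).mono_set ?_
  exact Set.prod_mono Set.uIoc_subset_uIcc Set.uIoc_subset_uIcc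

theorem cutoff {t : ℝ} (ht : 0 ≤ t) {e F Fx R q : ℝ → ℝ → ℝ} {g : ℝ → ℝ → ℝ} {J : ℝ → ℝ}
    {eh et : ℝ → ℝ} {Cf M : ℝ}
    (hd : ∀ s ∈ Set.Icc 0 t, ∀ x, HasDerivAt (fun s => e s x) (Fx s x + R s x) s)
    (hF : ∀ s ∈ Set.Icc 0 t, ∀ x, HasDerivAt (F s) (Fx s x) x)
    (cFx : ContinuousOn (fun p : ℝ × ℝ => Fx p.1 p.2) (Set.Icc 0 t ×ˢ Set.univ))
    (cR : ContinuousOn (fun p : ℝ × ℝ => R p.1 p.2) (Set.Icc 0 t ×ˢ Set.univ))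
    (ct : Continuous (e t)) (c0 : Continuous (e 0))
    (cq : Continuous (fun p : ℝ × ℝ => q p.1 p.2))
    (hR : ∀ s ∈ Set.Icc 0 t, ∀ x, R s x ≤ -q s x + g s x)
    (q0 : ∀ s ∈ Set.Icc 0 t, ∀ x, 0 ≤ q s x) (g0 : ∀ s ∈ Set.Icc 0 t, ∀ x, 0 ≤ g s x)
    (qi : ∀ s ∈ Set.Icc 0 t, Integrable (q s)) (gi : ∀ s ∈ Set.Icc 0 t, Integrable (g s))
    (qM : ∀ s ∈ Set.Icc 0 t, ∫ x, q s x ≤ M)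
    (gJ : ∀ s ∈ Set.Icc 0 t, ∫ x, g s x ≤ J s)
    (hJ : IntervalIntegrable J volume 0 t)
    (hf : ∀ s ∈ Set.Icc 0 t, ∀ n : ℕ, 1 ≤ n → ∫ x in (-(n : ℝ))..n, |F s x| ≤ Cf * √n)
    (heh : ∀ x, eh x ≤ e t x) (ieh : Integrable eh)
    (het : ∀ x, e 0 x ≤ et x) (et0 : ∀ x, 0 ≤ et x) (iet : Integrable et) :
    (∫ x, eh x) + (∫ s in (0 : ℝ)..t, ∫ x, q s x) ≤ (∫ x, et x) + ∫ s in (0 : ℝ)..t, J s := by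
  obtain ⟨G, hG, eG⟩ := strip_ext ht (H := fun s x => Fx s x + R s x) (cFx.add cR)
  have slice : ∀ {H : ℝ → ℝ → ℝ}, ContinuousOn (fun p : ℝ × ℝ => H p.1 p.2) (Set.Icc 0 t ×ˢ Set.univ) →
      ∀ s ∈ Set.Icc 0 t, Continuous (H s) := by
    intro H hH s hs
    exact hH.comp_continuous (by fun_prop : Continuous fun x : ℝ => (s, x)) (fun x => ⟨hs, trivial⟩)
  have qn : ∀ n : ℕ, Continuous (fun s => ∫ x in (-(n : ℝ))..n, chi n x * q s x) := by
    intro n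
    refine intervalIntegral.continuous_parametric_intervalIntegral_of_continuous' ?_ _ _
    exact ((chi_cont n).comp continuous_snd).mul cq
  have key : ∀ n : ℕ, 1 ≤ n →
      (∫ x in (-(n : ℝ))..n, chi n x * eh x) + (∫ s in (0 : ℝ)..t, ∫ x in (-(n : ℝ))..n, chi n x * q s x)
      ≤ (∫ x, et x) + (∫ s in (0 : ℝ)..t, J s) + t * (2 * Cf / √n) := by
    intro n hn
    have hn' : (0 : ℝ) < n := by exact_mod_cast hn
    have h1 := swap_id ht n hG (fun s hs x => by rw [eG s hs x]; exact hd s hs x)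
    have h2 : (∫ s in (0 : ℝ)..t, ∫ x in (-(n : ℝ))..n, chi n x * G s x)
        ≤ ∫ s in (0 : ℝ)..t, ((J s - ∫ x in (-(n : ℝ))..n, chi n x * q s x) + 2 * Cf / √n) := by
      refine intervalIntegral.integral_mono_on ht ?_ ?_ ?_
      · refine Continuous.intervalIntegrable ?_ _ _
        refine intervalIntegral.continuous_parametric_intervalIntegral_of_continuous' ?_ _ _
        exact ((chi_cont n).comp continuous_snd).mul hG
      · exact (hJ.sub ((qn n).intervalIntegrable _ _)).add intervalIntegrable_const
      · intro s hs
        have cq' : Continuous (q s) := cq.comp (by fun_prop : Continuous fun x : ℝ => (s, x))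
        have a1 : (∫ x in (-(n : ℝ))..n, chi n x * G s x)
            = (∫ x in (-(n : ℝ))..n, chi n x * Fx s x) + ∫ x in (-(n : ℝ))..n, chi n x * R s x := by
          rw [← intervalIntegral.integral_add
            (chi_ii n (slice cFx s hs)) (chi_ii n (slice cR s hs))]
          refine intervalIntegral.integral_congr fun x _ => ?_
          simp only [eG s hs x]; ring
        have a2 := chi_parts hn (hF s hs) (slice cFx s hs) (hf s hs n hn)
        have a3 := chi_mono hn (hR s hs) ((slice cR s hs).intervalIntegrable _ _)
          ((cq'.neg.intervalIntegrable _ _).add (gi s hs).intervalIntegrable)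
        have a4 := chi_le hn (g0 s hs) (gi s hs)
        have a5 := gJ s hs
        have a6 : (∫ x in (-(n : ℝ))..n, chi n x * (-q s x + g s x))
            = -(∫ x in (-(n : ℝ))..n, chi n x * q s x) + ∫ x in (-(n : ℝ))..n, chi n x * g s x := by
          rw [← intervalIntegral.integral_neg, ← intervalIntegral.integral_add
            (show IntervalIntegrable (fun x => -(chi n x * q s x)) volume (-(n : ℝ)) n from
              (chi_ii n cq').neg)
            ((gi s hs).intervalIntegrable.continuousOn_mul (chi_cont n).continuousOn)]
          refine intervalIntegral.integral_congr fun x _ => ?_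
          ring
        have a7 : 2 / (n : ℝ) * (Cf * √n) = 2 * Cf / √n := by
          have : √(n : ℝ) ≠ 0 := (Real.sqrt_pos.2 hn').ne'
          have h9 : √(n : ℝ) * √n = n := Real.mul_self_sqrt hn'.le
          rw [eq_div_iff this]
          calc 2 / (n : ℝ) * (Cf * √n) * √n = 2 / n * Cf * (√n * √n) := by ring
            _ = 2 * Cf := by rw [h9]; field_simp
        rw [a7] at a2
        rw [a1]
        simp only [a6] at a3
        linarith
    rw [intervalIntegral.integral_add (hJ.sub ((qn n).intervalIntegrable _ _)) intervalIntegrable_const,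
      intervalIntegral.integral_sub hJ ((qn n).intervalIntegrable _ _)] at h2
    have h3 : (∫ x in (-(n : ℝ))..n, chi n x * (e t x - e 0 x))
        = (∫ x in (-(n : ℝ))..n, chi n x * e t x) - ∫ x in (-(n : ℝ))..n, chi n x * e 0 x := by
      rw [← intervalIntegral.integral_sub (chi_ii n ct) (chi_ii n c0)]
      refine intervalIntegral.integral_congr fun x _ => ?_
      ring
    have h4 := chi_mono hn heh ieh.intervalIntegrable (ct.intervalIntegrable _ _)
    have h5 := chi_mono hn het (c0.intervalIntegrable _ _) iet.intervalIntegrable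
    have h6 := chi_le hn et0 iet
    simp only [intervalIntegral.integral_const, smul_eq_mul, sub_zero] at h2
    linarith
  have l1 := chi_tendsto ieh
  have l2 : Tendsto (fun n : ℕ => ∫ s in (0 : ℝ)..t, ∫ x in (-(n : ℝ))..n, chi n x * q s x) atTop
      (nhds (∫ s in (0 : ℝ)..t, ∫ x, q s x)) := by
    refine intervalIntegral.tendsto_integral_filter_of_dominated_convergence (fun _ => M) ?_ ?_
      intervalIntegrable_const ?_
    · exact Filter.Eventually.of_forall fun n => (qn n).aestronglyMeasurable
    · filter_upwards [eventually_ge_atTop 1] with n hn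
      refine Filter.Eventually.of_forall fun s hs => ?_
      rw [Set.uIoc_of_le ht] at hs
      have hs' := Set.Ioc_subset_Icc_self hs
      have hn' : (0 : ℝ) ≤ n := Nat.cast_nonneg n
      have := chi_le hn (q0 s hs') (qi s hs')
      have h0 : 0 ≤ ∫ x in (-(n : ℝ))..n, chi n x * q s x :=
        intervalIntegral.integral_nonneg (by linarith) fun x hx =>
          mul_nonneg (chi_bd hn hx).1 (q0 s hs' x)
      rw [Real.norm_eq_abs, abs_of_nonneg h0]
      exact this.trans (qM s hs')
    · refine Filter.Eventually.of_forall fun s hs => ?_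
      rw [Set.uIoc_of_le ht] at hs
      exact chi_tendsto (qi s (Set.Ioc_subset_Icc_self hs))
  have l3 : Tendsto (fun n : ℕ => (∫ x, et x) + (∫ s in (0 : ℝ)..t, J s) + t * (2 * Cf / √(n : ℝ))) atTop
      (nhds ((∫ x, et x) + (∫ s in (0 : ℝ)..t, J s) + t * 0)) := by
    refine Tendsto.const_add _ (Tendsto.const_mul _ ?_)
    exact tendsto_const_nhds.div_atTop (Real.tendsto_sqrt_atTop.comp tendsto_natCast_atTop_atTop)
  have := le_of_tendsto_of_tendsto (l1.add l2) l3 (by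
    filter_upwards [eventually_ge_atTop 1] with n hn using key n hn)
  linarith
end

noncomputable section

section gen
variable {m τ : ℝ} {S : Set (ℝ × ℝ)}
  {p p1 p2 p3 R1 R2 R3 a a1 a2 a3 b D D1 D2 D3 κ w w1 B Bt θ Y s : ℝ × ℝ → ℝ}

lemma fl1x_c (h0 : ContinuousOn p S) (h1 : ContinuousOn p1 S) (h2 : ContinuousOn p2 S)
    (h3 : ContinuousOn p3 S) (h4 : ContinuousOn R1 S) (h5 : ContinuousOn R2 S)
    (h6 : ContinuousOn R3 S) (h7 : ContinuousOn a S) (h8 : ContinuousOn a1 S)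
    (h9 : ContinuousOn b S) (h10 : ContinuousOn D S) (h11 : ContinuousOn w S)
    (h12 : ContinuousOn w1 S) :
    ContinuousOn (fun z => fl1x m τ (p z) (p1 z) (p2 z) (p3 z) (R1 z) (R2 z) (R3 z) (a z) (a1 z)
      (b z) (D z) (w z) (w1 z)) S := by
  unfold fl1x; fun_prop

lemma fl2x_c (h0 : ContinuousOn p S) (h1 : ContinuousOn p1 S) (h7 : ContinuousOn a S)
    (h8 : ContinuousOn a1 S) (h9 : ContinuousOn b S) (h10 : ContinuousOn D S)
    (h11 : ContinuousOn B S) :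
    ContinuousOn (fun z => fl2x m (B z) (p z) (p1 z) (a z) (a1 z) (b z) (D z)) S := by
  unfold fl2x gps gps' kk' gps cbar; fun_prop

lemma fl3_c (h0 : ContinuousOn B S) (h1 : ContinuousOn θ S) (h7 : ContinuousOn Y S)
    (h8 : ContinuousOn a1 S) :
    ContinuousOn (fun z => fl3 m (B z) (θ z) (Y z) (a1 z)) S := by
  unfold fl3; fun_prop

lemma fl4x_c (h0 : ContinuousOn Y S) (h1 : ContinuousOn b S) (h7 : ContinuousOn D S)
    (h8 : ContinuousOn D1 S) (h9 : ContinuousOn s S) :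
    ContinuousOn (fun z => fl4x m (Y z) (b z) (D z) (D1 z) (s z)) S := by
  unfold fl4x; fun_prop

lemma Res2_c (h0 : ContinuousOn p S) (h7 : ContinuousOn a S)
    (h8 : ContinuousOn a1 S) (h9 : ContinuousOn b S) (h10 : ContinuousOn D S)
    (h11 : ContinuousOn B S) (h12 : ContinuousOn Bt S) (h13 : ContinuousOn R1 S)
    (h14 : ContinuousOn Y S) :
    ContinuousOn (fun z => Res2 m (p z) (a z) (a1 z) (b z) (D z) (R1 z) (Y z) (B z) (Bt z)) S := by
  unfold Res2 HH gps gps' cbar; fun_prop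

lemma Res1_c (h0 : ContinuousOn p S) (h1 : ContinuousOn p1 S) (h2 : ContinuousOn p2 S)
    (h4 : ContinuousOn R1 S) (h5 : ContinuousOn R2 S)
    (h7 : ContinuousOn a S) (h8 : ContinuousOn a1 S) (h14 : ContinuousOn a2 S) (h15 : ContinuousOn a3 S)
    (h9 : ContinuousOn b S) (h10 : ContinuousOn D S) (h16 : ContinuousOn D1 S) (h17 : ContinuousOn D2 S)
    (h18 : ContinuousOn D3 S) (h19 : ContinuousOn Y S) (h11 : ContinuousOn w S)
    (h12 : ContinuousOn w1 S) :
    ContinuousOn (fun z => Res1 m τ (p z) (p1 z) (p2 z) (a z) (a1 z) (a2 z) (a3 z)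
      (b z) (D z) (D1 z) (D2 z) (D3 z) (R1 z) (R2 z) (Y z) (w z) (w1 z)) S := by
  unfold Res1 Sone Stwo qtwo qthree; fun_prop

end gen

namespace Sys
variable {m τ T ξ0 : ℝ} {uS : ℝ → ℝ} {wR φ r : ℝ → ℝ → ℝ} {X : ℝ → ℝ}

lemma kU (h : Sys m τ T ξ0 uS wR φ r X) {f : ℝ → ℝ → ℝ} (hf : SmoothOn UU f) :
    ContinuousOn (fun p : ℝ × ℝ => f p.1 (p.2 + X p.1)) (Set.Icc 0 T ×ˢ Set.univ) := by
  have hX := h.X_cont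
  refine hf.contOn.comp (f := fun p : ℝ × ℝ => (p.1, p.2 + X p.1)) (by fun_prop) ?_
  intro p hp
  exact Rare.mem (by linarith [hp.1.1]) _

lemma kU0 (h : Sys m τ T ξ0 uS wR φ r X) {f : ℝ → ℝ → ℝ} (hf : SmoothOn UU f) (x : ℝ) :
    ContinuousOn (fun p : ℝ × ℝ => f p.1 x) (Set.Icc 0 T ×ˢ Set.univ) := by
  refine hf.contOn.comp (f := fun p : ℝ × ℝ => (p.1, x)) (by fun_prop) ?_
  intro p hp
  exact Rare.mem (by linarith [hp.1.1]) _

lemma kA (h : Sys m τ T ξ0 uS wR φ r X) {f : ℝ → ℝ} (hf : Continuous f) :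
    Continuous (fun p : ℝ × ℝ => f (p.2 + X p.1)) := by
  have hX := h.X_cont
  fun_prop

lemma cth (h : Sys m τ T ξ0 uS wR φ r X) : ContinuousOn (fun p : ℝ × ℝ => th m p.1) (Set.Icc 0 T ×ˢ Set.univ) := by
  intro p hp
  have : ContinuousAt (th m) p.1 := (th_der h.sh.hm (by linarith [hp.1.1])).continuousAt
  exact (this.comp continuousAt_fst).continuousWithinAt

lemma cY (h : Sys m τ T ξ0 uS wR φ r X) : ContinuousOn (fun p : ℝ × ℝ => deriv X p.1) (Set.Icc 0 T ×ˢ Set.univ) :=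
  h.Y_cont.comp continuousOn_fst (fun _ hp => hp.1)

lemma a_c (h : Sys m τ T ξ0 uS wR φ r X) : Continuous uS ∧ Continuous (deriv uS) ∧ Continuous (deriv (deriv uS)) ∧
    Continuous (deriv (deriv (deriv uS))) :=
  ⟨h.uS_cont, continuous_iff_continuousAt.2 fun x => (h.sh.d2 x).continuousAt,
   continuous_iff_continuousAt.2 fun x => (h.sh.d3 x).continuousAt, h.sh.smooth3.continuous⟩

lemma w_c (h : Sys m τ T ξ0 uS wR φ r X) : Continuous (fun x => W m (uS x)) := (W_cont h.sh.hm).comp h.uS_cont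
lemma w1_c (h : Sys m τ T ξ0 uS wR φ r X) : Continuous (fun x => Wd m (uS x) * deriv uS x) :=
  ((Wd_cont h.sh.hm).comp h.uS_cont).mul h.a_c.2.1

lemma sf3 (h : Sys m τ T ξ0 uS wR φ r X) : SmoothOn Set.univ (dx (dx (dx φ))) := h.sf2.dx isOpen_univ
lemma sr3 (h : Sys m τ T ξ0 uS wR φ r X) : SmoothOn Set.univ (dx (dx (dx r))) := h.sr2.dx isOpen_univ
lemma sD3 (h : Sys m τ T ξ0 uS wR φ r X) : SmoothOn UU (dx (dx (dx (dx (tuR m wR))))) := h.sD2.dx UU_open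

lemma Flx_c (h : Sys m τ T ξ0 uS wR φ r X) : ContinuousOn (fun p : ℝ × ℝ => Flx m τ ξ0 uS wR φ r X p.1 p.2) (Set.Icc 0 T ×ˢ Set.univ) := by
  have hs : ContinuousOn (fun p : ℝ × ℝ => p.1) (Set.Icc 0 T ×ˢ Set.univ) := continuousOn_fst
  have hB : ContinuousOn (fun p : ℝ × ℝ => tuR m wR p.1 ξ0 - m) (Set.Icc 0 T ×ˢ Set.univ) :=
    (h.kU0 h.ra.smooth ξ0).sub continuousOn_const
  have hR1 := (cst h.sr1).continuousOn.add (h.kU h.sD1)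
  have hR2 := (cst h.sr2).continuousOn.add (h.kU h.sD2)
  have hR3 := (cst h.sr3).continuousOn.add (h.kU h.sD3)
  obtain ⟨a0, a1, a2, a3⟩ := h.a_c
  exact (((fl1x_c (cst h.sf).continuousOn (cst h.sf1).continuousOn (cst h.sf2).continuousOn
    (cst h.sf3).continuousOn hR1 hR2 hR3 (h.kA a0).continuousOn (h.kA a1).continuousOn
    (h.kU h.ra.smooth) (h.kU h.sD) (h.kA h.w_c).continuousOn (h.kA h.w1_c).continuousOn).add
    (fl2x_c (cst h.sf).continuousOn (cst h.sf1).continuousOn (h.kA a0).continuousOn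
      (h.kA a1).continuousOn (h.kU h.ra.smooth) (h.kU h.sD) hB)).add
    (fl3_c hB h.cth h.cY (h.kA a2).continuousOn)).add
    (fl4x_c h.cY (h.kU h.ra.smooth) (h.kU h.sD) (h.kU h.sD1) hs)

lemma Rs_c (h : Sys m τ T ξ0 uS wR φ r X) : ContinuousOn (fun p : ℝ × ℝ => Rs m τ ξ0 uS wR φ r X p.1 p.2) (Set.Icc 0 T ×ˢ Set.univ) := by
  have hs : ContinuousOn (fun p : ℝ × ℝ => p.1) (Set.Icc 0 T ×ˢ Set.univ) := continuousOn_fst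
  have hB : ContinuousOn (fun p : ℝ × ℝ => tuR m wR p.1 ξ0 - m) (Set.Icc 0 T ×ˢ Set.univ) :=
    (h.kU0 h.ra.smooth ξ0).sub continuousOn_const
  have hBt := h.kU0 (h.ra.smooth.dt UU_open) ξ0
  have hR1 := (cst h.sr1).continuousOn.add (h.kU h.sD1)
  have hR2 := (cst h.sr2).continuousOn.add (h.kU h.sD2)
  have hb := h.kU h.ra.smooth
  have hD := h.kU h.sD
  have hk : ContinuousOn (fun p : ℝ × ℝ => Rare.kap m wR p.1 (p.2 + X p.1)) (Set.Icc 0 T ×ˢ Set.univ) := by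
    unfold Rare.kap
    fun_prop
  have hth := h.cth
  obtain ⟨a0, a1, a2, a3⟩ := h.a_c
  have k1 := (h.kA a1).continuousOn (s := Set.Icc 0 T ×ˢ Set.univ)
  refine (((Res1_c (cst h.sf).continuousOn (cst h.sf1).continuousOn (cst h.sf2).continuousOn
    hR1 hR2 (h.kA a0).continuousOn k1 (h.kA a2).continuousOn (h.kA a3).continuousOn
    hb hD (h.kU h.sD1) (h.kU h.sD2) (h.kU h.sD3) h.cY
    (h.kA h.w_c).continuousOn (h.kA h.w1_c).continuousOn).add
    (Res2_c (cst h.sf).continuousOn (h.kA a0).continuousOn k1 hb hD hB hBt hR1 h.cY)).add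
    ?_).sub ?_
  · fun_prop
  · fun_prop

lemma En_c (h : Sys m τ T ξ0 uS wR φ r X) {t : ℝ} (ht : t ∈ Set.Icc 0 T) : Continuous (En m τ ξ0 uS wR φ r X t) := by
  have hX := h.X_cont
  have h1 := csx h.sf t
  have h2 := csx h.sf1 t
  have h3 := csx h.sf2 t
  have h4 := csx h.sr1 t
  have h5 := csx h.sr2 t
  have h6 := h.cD ht h.ra.smooth
  have h7 := h.cD ht h.sD
  have h8 := h.cD ht h.sD1
  have h9 := h.cD ht h.sD2
  have hw := h.w_c
  have hw' : Continuous fun ξ => (W m (uS (ξ + X t))) := hw.comp (continuous_add_const (X t))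
  obtain ⟨a0, a1, a2, a3⟩ := h.a_c
  unfold En en1 en2 en3 en4 gps
  fun_prop
end Sys
end

noncomputable section

lemma mono_b {m a : ℝ} (hm : |m| ≤ 1) (ha : |a| ≤ 1) (i j : ℕ) : |m ^ i * a ^ j| ≤ 1 := by
  rw [abs_mul, abs_pow, abs_pow]
  exact mul_le_one₀ (pow_le_one₀ (abs_nonneg _) hm) (by positivity) (pow_le_one₀ (abs_nonneg _) ha)

lemma kk_b {m a : ℝ} (hm : |m| ≤ 1) (ha : |a| ≤ 1) (hh : 0 ≤ (a + 2 * m) * (m - a)) :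
    |kk m a| ≤ 3 * ((a + 2 * m) * (m - a)) := by
  have e : kk m a = -(1 / 7 * (m ^ 0 * a ^ 5) + 4 / 21 * (m ^ 1 * a ^ 4) - 53 / 105 * (m ^ 2 * a ^ 3)
      - 4 / 35 * (m ^ 3 * a ^ 2) + 46 / 105 * (m ^ 4 * a ^ 1) - 2 / 3 * (m ^ 5 * a ^ 0))
        * ((a + 2 * m) * (m - a)) := by
    unfold kk; ring
  rw [e, abs_mul, abs_of_nonneg hh]
  refine mul_le_mul_of_nonneg_right ?_ hh
  have h0 := abs_le.1 (mono_b hm ha 0 5)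
  have h1 := abs_le.1 (mono_b hm ha 1 4)
  have h2 := abs_le.1 (mono_b hm ha 2 3)
  have h3 := abs_le.1 (mono_b hm ha 3 2)
  have h4 := abs_le.1 (mono_b hm ha 4 1)
  have h5 := abs_le.1 (mono_b hm ha 5 0)
  rw [abs_le]
  constructor
  · linarith only [h0.1, h0.2, h1.1, h1.2, h2.1, h2.2, h3.1, h3.2, h4.1, h4.2, h5.1, h5.2]
  · linarith only [h0.1, h0.2, h1.1, h1.2, h2.1, h2.2, h3.1, h3.2, h4.1, h4.2, h5.1, h5.2]

namespace Pt
variable {m τ N0 N1 φ φ1 a a1 a2 a3 b D D1 D2 D3 κ B Bt θ Y ω ω1 l : ℝ}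

lemma Dsq (h : Pt m τ N0 N1 φ φ1 a a1 a2 a3 b D D1 D2 D3 κ B Bt θ Y ω ω1 l) :
    D1 ^ 2 + D2 ^ 2 ≤ 2250 * m ^ 2 * D := by
  have hD := h.Dp; have hk := h.kp; have hkl := h.kl; have hm := h.m0
  have h1 : D1 ^ 2 ≤ (3 * (D * κ)) ^ 2 := by rw [← sq_abs]; gcongr; exact h.D1b
  have h2 : D2 ^ 2 ≤ (21 * (D * κ)) ^ 2 := by rw [← sq_abs]; gcongr; exact h.D2b
  have h3 : D * κ ≤ D := by nlinarith
  have h4 : (D * κ) ^ 2 ≤ D ^ 2 := by gcongr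
  have h5 : D ≤ 5 * m ^ 2 := h.Dl.trans (by nlinarith [sq_nonneg m])
  have h6 : D ^ 2 ≤ 5 * m ^ 2 * D := by rw [sq]; exact mul_le_mul_of_nonneg_right h5 hD.le
  linarith only [h1, h2, h4, h6]

lemma en_lo (h : Pt m τ N0 N1 φ φ1 a a1 a2 a3 b D D1 D2 D3 κ B Bt θ Y ω ω1 l) {s : ℝ}
    (hk : κ = 1 - 6 * (1 + s) * b * D) (φ2 r1 r2 : ℝ) :
    1 / 2 * (ω * (φ1 ^ 2 + φ2 ^ 2)) + τ * (1 / 4 * (ω * (r1 ^ 2 + r2 ^ 2))) - m * D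
      ≤ en1 τ φ1 φ2 (r1 + D1) (r2 + D2) ω + en2 m φ a B + en3 m B θ a1 + en4 b D s := by
  have hm := h.m0; have hD := h.Dp; have hB := h.Bp; have ha := h.a1p; have ht := h.t0
  have hth := h.thp; have hκ := h.kp
  have hb : 0 < b := hm.trans h.blo
  have hω : 0 < ω := lt_of_lt_of_le (by positivity) h.wlo
  have e4 : 0 ≤ en4 b D s := by
    unfold en4; rw [← hk]; positivity
  have e2 : |φ * gps m a| ≤ 1 * (4 * (m ^ 2 * a1)) := bM (h.p0.trans h.n0) h.gb.1
  have e2' : -(m ^ 2 * B * (4 * (m ^ 2 * a1))) ≤ en2 m φ a B := by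
    unfold en2
    have := mul_le_mul_of_nonneg_left (neg_le_of_abs_le e2) (by positivity : 0 ≤ m ^ 2 * B)
    linarith
  have e3 : m ^ 2 * B * (4 * (m ^ 2 * a1)) ≤ en3 m B θ a1 := by
    unfold en3
    have h1 : 0 < m ^ 4 * B * a1 := by positivity
    have h2 : 0 < m * θ * a1 := by positivity
    linarith
  have e1 : 1 / 2 * (ω * (φ1 ^ 2 + φ2 ^ 2)) + τ * (1 / 4 * (ω * (r1 ^ 2 + r2 ^ 2)))
      - 1 / 2 * (τ * ω * (D1 ^ 2 + D2 ^ 2)) ≤ en1 τ φ1 φ2 (r1 + D1) (r2 + D2) ω := by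
    unfold en1
    have : 0 ≤ τ * ω * ((r1 + 2 * D1) ^ 2 + (r2 + 2 * D2) ^ 2) := by positivity
    linarith
  have e5 : 1 / 2 * (τ * ω * (D1 ^ 2 + D2 ^ 2)) ≤ m * D := by
    have h1 := h.Dsq
    have h2 : τ * ω ≤ 1 * (15 / 2 * m ^ 2) := mul_le_mul h.t1 h.whi hω.le (by norm_num)
    have h3 := mul_le_mul h2 h1 (by positivity) (by positivity)
    have h4 : m ^ 3 ≤ 1 / 10 ^ 5 := by
      have := pow_le_pow_left₀ hm.le h.ms 3
      exact this.trans (by norm_num)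
    have h5 : m ^ 3 * (m * D) ≤ 1 / 10 ^ 5 * (m * D) := mul_le_mul_of_nonneg_right h4 (by positivity)
    have h6 : 0 < m * D := by positivity
    linarith
  linarith

lemma en_hi (h : Pt m τ N0 N1 φ φ1 a a1 a2 a3 b D D1 D2 D3 κ B Bt θ Y ω ω1 l) {s : ℝ}
    (hk : κ = 1 - 6 * (1 + s) * b * D) (hθ : θ ≤ 30 * m ^ 3) (φ2 r1 r2 : ℝ) :
    en1 τ φ1 φ2 (r1 + D1) (r2 + D2) ω + en2 m φ a B + en3 m B θ a1 + en4 b D s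
      ≤ 15 / 2 * m ^ 2 * (φ1 ^ 2 + φ2 ^ 2 + r1 ^ 2 + r2 ^ 2) + 7000 * m * D + m ^ 2 * a1 := by
  have hm := h.m0; have hD := h.Dp; have hB := h.Bp; have ha := h.a1p; have ht := h.t0
  have hth := h.thp; have hκ := h.kp
  have hb : 0 < b := hm.trans h.blo
  have hω : 0 < ω := lt_of_lt_of_le (by positivity) h.wlo
  have m2 : m ^ 2 ≤ 1 / 10 ^ 8 * m := by rw [sq]; exact mul_le_mul_of_nonneg_right h.ms hm.le
  have e4 : en4 b D s ≤ 6001 * (m * D) := by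
    unfold en4; rw [← hk]
    have h1 : b ≤ 1.0001 * m := by linarith [h.bhi]
    have h2 : b * D * κ ≤ b * D := mul_le_of_le_one_right (by positivity) h.kl
    have h3 := mul_le_mul_of_nonneg_right h1 hD.le
    have h9 : 0 < m * D := by positivity
    linarith
  have e2 : |φ * gps m a| ≤ 1 * (4 * (m ^ 2 * a1)) := bM (h.p0.trans h.n0) h.gb.1
  have e2' : en2 m φ a B ≤ m ^ 2 * B * (4 * (m ^ 2 * a1)) := by
    unfold en2
    have := mul_le_mul_of_nonneg_left (le_of_abs_le e2) (by positivity : 0 ≤ m ^ 2 * B)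
    linarith
  have e3 : m ^ 2 * B * (4 * (m ^ 2 * a1)) + en3 m B θ a1 ≤ m ^ 2 * a1 := by
    unfold en3
    have h1 : m ^ 4 * B ≤ m ^ 4 * 1 := by
      refine mul_le_mul_of_nonneg_left ?_ (by positivity)
      linarith [h.Bl, h.ms]
    have h2 : m * θ ≤ m * (30 * m ^ 3) := mul_le_mul_of_nonneg_left hθ hm.le
    have h3 : m ^ 4 ≤ 1 / 10 ^ 16 * m ^ 2 := by
      have : m ^ 2 ≤ 1 / 10 ^ 16 := (pow_le_pow_left₀ hm.le h.ms 2).trans (by norm_num)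
      calc m ^ 4 = m ^ 2 * m ^ 2 := by ring
        _ ≤ _ := mul_le_mul_of_nonneg_right this (by positivity)
    have h4 : 11 * (m ^ 4 * B) + 1000 * (m * θ) ≤ m ^ 2 := by linarith [sq_nonneg m]
    have := mul_le_mul_of_nonneg_right h4 ha.le
    linarith
  have e1 : en1 τ φ1 φ2 (r1 + D1) (r2 + D2) ω
      ≤ 15 / 4 * m ^ 2 * (φ1 ^ 2 + φ2 ^ 2 + 2 * r1 ^ 2 + 2 * r2 ^ 2 + 2 * (D1 ^ 2 + D2 ^ 2)) := by
    unfold en1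
    have h1 : (r1 + D1) ^ 2 + (r2 + D2) ^ 2 ≤ 2 * r1 ^ 2 + 2 * r2 ^ 2 + 2 * (D1 ^ 2 + D2 ^ 2) := by
      linarith [sq_nonneg (r1 - D1), sq_nonneg (r2 - D2)]
    have h2 : τ * ((r1 + D1) ^ 2 + (r2 + D2) ^ 2) ≤ 1 * ((r1 + D1) ^ 2 + (r2 + D2) ^ 2) :=
      mul_le_mul_of_nonneg_right h.t1 (by positivity)
    have h3 : φ1 ^ 2 + φ2 ^ 2 + τ * (r1 + D1) ^ 2 + τ * (r2 + D2) ^ 2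
      ≤ φ1 ^ 2 + φ2 ^ 2 + 2 * r1 ^ 2 + 2 * r2 ^ 2 + 2 * (D1 ^ 2 + D2 ^ 2) := by linarith
    have := mul_le_mul h.whi h3 (by positivity) (by positivity)
    linarith
  have e5 : 15 / 4 * m ^ 2 * (2 * (D1 ^ 2 + D2 ^ 2)) ≤ m * D := by
    have h1 := mul_le_mul_of_nonneg_left h.Dsq (by positivity : 0 ≤ m ^ 2)
    have h4 : m ^ 3 ≤ 1 / 10 ^ 5 := by
      have := pow_le_pow_left₀ hm.le h.ms 3
      exact this.trans (by norm_num)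
    have h5 : m ^ 3 * (m * D) ≤ 1 / 10 ^ 5 * (m * D) := mul_le_mul_of_nonneg_right h4 (by positivity)
    have h6 : 0 < m * D := by positivity
    linarith
  have h6 : 0 < m * D := by positivity
  have h7 : 0 ≤ m ^ 2 * φ1 ^ 2 := by positivity
  have h8 : 0 ≤ m ^ 2 * φ2 ^ 2 := by positivity
  linarith

lemma fl_b (h : Pt m τ N0 N1 φ φ1 a a1 a2 a3 b D D1 D2 D3 κ B Bt θ Y ω ω1 l) {s : ℝ}
    (hk : κ = 1 - 6 * (1 + s) * b * D) (hθ : θ ≤ 30 * m ^ 3) (φ2 r1 r2 : ℝ) :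
    |fl1 m τ φ φ1 φ2 (r1 + D1) (r2 + D2) a b ω + fl2 m B φ a b + fl3 m B θ Y a1 + fl4 m Y b D s|
      ≤ 100 * (φ1 ^ 2 + φ2 ^ 2 + r1 ^ 2 + r2 ^ 2 + a1 + D + (a + 2 * m) * (m - a)) := by
  have hm := h.m0; have hD := h.Dp; have hB := h.Bp; have ha := h.a1p; have ht := h.t0
  have hth := h.thp; have hκ := h.kp; have ms := h.ms
  have hb : 0 < b := hm.trans h.blo
  have hω : 0 < ω := lt_of_lt_of_le (by positivity) h.wlo
  have m2 : m ^ 2 ≤ 1 / 10 ^ 8 * m := by rw [sq]; exact mul_le_mul_of_nonneg_right h.ms hm.le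
  have m2' : m ^ 2 ≤ 1 / 10 ^ 16 := by linarith
  have hb1 : b ≤ 2 / 10 ^ 8 := by linarith [h.bhi]
  have hω1 : ω ≤ 1 := by linarith [h.whi]
  have hB1 : B ≤ 1 / 10 ^ 8 := by linarith [h.Bl]
  have hp : |φ| ≤ 1 := h.p0.trans h.n0
  have ha' : |a| ≤ 2 / 10 ^ 8 := by rw [abs_le]; constructor <;> linarith [h.alo, h.ahi]
  have hm' : |m| ≤ 1 / 10 ^ 8 := by rw [abs_of_pos hm]; exact ms
  have hb' : |b| ≤ 2 / 10 ^ 8 := by rw [abs_of_pos hb]; exact hb1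
  have hB' : |B| ≤ 1 / 10 ^ 8 := by rw [abs_of_pos hB]; exact hB1
  have hu : |φ + a + b - m| ≤ 2 := (bS (bA (bA hp ha') hb') hm').trans (by norm_num)
  have hu2 : (φ + a + b - m) ^ 2 ≤ 4 := by
    rw [← sq_abs]; nlinarith [abs_nonneg (φ + a + b - m)]
  have hDs : D1 ^ 2 + D2 ^ 2 ≤ D := by
    have h1 := h.Dsq
    have h2 := mul_le_mul_of_nonneg_right m2' hD.le
    linarith
  -- first
  have e1 : |fl1 m τ φ φ1 φ2 (r1 + D1) (r2 + D2) a b ω|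
      ≤ 10 * (φ1 ^ 2 + φ2 ^ 2 + (r1 + D1) ^ 2 + (r2 + D2) ^ 2) := by
    unfold fl1
    generalize r1 + D1 = R1
    generalize r2 + D2 = R2
    generalize φ + a + b - m = u at *
    have g0 : 0 ≤ φ1 ^ 2 + φ2 ^ 2 := by positivity
    have g1 : τ * R1 ^ 2 ≤ 1 * R1 ^ 2 := mul_le_mul_of_nonneg_right h.t1 (by positivity)
    have g2 : τ * R2 ^ 2 ≤ 1 * R2 ^ 2 := mul_le_mul_of_nonneg_right h.t1 (by positivity)
    have g3 : m ^ 2 * (φ1 ^ 2 + φ2 ^ 2 + τ * R1 ^ 2 + τ * R2 ^ 2) ≤ 1 * (φ1 ^ 2 + φ2 ^ 2 + τ * R1 ^ 2 + τ * R2 ^ 2) :=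
      mul_le_mul_of_nonneg_right (by linarith) (by positivity)
    have g3' : 0 ≤ m ^ 2 * (φ1 ^ 2 + φ2 ^ 2 + τ * R1 ^ 2 + τ * R2 ^ 2) := by positivity
    have g4 : u ^ 2 * (φ1 ^ 2 + φ2 ^ 2) ≤ 4 * (φ1 ^ 2 + φ2 ^ 2) := mul_le_mul_of_nonneg_right hu2 g0
    have g4' : 0 ≤ u ^ 2 * (φ1 ^ 2 + φ2 ^ 2) := by positivity
    have g5 := sq_nonneg (φ1 - R1)
    have g6 := sq_nonneg (φ1 + R1)
    have g7 := sq_nonneg (φ2 - R2)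
    have g8 := sq_nonneg (φ2 + R2)
    have g9 : |3 / 2 * m ^ 2 * (φ1 ^ 2 + φ2 ^ 2 + τ * R1 ^ 2 + τ * R2 ^ 2) + φ1 * R1 + φ2 * R2
        - 3 / 2 * u ^ 2 * (φ1 ^ 2 + φ2 ^ 2)| ≤ 10 * (φ1 ^ 2 + φ2 ^ 2 + R1 ^ 2 + R2 ^ 2) := by
      have := sq_nonneg R1
      have := sq_nonneg R2
      rw [abs_le]; constructor <;> linarith
    have hw : |ω| ≤ 1 := by rw [abs_of_pos hω]; exact hω1
    exact (bM hw g9).trans (by linarith)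
  have e1' : (r1 + D1) ^ 2 + (r2 + D2) ^ 2 ≤ 2 * (r1 ^ 2 + r2 ^ 2) + 2 * D := by
    linarith [sq_nonneg (r1 - D1), sq_nonneg (r2 - D2)]
  -- second
  obtain ⟨gb1, -, -, gb4⟩ := h.gb
  have gb : |gps m a| ≤ a1 := by
    have := mul_le_mul_of_nonneg_right m2' ha.le
    linarith
  have kb := kk_b (hm'.trans (by norm_num)) (ha'.trans (by norm_num)) gb4.le
  have e2 : |fl2 m B φ a b| ≤ 20 * a1 + (a + 2 * m) * (m - a) := by
    unfold fl2
    have pw : ∀ {x c : ℝ} (n : ℕ), |x| ≤ c → |x ^ n| ≤ c ^ n := by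
      intro x c n hx
      rw [abs_pow]; exact pow_le_pow_left₀ (abs_nonneg _) hx n
    have c1 : |3 * m ^ 2 * φ - ((φ + a + b - m) ^ 3 - a ^ 3 - b ^ 3 + m ^ 3)
      + 3 * B * (a ^ 2 - m ^ 2) + 3 * B ^ 2 * (a - m)| ≤ 20 := by
      have c3 : |(3 : ℝ)| ≤ 3 := by norm_num
      refine (bA (bA (bS (bM (bM c3 (pw 2 hm')) hp) (bA (bS (bS (pw 3 hu) (pw 3 ha')) (pw 3 hb')) (pw 3 hm')))
        (bM (bM c3 hB') (bS (pw 2 ha') (pw 2 hm')))) (bM (bM c3 (pw 2 hB')) (bS ha' hm'))).trans ?_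
      norm_num
    have c2 : |gps m a * (3 * m ^ 2 * φ - ((φ + a + b - m) ^ 3 - a ^ 3 - b ^ 3 + m ^ 3)
      + 3 * B * (a ^ 2 - m ^ 2) + 3 * B ^ 2 * (a - m)) - 6 * B * kk m a|
        ≤ a1 * 20 + (6 * (1 / 10 ^ 8)) * (3 * ((a + 2 * m) * (m - a))) := by
      refine bS (bM gb c1) (bM (bM (by norm_num) hB') kb)
    have c4 : |m ^ 2 * B| ≤ 1 := by
      refine (bM (pw 2 hm') hB').trans (by norm_num)
    refine (bM c4 c2).trans ?_
    linarith
  have e3 : |fl3 m B θ Y a1| ≤ a1 := by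
    unfold fl3
    rw [abs_mul, abs_of_pos ha]
    have hm3 : m ^ 3 ≤ 1 := (pow_le_pow_left₀ hm.le h.ms 3).trans (by norm_num)
    have hm4 : m ^ 4 ≤ 1 / 10 ^ 8 := (pow_le_pow_left₀ hm.le h.ms 4).trans (by norm_num)
    have d1 : |7 * m ^ 4 * B + 1000 * m * θ| ≤ 1 := by
      have d2 : 0 < 7 * m ^ 4 * B + 1000 * m * θ := by positivity
      rw [abs_of_pos d2]
      have d3 : m ^ 4 * B ≤ 1 / 10 ^ 8 * (1 / 10 ^ 8) := mul_le_mul hm4 hB1 hB.le (by norm_num)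
      have d4 : m * θ ≤ m * (30 * m ^ 3) := mul_le_mul_of_nonneg_left hθ hm.le
      linarith
    have d5 : |Y| ≤ 1 := by linarith [h.Yb]
    have := bM d1 d5
    nlinarith
  have e4 : |fl4 m Y b D s| ≤ D := by
    unfold fl4
    rw [← hk]
    have d1 : |3 * b ^ 2 - 3 * m ^ 2 - Y| ≤ 1 := by
      have d0 : b ^ 2 ≤ 1 / 10 ^ 8 := (pow_le_pow_left₀ hb.le hb1 2).trans (by norm_num)
      have d9 := sq_nonneg b
      have d8 := sq_nonneg m
      have := abs_le.1 h.Yb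
      rw [abs_le]; constructor <;> linarith
    have d2 : |6 * b * D * κ| ≤ 6 * (2 / 10 ^ 8) * D := by
      rw [abs_of_pos (by positivity)]
      have d3 : b * D * κ ≤ b * D := mul_le_of_le_one_right (by positivity) h.kl
      have d4 := mul_le_mul_of_nonneg_right hb1 hD.le
      linarith
    rw [abs_neg, abs_mul]
    have := bM d1 d2
    have d5 : |(1000 : ℝ)| = 1000 := by norm_num
    rw [d5]
    linarith
  have key := bA (bA (bA e1 e2) e3) e4
  have := sq_nonneg φ1
  have := sq_nonneg φ2
  have := sq_nonneg r1
  have := sq_nonneg r2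
  linarith

lemma h_b (h : Pt m τ N0 N1 φ φ1 a a1 a2 a3 b D D1 D2 D3 κ B Bt θ Y ω ω1 l) {n : ℕ} (hn : 1 ≤ n) :
    (a + 2 * m) * (m - a) ≤ 1 / √(n : ℝ) + √(n : ℝ) * a1 := by
  have hm := h.m0
  obtain ⟨-, -, -, g4⟩ := h.gb
  have hn' : (0 : ℝ) < n := by exact_mod_cast hn
  have hq : 0 < √(n : ℝ) := Real.sqrt_pos.2 hn'
  have h1 : ((a + 2 * m) * (m - a)) ^ 2 ≤ a1 := by
    have e : ((a + 2 * m) * (m - a)) ^ 2 = (a + 2 * m) * ((a + 2 * m) * (m - a) ^ 2) := by ring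
    rw [e]
    have h2 : a + 2 * m ≤ 1 / 2 := by linarith [h.ahi, h.ms]
    have h3 : 0 ≤ a + 2 * m := by linarith [h.alo]
    have := mul_le_mul h2 h.cmp2 (by positivity) (by norm_num)
    linarith [h.a1p]
  have h2 := mul_le_mul_of_nonneg_left h1 hq.le
  generalize (a + 2 * m) * (m - a) = y at *
  have h3 : 0 ≤ 1 / √(n : ℝ) * (√(n : ℝ) * y - 1) ^ 2 := by positivity
  have h4 : 1 / √(n : ℝ) * (√(n : ℝ) * y - 1) ^ 2 = √(n : ℝ) * y ^ 2 - 2 * y + 1 / √(n : ℝ) := by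
    field_simp
    ring
  linarith

lemma g0 (h : Pt m τ N0 N1 φ φ1 a a1 a2 a3 b D D1 D2 D3 κ B Bt θ Y ω ω1 l) (φ2 : ℝ) :
    0 ≤ Gq m N0 N1 φ (φ1 ^ 2 + φ2 ^ 2) a1 D Y := by
  have hm := h.m0; have hD := h.Dp; have ha := h.a1p
  have := h.N0n; have := h.N1n
  unfold Gq; positivity

lemma res_q (h : Pt m τ N0 N1 φ φ1 a a1 a2 a3 b D D1 D2 D3 κ B Bt θ Y ω ω1 l) (φ2 r1 r2 : ℝ) :
    Res m τ φ φ1 φ2 a a1 a2 a3 b D D1 D2 D3 κ (r1 + D1) (r2 + D2) Y ω ω1 B Bt θ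
      ≤ -(1 / 4 * (ω * (r1 ^ 2 + r2 ^ 2)))
        + 1000000000 * Gq m N0 N1 φ (φ1 ^ 2 + φ2 ^ 2) a1 D Y := by
  have hm := h.m0
  have h1 := h.res_b φ2 (r1 + D1) (r2 + D2)
  have hω : 0 < ω := lt_of_lt_of_le (by positivity) h.wlo
  have : 0 ≤ ω * ((r1 + 2 * D1) ^ 2 + (r2 + 2 * D2) ^ 2) := by positivity
  have : 0 ≤ ω * (D1 ^ 2 + D2 ^ 2) := by positivity
  linarith
end Pt
end

noncomputable section

lemma dom {f g : ℝ → ℝ} (hf : Continuous f) (hg : Integrable g) (h0 : ∀ x, 0 ≤ f x)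
    (h : ∀ x, f x ≤ g x) : Integrable f :=
  hg.mono' hf.aestronglyMeasurable (Filter.Eventually.of_forall fun x => by
    rw [Real.norm_eq_abs, abs_of_nonneg (h0 x)]; exact h x)

namespace Sys
variable {m τ T ξ0 : ℝ} {uS : ℝ → ℝ} {wR φ r : ℝ → ℝ → ℝ} {X : ℝ → ℝ}

/-- Weighted energy. -/
def EP (m : ℝ) (uS : ℝ → ℝ) (φ : ℝ → ℝ → ℝ) (X : ℝ → ℝ) (t : ℝ) : ℝ :=
  ∫ ξ, (W m (uS (ξ + X t))) * ((dx φ t ξ) ^ 2 + (dx (dx φ) t ξ) ^ 2)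
def ID (m : ℝ) (uS : ℝ → ℝ) (wR φ : ℝ → ℝ → ℝ) (X : ℝ → ℝ) (t : ℝ) : ℝ :=
  ∫ ξ, (φ t ξ) ^ 2 * (W m (uS (ξ + X t))) * (dx (tuR m wR) t (ξ + X t))
def IA (uS : ℝ → ℝ) (φ : ℝ → ℝ → ℝ) (X : ℝ → ℝ) (t : ℝ) : ℝ :=
  ∫ ξ, (φ t ξ) ^ 2 * (deriv uS (ξ + X t))

lemma th_le (h : Sys m τ T ξ0 uS wR φ r X) {t : ℝ} (ht : t ∈ Set.Icc 0 T) : (th m t) ≤ 30 * m ^ 3 := by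
  have h1 := Dl_le h.ra.hm h.ra.hs
  have h2 := Dl_pos h.ra.hm
  refine le_trans ?_ h1
  unfold th
  refine div_le_self h2.le ?_
  have : 0 ≤ (1 + t) * Dl m := mul_nonneg (by linarith [ht.1]) h2.le
  linarith

lemma sa (h : Sys m τ T ξ0 uS wR φ r X) (t : ℝ) : Integrable (fun ξ => (deriv uS (ξ + X t))) ∧ ∫ ξ, (deriv uS (ξ + X t)) ≤ 3 * m := by
  refine ⟨h.ia.1.comp_add_right (X t), ?_⟩
  rw [integral_add_right_eq_self (fun y => deriv uS y) (X t)]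
  exact h.ia.2

lemma sDi (h : Sys m τ T ξ0 uS wR φ r X) {t : ℝ} (ht : t ∈ Set.Icc 0 T) : Integrable (fun ξ => (dx (tuR m wR) t (ξ + X t))) ∧ ∫ ξ, (dx (tuR m wR) t (ξ + X t)) ≤ 9 * m ^ 2 := by
  refine ⟨(h.iD ht).1.comp_add_right (X t), ?_⟩
  rw [integral_add_right_eq_self (fun y => dx (tuR m wR) t y) (X t)]
  exact (h.iD ht).2

lemma cw (h : Sys m τ T ξ0 uS wR φ r X) (t : ℝ) : Continuous fun ξ => (W m (uS (ξ + X t))) := h.w_c.comp (continuous_add_const (X t))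
lemma ca (h : Sys m τ T ξ0 uS wR φ r X) (t : ℝ) : Continuous fun ξ => (deriv uS (ξ + X t)) := h.a_c.2.1.comp (continuous_add_const (X t))
lemma cDD (h : Sys m τ T ξ0 uS wR φ r X) {t : ℝ} (ht : t ∈ Set.Icc 0 T) : Continuous fun ξ => (dx (tuR m wR) t (ξ + X t)) :=
  (h.cD ht h.sD).comp (continuous_add_const (X t))

lemma mpos (h : Sys m τ T ξ0 uS wR φ r X) : 0 < m := h.sh.hm

lemma m2le (h : Sys m τ T ξ0 uS wR φ r X) : m ^ 2 ≤ 1 / 10 ^ 16 :=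
  (pow_le_pow_left₀ h.mpos.le h.ms 2).trans (by norm_num)

lemma EP_i (h : Sys m τ T ξ0 uS wR φ r X) {t : ℝ} (ht : t ∈ Set.Icc 0 T) :
    Integrable (fun ξ => (W m (uS (ξ + X t))) * ((dx φ t ξ) ^ 2 + (dx (dx φ) t ξ) ^ 2)) ∧ 0 ≤ EP m uS φ X t ∧ EP m uS φ X t ≤ 1 := by
  obtain ⟨i0, i1, i2, i3, i4, i5⟩ := h.ip ht
  have hm := h.mpos
  have c1 := h.cw t
  have c2 := csx h.sf1 t
  have c3 := csx h.sf2 t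
  have hb : ∀ ξ, (W m (uS (ξ + X t))) * ((dx φ t ξ) ^ 2 + (dx (dx φ) t ξ) ^ 2) ≤ (dx φ t ξ) ^ 2 + (dx (dx φ) t ξ) ^ 2 := by
    intro ξ
    have := (h.w_b (ξ + X t)).2
    have := h.m2le
    exact mul_le_of_le_one_left (by positivity) (by linarith)
  have h0 : ∀ ξ, 0 ≤ (W m (uS (ξ + X t))) * ((dx φ t ξ) ^ 2 + (dx (dx φ) t ξ) ^ 2) := by
    intro ξ
    have := (h.w_b (ξ + X t)).1
    have : 0 ≤ (W m (uS (ξ + X t))) := le_trans (by positivity) this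
    positivity
  have hi := dom (by fun_prop) (i1.add i2) h0 hb
  refine ⟨hi, integral_nonneg h0, ?_⟩
  have e := integral_mono hi (i1.add i2) hb
  have e' : (∫ ξ, ((fun ξ => (dx φ t ξ) ^ 2) + (fun ξ => (dx (dx φ) t ξ) ^ 2)) ξ) = (∫ ξ, (dx φ t ξ) ^ 2) + ∫ ξ, (dx (dx φ) t ξ) ^ 2 :=
    integral_add i1 i2
  rw [e'] at e
  have n := (h.nrm ht).1
  have : 0 ≤ ∫ ξ, (φ t ξ) ^ 2 := integral_nonneg fun ξ => sq_nonneg _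
  unfold EP
  linarith

lemma ER_i (h : Sys m τ T ξ0 uS wR φ r X) {t : ℝ} (ht : t ∈ Set.Icc 0 T) :
    Integrable (fun ξ => (W m (uS (ξ + X t))) * ((dx r t ξ) ^ 2 + (dx (dx r) t ξ) ^ 2)) ∧ 0 ≤ EP m uS r X t ∧ EP m uS r X t ≤ 1 / τ := by
  obtain ⟨i0, i1, i2, i3, i4, i5⟩ := h.ip ht
  have hm := h.mpos
  have c1 := h.cw t
  have c2 := csx h.sr1 t
  have c3 := csx h.sr2 t
  have hb : ∀ ξ, (W m (uS (ξ + X t))) * ((dx r t ξ) ^ 2 + (dx (dx r) t ξ) ^ 2) ≤ (dx r t ξ) ^ 2 + (dx (dx r) t ξ) ^ 2 := by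
    intro ξ
    have := (h.w_b (ξ + X t)).2
    have := h.m2le
    exact mul_le_of_le_one_left (by positivity) (by linarith)
  have h0 : ∀ ξ, 0 ≤ (W m (uS (ξ + X t))) * ((dx r t ξ) ^ 2 + (dx (dx r) t ξ) ^ 2) := by
    intro ξ
    have := (h.w_b (ξ + X t)).1
    have : 0 ≤ (W m (uS (ξ + X t))) := le_trans (by positivity) this
    positivity
  have hi := dom (by fun_prop) (i4.add i5) h0 hb
  refine ⟨hi, integral_nonneg h0, ?_⟩
  have e := integral_mono hi (i4.add i5) hb
  have e' : (∫ ξ, ((fun ξ => (dx r t ξ) ^ 2) + (fun ξ => (dx (dx r) t ξ) ^ 2)) ξ) = (∫ ξ, (dx r t ξ) ^ 2) + ∫ ξ, (dx (dx r) t ξ) ^ 2 :=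
    integral_add i4 i5
  rw [e'] at e
  have n := (h.nrm ht).2
  have h3 : 0 ≤ ∫ ξ, (r t ξ) ^ 2 := integral_nonneg fun ξ => sq_nonneg _
  have ht := h.sh.hτ
  have h4 := mul_nonneg ht.le h3
  have h5 : (∫ ξ, (dx r t ξ) ^ 2) + ∫ ξ, (dx (dx r) t ξ) ^ 2 ≤ 1 / τ := by
    rw [le_div_iff₀ ht]; linarith
  unfold EP
  linarith

lemma psq (h : Sys m τ T ξ0 uS wR φ r X) {t : ℝ} (ht : t ∈ Set.Icc 0 T) (ξ : ℝ) : (φ t ξ) ^ 2 ≤ 1 := by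
  have := (h.p_le ht ξ).1
  rw [← sq_abs]; nlinarith [abs_nonneg (φ t ξ)]

lemma Dp (h : Sys m τ T ξ0 uS wR φ r X) {t : ℝ} (ht : t ∈ Set.Icc 0 T) (ξ : ℝ) : 0 < (dx (tuR m wR) t (ξ + X t)) := (h.pt ht ξ).Dp

lemma ID_i (h : Sys m τ T ξ0 uS wR φ r X) {t : ℝ} (ht : t ∈ Set.Icc 0 T) :
    Integrable (fun ξ => (φ t ξ) ^ 2 * (W m (uS (ξ + X t))) * (dx (tuR m wR) t (ξ + X t))) ∧ 0 ≤ ID m uS wR φ X t ∧ ID m uS wR φ X t ≤ 1 := by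
  have hm := h.mpos
  have c1 := h.cw t
  have c2 := csx h.sf t
  have c3 := h.cDD ht
  have hw0 : ∀ ξ, 0 ≤ (W m (uS (ξ + X t))) := fun ξ => le_trans (by positivity) (h.w_b (ξ + X t)).1
  have hb : ∀ ξ, (φ t ξ) ^ 2 * (W m (uS (ξ + X t))) * (dx (tuR m wR) t (ξ + X t)) ≤ (dx (tuR m wR) t (ξ + X t)) := by
    intro ξ
    have := (h.w_b (ξ + X t)).2
    have := h.m2le
    refine mul_le_of_le_one_left (h.Dp ht ξ).le ?_
    exact mul_le_one₀ (h.psq ht ξ) (hw0 ξ) (by linarith)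
  have h0 : ∀ ξ, 0 ≤ (φ t ξ) ^ 2 * (W m (uS (ξ + X t))) * (dx (tuR m wR) t (ξ + X t)) := by
    intro ξ
    have := hw0 ξ
    have := h.Dp ht ξ
    positivity
  have hi := dom (by fun_prop) (h.sDi ht).1 h0 hb
  refine ⟨hi, integral_nonneg h0, ?_⟩
  have e := integral_mono hi (h.sDi ht).1 hb
  have := (h.sDi ht).2
  have := h.m2le
  unfold ID
  linarith

lemma IA_i (h : Sys m τ T ξ0 uS wR φ r X) {t : ℝ} (ht : t ∈ Set.Icc 0 T) :
    Integrable (fun ξ => (φ t ξ) ^ 2 * (deriv uS (ξ + X t))) ∧ 0 ≤ IA uS φ X t ∧ IA uS φ X t ≤ 1 := by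
  have hm := h.mpos
  have c1 := h.ca t
  have c2 := csx h.sf t
  have hb : ∀ ξ, (φ t ξ) ^ 2 * (deriv uS (ξ + X t)) ≤ (deriv uS (ξ + X t)) := by
    intro ξ
    exact mul_le_of_le_one_left (h.sh.pos _).le (h.psq ht ξ)
  have h0 : ∀ ξ, 0 ≤ (φ t ξ) ^ 2 * (deriv uS (ξ + X t)) := by
    intro ξ
    have := h.sh.pos (ξ + X t)
    positivity
  have hi := dom (by fun_prop) (h.sa t).1 h0 hb
  refine ⟨hi, integral_nonneg h0, ?_⟩
  have e := integral_mono hi (h.sa t).1 hb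
  have := (h.sa t).2
  have := h.ms
  unfold IA
  linarith

lemma strip_sub {f : ℝ × ℝ → ℝ} {t : ℝ} (ht : t ≤ T)
    (hf : ContinuousOn f (Set.Icc 0 T ×ˢ Set.univ)) : ContinuousOn f (Set.Icc 0 t ×ˢ Set.univ) :=
  hf.mono (Set.prod_mono (Set.Icc_subset_Icc_right ht) subset_rfl)

lemma EP_t (h : Sys m τ T ξ0 uS wR φ r X) {t : ℝ} (ht : t ∈ Set.Icc 0 T) : IntervalIntegrable (EP m uS φ X) volume 0 t := by
  refine time_int ht.1 (H := fun t ξ => (W m (uS (ξ + X t))) * ((dx φ t ξ) ^ 2 + (dx (dx φ) t ξ) ^ 2)) (M := 1) ?_ ?_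
  · have c1 := h.kA h.w_c
    have c2 := cst h.sf1
    have c3 := cst h.sf2
    exact Continuous.continuousOn (by fun_prop)
  · intro s hs
    have := (h.EP_i (t := s) ⟨hs.1, hs.2.trans ht.2⟩).2
    rw [abs_le]; unfold EP at this; constructor <;> linarith

lemma ER_t (h : Sys m τ T ξ0 uS wR φ r X) {t : ℝ} (ht : t ∈ Set.Icc 0 T) : IntervalIntegrable (EP m uS r X) volume 0 t := by
  refine time_int ht.1 (H := fun t ξ => (W m (uS (ξ + X t))) * ((dx r t ξ) ^ 2 + (dx (dx r) t ξ) ^ 2)) (M := 1 / τ) ?_ ?_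
  · have c1 := h.kA h.w_c
    have c2 := cst h.sr1
    have c3 := cst h.sr2
    exact Continuous.continuousOn (by fun_prop)
  · intro s hs
    have := (h.ER_i (t := s) ⟨hs.1, hs.2.trans ht.2⟩).2
    rw [abs_le]; unfold EP at this; constructor <;> linarith

lemma ID_t (h : Sys m τ T ξ0 uS wR φ r X) {t : ℝ} (ht : t ∈ Set.Icc 0 T) : IntervalIntegrable (ID m uS wR φ X) volume 0 t := by
  refine time_int ht.1 (H := fun t ξ => (φ t ξ) ^ 2 * (W m (uS (ξ + X t))) * (dx (tuR m wR) t (ξ + X t))) (M := 1) ?_ ?_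
  · have c1 := (h.kA h.w_c).continuousOn (s := Set.Icc 0 t ×ˢ Set.univ)
    have c2 := (cst h.sf).continuousOn (s := Set.Icc 0 t ×ˢ Set.univ)
    have c3 := strip_sub ht.2 (h.kU h.sD)
    exact ((c2.pow 2).mul c1).mul c3
  · intro s hs
    have := (h.ID_i (t := s) ⟨hs.1, hs.2.trans ht.2⟩).2
    rw [abs_le]; unfold ID at this; constructor <;> linarith

lemma IA_t (h : Sys m τ T ξ0 uS wR φ r X) {t : ℝ} (ht : t ∈ Set.Icc 0 T) : IntervalIntegrable (IA uS φ X) volume 0 t := by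
  refine time_int ht.1 (H := fun t ξ => (φ t ξ) ^ 2 * (deriv uS (ξ + X t))) (M := 1) ?_ ?_
  · have c1 := h.kA h.a_c.2.1
    have c2 := cst h.sf
    exact Continuous.continuousOn (by fun_prop)
  · intro s hs
    have := (h.IA_i (t := s) ⟨hs.1, hs.2.trans ht.2⟩).2
    rw [abs_le]; unfold IA at this; constructor <;> linarith

lemma Y_t (h : Sys m τ T ξ0 uS wR φ r X) {t : ℝ} (ht : t ∈ Set.Icc 0 T) :
    IntervalIntegrable (fun s => (deriv X s) ^ 2) volume 0 t := by
  refine ContinuousOn.intervalIntegrable ?_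
  rw [Set.uIcc_of_le ht.1]
  exact (h.Y_cont.mono (Set.Icc_subset_Icc_right ht.2)).pow 2

/-- Time integrand. -/
def JJ (m T : ℝ) (uS : ℝ → ℝ) (wR φ : ℝ → ℝ → ℝ) (X : ℝ → ℝ) (t : ℝ) : ℝ :=
  1000000000 * ((m ^ 2 + N0 T φ + N0 T (dx φ)) * EP m uS φ X t + m ^ 2 * ID m uS wR φ X t
    + m ^ 2 * (m ^ 2 + N0 T φ) * IA uS φ X t + 12 * m ^ 4 * (deriv X t) ^ 2)

lemma N0_nn (φ : ℝ → ℝ → ℝ) : 0 ≤ N0 T φ :=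
  Real.iSup_nonneg fun _ => Real.iSup_nonneg fun _ => Real.iSup_nonneg fun _ => abs_nonneg _

lemma g_int (h : Sys m τ T ξ0 uS wR φ r X) {t : ℝ} (ht : t ∈ Set.Icc 0 T) :
    Integrable (fun ξ => 1000000000 * Gq m (N0 T φ) (N0 T (dx φ)) (φ t ξ) ((dx φ t ξ) ^ 2 + (dx (dx φ) t ξ) ^ 2) (deriv uS (ξ + X t)) (dx (tuR m wR) t (ξ + X t)) (deriv X t)) ∧
    ∫ ξ, 1000000000 * Gq m (N0 T φ) (N0 T (dx φ)) (φ t ξ) ((dx φ t ξ) ^ 2 + (dx (dx φ) t ξ) ^ 2) (deriv uS (ξ + X t)) (dx (tuR m wR) t (ξ + X t)) (deriv X t)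
      ≤ JJ m T uS wR φ X t := by
  have hm := h.mpos
  have hn0 := N0_nn (T := T) φ
  have hn1 := N0_nn (T := T) (dx φ)
  have c0 := csx h.sf t
  have c1 := csx h.sf1 t
  have c2 := csx h.sf2 t
  have c3 := h.cDD ht
  have c4 := h.ca t
  obtain ⟨j1, -, -⟩ := h.EP_i ht
  obtain ⟨j2, -, -⟩ := h.ID_i ht
  obtain ⟨j3, -, -⟩ := h.IA_i ht
  obtain ⟨j4, k4⟩ := h.sa t
  obtain ⟨j5, k5⟩ := h.sDi ht
  have hc : Continuous (fun ξ => 1000000000 * Gq m (N0 T φ) (N0 T (dx φ)) (φ t ξ) ((dx φ t ξ) ^ 2 + (dx (dx φ) t ξ) ^ 2) (deriv uS (ξ + X t)) (dx (tuR m wR) t (ξ + X t)) (deriv X t)) := by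
    unfold Gq; fun_prop
  have hle : ∀ ξ, 1000000000 * Gq m (N0 T φ) (N0 T (dx φ)) (φ t ξ) ((dx φ t ξ) ^ 2 + (dx (dx φ) t ξ) ^ 2) (deriv uS (ξ + X t)) (dx (tuR m wR) t (ξ + X t)) (deriv X t)
      ≤ 1000000000 * ((m ^ 2 + N0 T φ + N0 T (dx φ)) * ((W m (uS (ξ + X t))) * ((dx φ t ξ) ^ 2 + (dx (dx φ) t ξ) ^ 2))
        + m ^ 2 * ((φ t ξ) ^ 2 * (W m (uS (ξ + X t))) * (dx (tuR m wR) t (ξ + X t))) + m ^ 2 * (m ^ 2 + N0 T φ) * ((φ t ξ) ^ 2 * (deriv uS (ξ + X t)))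
        + ((deriv X t) ^ 2 * m ^ 4 * (deriv uS (ξ + X t)) + (deriv X t) ^ 2 * m ^ 2 * (dx (tuR m wR) t (ξ + X t)))) := by
    intro ξ
    have hw : m ^ 2 ≤ (W m (uS (ξ + X t))) := by
      have := (h.w_b (ξ + X t)).1
      have := sq_nonneg m
      linarith
    have d := h.Dp ht ξ
    generalize (W m (uS (ξ + X t))) = w at *
    generalize (dx (tuR m wR) t (ξ + X t)) = D at *
    generalize (deriv uS (ξ + X t)) = a1 at *
    generalize (φ t ξ) = p at *
    generalize (dx φ t ξ) = p1 at *
    generalize (dx (dx φ) t ξ) = p2 at *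
    generalize (deriv X t) = y at *
    generalize N0 T φ = n0 at *
    generalize N0 T (dx φ) = n1 at *
    unfold Gq
    have e1 : m ^ 2 * ((m ^ 2 + n0 + n1) * (p1 ^ 2 + p2 ^ 2)) ≤ w * ((m ^ 2 + n0 + n1) * (p1 ^ 2 + p2 ^ 2)) :=
      mul_le_mul_of_nonneg_right hw (by positivity)
    have e2 : m ^ 2 * (m ^ 2 * (D * p ^ 2)) ≤ w * (m ^ 2 * (D * p ^ 2)) :=
      mul_le_mul_of_nonneg_right hw (by positivity)
    linarith
  have i1 := j1.const_mul (m ^ 2 + N0 T φ + N0 T (dx φ))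
  have i2 := j2.const_mul (m ^ 2)
  have i3 := j3.const_mul (m ^ 2 * (m ^ 2 + N0 T φ))
  have i4 := j4.const_mul ((deriv X t) ^ 2 * m ^ 4)
  have i5 := j5.const_mul ((deriv X t) ^ 2 * m ^ 2)
  have itot := ((((i1.add i2).add i3).add (i4.add i5)).const_mul 1000000000)
  have hi := dom hc itot (fun ξ => mul_nonneg (by norm_num) ((h.pt ht ξ).g0 _)) hle
  refine ⟨hi, (integral_mono hi itot hle).trans ?_⟩
  rw [integral_const_mul]
  have E : (∫ ξ, ((((fun ξ => (m ^ 2 + N0 T φ + N0 T (dx φ)) * ((W m (uS (ξ + X t))) * ((dx φ t ξ) ^ 2 + (dx (dx φ) t ξ) ^ 2)))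
        + fun ξ => m ^ 2 * ((φ t ξ) ^ 2 * (W m (uS (ξ + X t))) * (dx (tuR m wR) t (ξ + X t)))) + fun ξ => m ^ 2 * (m ^ 2 + N0 T φ) * ((φ t ξ) ^ 2 * (deriv uS (ξ + X t))))
        + ((fun ξ => (deriv X t) ^ 2 * m ^ 4 * (deriv uS (ξ + X t))) + fun ξ => (deriv X t) ^ 2 * m ^ 2 * (dx (tuR m wR) t (ξ + X t)))) ξ)
      = (m ^ 2 + N0 T φ + N0 T (dx φ)) * EP m uS φ X t + m ^ 2 * ID m uS wR φ X t
        + m ^ 2 * (m ^ 2 + N0 T φ) * IA uS φ X t + ((deriv X t) ^ 2 * m ^ 4 * (∫ ξ, (deriv uS (ξ + X t))) + (deriv X t) ^ 2 * m ^ 2 * ∫ ξ, (dx (tuR m wR) t (ξ + X t))) := by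
    rw [integral_add' ((i1.add i2).add i3) (i4.add i5), integral_add' (i1.add i2) i3,
      integral_add' i1 i2, integral_add' i4 i5]
    simp only [integral_const_mul]
    rfl
  rw [E]
  unfold JJ
  have f1 := mul_le_mul_of_nonneg_left k4 (by positivity : 0 ≤ (deriv X t) ^ 2 * m ^ 4)
  have f2 := mul_le_mul_of_nonneg_left k5 (by positivity : 0 ≤ (deriv X t) ^ 2 * m ^ 2)
  have f3 : ((deriv X t) ^ 2 * m ^ 4) * m ≤ ((deriv X t) ^ 2 * m ^ 4) * 1 :=
    mul_le_mul_of_nonneg_left (by linarith [h.ms]) (by positivity)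
  linarith

lemma flux (h : Sys m τ T ξ0 uS wR φ r X) {t : ℝ} (ht : t ∈ Set.Icc 0 T) (n : ℕ) (hn : 1 ≤ n) :
    ∫ ξ in (-(n : ℝ))..n, |Fl m τ ξ0 uS wR φ r X t ξ| ≤ (100 * (5 + 1 / τ)) * √n := by
  have hn' : (1 : ℝ) ≤ n := by exact_mod_cast hn
  have hm := h.mpos
  have hτ := h.sh.hτ
  have hq : 1 ≤ √(n : ℝ) := Real.one_le_sqrt.2 hn'
  obtain ⟨i0, i1, i2, i3, i4, i5⟩ := h.ip ht
  obtain ⟨j4, k4⟩ := h.sa t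
  obtain ⟨j5, k5⟩ := h.sDi ht
  have cF : Continuous (Fl m τ ξ0 uS wR φ r X t) := continuous_iff_continuousAt.2 fun ξ => (h.Fl_der ht ξ).continuousAt
  have hle : ∀ ξ, |Fl m τ ξ0 uS wR φ r X t ξ| ≤ 100 * ((dx φ t ξ) ^ 2 + (dx (dx φ) t ξ) ^ 2 + (dx r t ξ) ^ 2 + (dx (dx r) t ξ) ^ 2 + (dx (tuR m wR) t (ξ + X t))
      + (1 + √(n : ℝ)) * (deriv uS (ξ + X t))) + 100 * (1 / √(n : ℝ)) := by
    intro ξ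
    have hp := h.pt ht ξ
    have h1 := hp.fl_b (s := t) rfl (h.th_le ht) (dx (dx φ) t ξ) (dx r t ξ) (dx (dx r) t ξ)
    have h2 := hp.h_b hn
    unfold Fl
    linarith
  have itot := (((((i1.add i2).add i4).add i5).add j5).add (j4.const_mul (1 + √(n : ℝ)))).const_mul 100
  have hn0 : (-(n : ℝ)) ≤ n := by linarith
  have h1 := intervalIntegral.integral_mono_on hn0 (cF.abs.intervalIntegrable _ _)
    (itot.intervalIntegrable.add (intervalIntegrable_const (c := 100 * (1 / √(n : ℝ))))) (fun ξ _ => hle ξ)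
  refine h1.trans ?_
  rw [intervalIntegral.integral_add itot.intervalIntegrable intervalIntegrable_const]
  rw [intervalIntegral.integral_const]
  have h2 : (∫ ξ in (-(n : ℝ))..n, 100 * ((((((fun ξ => (dx φ t ξ) ^ 2) + fun ξ => (dx (dx φ) t ξ) ^ 2) + fun ξ => (dx r t ξ) ^ 2)
      + fun ξ => (dx (dx r) t ξ) ^ 2) + fun ξ => (dx (tuR m wR) t (ξ + X t))) + fun ξ => (1 + √(n : ℝ)) * (deriv uS (ξ + X t))) ξ)
      ≤ ∫ ξ, 100 * ((((((fun ξ => (dx φ t ξ) ^ 2) + fun ξ => (dx (dx φ) t ξ) ^ 2) + fun ξ => (dx r t ξ) ^ 2)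
      + fun ξ => (dx (dx r) t ξ) ^ 2) + fun ξ => (dx (tuR m wR) t (ξ + X t))) + fun ξ => (1 + √(n : ℝ)) * (deriv uS (ξ + X t))) ξ := by
    rw [intervalIntegral.integral_of_le hn0]
    refine setIntegral_le_integral itot (Filter.Eventually.of_forall fun ξ => ?_)
    have := h.Dp ht ξ
    have := h.sh.pos (ξ + X t)
    simp only [Pi.add_apply, Pi.zero_apply]
    positivity
  refine (add_le_add_left h2 _).trans ?_
  rw [integral_const_mul, integral_add' ((((i1.add i2).add i4).add i5).add j5) (j4.const_mul (1 + √(n : ℝ))),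
    integral_add' (((i1.add i2).add i4).add i5) j5, integral_add' ((i1.add i2).add i4) i5,
    integral_add' (i1.add i2) i4, integral_add' i1 i2, integral_const_mul, smul_eq_mul]
  have n1 := (h.nrm ht).1
  have n2 := (h.nrm ht).2
  have z1 : 0 ≤ ∫ ξ, (φ t ξ) ^ 2 := integral_nonneg fun ξ => sq_nonneg _
  have z2 : 0 ≤ ∫ ξ, (r t ξ) ^ 2 := integral_nonneg fun ξ => sq_nonneg _
  have n3 : (∫ ξ, (r t ξ) ^ 2) + (∫ ξ, (dx r t ξ) ^ 2) + (∫ ξ, (dx (dx r) t ξ) ^ 2) ≤ 1 / τ := by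
    rw [le_div_iff₀ hτ]; linarith
  have n4 := mul_le_mul_of_nonneg_left k4 (by positivity : 0 ≤ 1 + √(n : ℝ))
  have n5 : ((n : ℝ) - -n) * (100 * (1 / √(n : ℝ))) = 200 * √(n : ℝ) := by
    have h9 : √(n : ℝ) * √n = n := Real.mul_self_sqrt (by linarith)
    have : √(n : ℝ) ≠ 0 := by positivity
    field_simp
    linarith
  rw [n5]
  have n6 : 1 / τ * 1 ≤ 1 / τ * √(n : ℝ) := mul_le_mul_of_nonneg_left hq (by positivity)
  have n7 : (1 + √(n : ℝ)) * (3 * m) ≤ (1 + √(n : ℝ)) * (1 / 2) :=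
    mul_le_mul_of_nonneg_left (by linarith [h.ms]) (by positivity)
  have n8 := h.m2le
  linarith
end Sys
end

noncomputable section

namespace Sys
variable {m τ T ξ0 : ℝ} {uS : ℝ → ℝ} {wR φ r : ℝ → ℝ → ℝ} {X : ℝ → ℝ}

lemma JJ_t (h : Sys m τ T ξ0 uS wR φ r X) {t : ℝ} (ht : t ∈ Set.Icc 0 T) :
    IntervalIntegrable (JJ m T uS wR φ X) volume 0 t ∧
    ∫ s in (0 : ℝ)..t, JJ m T uS wR φ X s = 1000000000 * ((m ^ 2 + N0 T φ + N0 T (dx φ)) * (∫ s in (0 : ℝ)..t, EP m uS φ X s)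
      + m ^ 2 * (∫ s in (0 : ℝ)..t, ID m uS wR φ X s) + m ^ 2 * (m ^ 2 + N0 T φ) * (∫ s in (0 : ℝ)..t, IA uS φ X s)
      + 12 * m ^ 4 * (∫ s in (0 : ℝ)..t, (deriv X s) ^ 2)) := by
  have i1 := (h.EP_t ht).const_mul (m ^ 2 + N0 T φ + N0 T (dx φ))
  have i2 := (h.ID_t ht).const_mul (m ^ 2)
  have i3 := (h.IA_t ht).const_mul (m ^ 2 * (m ^ 2 + N0 T φ))
  have i4 := (h.Y_t ht).const_mul (12 * m ^ 4)
  refine ⟨(((i1.add i2).add i3).add i4).const_mul 1000000000, ?_⟩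
  unfold JJ
  rw [intervalIntegral.integral_const_mul, intervalIntegral.integral_add ((i1.add i2).add i3) i4,
    intervalIntegral.integral_add (i1.add i2) i3, intervalIntegral.integral_add i1 i2]
  simp only [intervalIntegral.integral_const_mul]

lemma eh_i (h : Sys m τ T ξ0 uS wR φ r X) {t : ℝ} (ht : t ∈ Set.Icc 0 T) :
    Integrable (fun ξ => 1 / 2 * ((W m (uS (ξ + X t))) * ((dx φ t ξ) ^ 2 + (dx (dx φ) t ξ) ^ 2)) + τ * (1 / 4 * ((W m (uS (ξ + X t))) * ((dx r t ξ) ^ 2 + (dx (dx r) t ξ) ^ 2))) - m * (dx (tuR m wR) t (ξ + X t))) ∧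
    1 / 2 * EP m uS φ X t + τ / 4 * EP m uS r X t - 9 * m ^ 3 ≤
    ∫ ξ, (1 / 2 * ((W m (uS (ξ + X t))) * ((dx φ t ξ) ^ 2 + (dx (dx φ) t ξ) ^ 2)) + τ * (1 / 4 * ((W m (uS (ξ + X t))) * ((dx r t ξ) ^ 2 + (dx (dx r) t ξ) ^ 2))) - m * (dx (tuR m wR) t (ξ + X t))) := by
  have i1 := (h.EP_i ht).1.const_mul (1 / 2)
  have i2 := ((h.ER_i ht).1.const_mul (1 / 4)).const_mul τ
  have i3 := (h.sDi ht).1.const_mul m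
  refine ⟨(i1.add i2).sub i3, ?_⟩
  have E := integral_sub' (i1.add i2) i3
  rw [integral_add' i1 i2] at E
  refine le_of_le_of_eq ?_ E.symm
  simp only [integral_const_mul]
  have := mul_le_mul_of_nonneg_left (h.sDi ht).2 h.mpos.le
  unfold EP
  linarith

lemma et_i (h : Sys m τ T ξ0 uS wR φ r X) {t : ℝ} (ht : t ∈ Set.Icc 0 T) :
    Integrable (fun ξ => 15 / 2 * m ^ 2 * ((dx φ t ξ) ^ 2 + (dx (dx φ) t ξ) ^ 2 + (dx r t ξ) ^ 2 + (dx (dx r) t ξ) ^ 2) + 7000 * m * (dx (tuR m wR) t (ξ + X t)) + m ^ 2 * (deriv uS (ξ + X t))) ∧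
    (∫ ξ, (15 / 2 * m ^ 2 * ((dx φ t ξ) ^ 2 + (dx (dx φ) t ξ) ^ 2 + (dx r t ξ) ^ 2 + (dx (dx r) t ξ) ^ 2) + 7000 * m * (dx (tuR m wR) t (ξ + X t)) + m ^ 2 * (deriv uS (ξ + X t))))
    ≤ 15 / 2 * m ^ 2 * ((∫ ξ, (dx φ t ξ) ^ 2) + (∫ ξ, (dx (dx φ) t ξ) ^ 2) + (∫ ξ, (dx r t ξ) ^ 2) + ∫ ξ, (dx (dx r) t ξ) ^ 2) + 63003 * m ^ 3 := by
  obtain ⟨-, a1, a2, -, a3, a4⟩ := h.ip ht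
  have i1 := (((a1.add a2).add a3).add a4).const_mul (15 / 2 * m ^ 2)
  have i2 := (h.sDi ht).1.const_mul (7000 * m)
  have i3 := (h.sa t).1.const_mul (m ^ 2)
  refine ⟨(i1.add i2).add i3, ?_⟩
  have E := integral_add' (i1.add i2) i3
  rw [integral_add' i1 i2] at E
  refine (le_of_eq E).trans ?_
  simp only [integral_const_mul]
  rw [integral_add' ((a1.add a2).add a3) a4, integral_add' (a1.add a2) a3, integral_add' a1 a2]
  have hm := h.mpos
  have e1 := mul_le_mul_of_nonneg_left (h.sDi ht).2 (by positivity : 0 ≤ 7000 * m)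
  have e2 := mul_le_mul_of_nonneg_left (h.sa t).2 (by positivity : 0 ≤ m ^ 2)
  linarith

lemma main (h : Sys m τ T ξ0 uS wR φ r X) {t : ℝ} (ht : t ∈ Set.Icc 0 T) :
    1 / 2 * EP m uS φ X t + τ / 4 * EP m uS r X t - 9 * m ^ 3 + 1 / 4 * (∫ s in (0 : ℝ)..t, EP m uS r X s)
    ≤ 15 / 2 * m ^ 2 * ((∫ ξ, dx φ 0 ξ ^ 2) + (∫ ξ, dx (dx φ) 0 ξ ^ 2) + (∫ ξ, dx r 0 ξ ^ 2)
      + ∫ ξ, dx (dx r) 0 ξ ^ 2) + 63003 * m ^ 3 + ∫ s in (0 : ℝ)..t, JJ m T uS wR φ X s := by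
  have hm := h.mpos
  have hτ := h.sh.hτ
  have h0 : (0 : ℝ) ∈ Set.Icc 0 T := ⟨le_rfl, h.T0⟩
  have sub : ∀ s ∈ Set.Icc 0 t, s ∈ Set.Icc 0 T := fun s hs => ⟨hs.1, hs.2.trans ht.2⟩
  have key := cutoff ht.1 (e := En m τ ξ0 uS wR φ r X) (F := Fl m τ ξ0 uS wR φ r X) (Fx := Flx m τ ξ0 uS wR φ r X) (R := Rs m τ ξ0 uS wR φ r X)
    (q := fun t ξ => 1 / 4 * ((W m (uS (ξ + X t))) * ((dx r t ξ) ^ 2 + (dx (dx r) t ξ) ^ 2)))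
    (g := fun t ξ => 1000000000 * Gq m (N0 T φ) (N0 T (dx φ)) (φ t ξ) ((dx φ t ξ) ^ 2 + (dx (dx φ) t ξ) ^ 2) (deriv uS (ξ + X t)) (dx (tuR m wR) t (ξ + X t)) (deriv X t))
    (J := JJ m T uS wR φ X)
    (eh := fun ξ => 1 / 2 * ((W m (uS (ξ + X t))) * ((dx φ t ξ) ^ 2 + (dx (dx φ) t ξ) ^ 2)) + τ * (1 / 4 * ((W m (uS (ξ + X t))) * ((dx r t ξ) ^ 2 + (dx (dx r) t ξ) ^ 2))) - m * (dx (tuR m wR) t (ξ + X t)))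
    (et := (fun t ξ => 15 / 2 * m ^ 2 * ((dx φ t ξ) ^ 2 + (dx (dx φ) t ξ) ^ 2 + (dx r t ξ) ^ 2 + (dx (dx r) t ξ) ^ 2) + 7000 * m * (dx (tuR m wR) t (ξ + X t)) + m ^ 2 * (deriv uS (ξ + X t))) 0)
    (Cf := 100 * (5 + 1 / τ)) (M := 1 / τ)
    (fun s hs x => h.En_der (sub s hs) x) (fun s hs x => h.Fl_der (sub s hs) x)
    (strip_sub ht.2 h.Flx_c) (strip_sub ht.2 h.Rs_c) (h.En_c ht) (h.En_c h0)
    (by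
      have c1 := h.kA h.w_c
      have c2 := cst h.sr1
      have c3 := cst h.sr2
      fun_prop)
    (fun s hs x => (h.pt (sub s hs) x).res_q _ _ _)
    (fun s hs x => by
      have := (h.w_b (x + X s)).1
      have : 0 ≤ W m (uS (x + X s)) := le_trans (by positivity) this
      positivity)
    (fun s hs x => mul_nonneg (by norm_num) ((h.pt (sub s hs) x).g0 _))
    (fun s hs => (h.ER_i (sub s hs)).1.const_mul _) (fun s hs => (h.g_int (sub s hs)).1)
    (fun s hs => by
      have := (h.ER_i (sub s hs)).2
      unfold EP at this
      rw [integral_const_mul]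
      linarith)
    (fun s hs => (h.g_int (sub s hs)).2) (h.JJ_t ht).1
    (fun s hs n hn => h.flux (sub s hs) n hn)
    (fun x => (h.pt ht x).en_lo rfl _ _ _) (h.eh_i ht).1
    (fun x => (h.pt h0 x).en_hi rfl (h.th_le h0) _ _ _)
    (fun x => by
      have := h.Dp h0 x
      have := (h.pt h0 x).a1p
      dsimp only
      positivity) (h.et_i h0).1
  have e1 := (h.eh_i ht).2
  have e2 := (h.et_i h0).2
  simp only [integral_const_mul, intervalIntegral.integral_const_mul] at key
  unfold EP at e1 ⊢
  linarith

lemma EW_eq (f : ℝ → ℝ → ℝ) (t : ℝ)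
    (i1 : Integrable (fun ξ => W m (uS (ξ + X t)) * dx f t ξ ^ 2))
    (i2 : Integrable (fun ξ => W m (uS (ξ + X t)) * dx (dx f) t ξ ^ 2)) :
    EW m uS (shiftNeg f X t) = EP m uS f X t := by
  unfold EW EP
  have hs : shiftNeg f X t = fun z => f t (z - X t) := rfl
  simp only [mul_add]
  rw [integral_add i1 i2, hs, iteratedDeriv_comp_sub_const]
  congr 1
  · rw [← integral_add_right_eq_self _ (X t)]
    refine integral_congr_ae (Filter.Eventually.of_forall fun x => ?_)
    simp only [deriv_comp_sub_const, add_sub_cancel_right]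
    exact mul_comm _ _
  · rw [← integral_add_right_eq_self _ (X t)]
    refine integral_congr_ae (Filter.Eventually.of_forall fun x => ?_)
    simp only [add_sub_cancel_right, dx_dx_eq]
    exact mul_comm _ _

lemma wi (h : Sys m τ T ξ0 uS wR φ r X) {t : ℝ} {f : ℝ → ℝ} (hf : Continuous f) (i : Integrable (fun x => f x ^ 2)) :
    Integrable (fun ξ => (W m (uS (ξ + X t))) * f ξ ^ 2) := by
  have c := h.cw t
  refine dom (by fun_prop) (i.const_mul (15 / 2 * m ^ 2)) (fun x => ?_) (fun x => ?_)
  · exact mul_nonneg (le_trans (by positivity) (h.w_b _).1) (sq_nonneg _)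
  · exact mul_le_mul_of_nonneg_right (h.w_b _).2 (sq_nonneg _)

lemma EWp (h : Sys m τ T ξ0 uS wR φ r X) {t : ℝ} (ht : t ∈ Set.Icc 0 T) : EW m uS (shiftNeg φ X t) = EP m uS φ X t :=
  EW_eq φ t (h.wi (csx h.sf1 t) (h.ip ht).2.1) (h.wi (csx h.sf2 t) (h.ip ht).2.2.1)

lemma EWr (h : Sys m τ T ξ0 uS wR φ r X) {t : ℝ} (ht : t ∈ Set.Icc 0 T) : EW m uS (shiftNeg r X t) = EP m uS r X t :=
  EW_eq r t (h.wi (csx h.sr1 t) (h.ip ht).2.2.2.2.1) (h.wi (csx h.sr2 t) (h.ip ht).2.2.2.2.2)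

lemma ID_eq (t : ℝ) : ∫ ξ, (shiftNeg φ X t ξ) ^ 2 * W m (uS ξ) * deriv (tuR m wR t) ξ = ID m uS wR φ X t := by
  rw [← integral_add_right_eq_self _ (X t)]
  simp only [shiftNeg, add_sub_cancel_right]
  rfl

lemma IA_eq (t : ℝ) : ∫ ξ, (shiftNeg φ X t ξ) ^ 2 * deriv uS ξ = IA uS φ X t := by
  rw [← integral_add_right_eq_self _ (X t)]
  simp only [shiftNeg, add_sub_cancel_right]
  rfl

lemma rt {m : ℝ} (h0 : 0 < m) (h1 : m ≤ 1) : m ≤ ((3 * m) ^ 2) ^ ((1 : ℝ) / 6) := by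
  have e : (m ^ 6) ^ ((1 : ℝ) / 6) = m := by
    rw [← Real.rpow_natCast, ← Real.rpow_mul h0.le]; norm_num
  calc m = (m ^ 6) ^ ((1 : ℝ) / 6) := e.symm
    _ ≤ _ := by
      refine Real.rpow_le_rpow (by positivity) ?_ (by norm_num)
      have : m ^ 6 ≤ m ^ 2 := pow_le_pow_of_le_one h0.le h1 (by norm_num)
      have := sq_nonneg m
      linarith

lemma final (h : Sys m τ T ξ0 uS wR φ r X) {t : ℝ} (ht : t ∈ Set.Icc 0 T) :
          EW m uS (shiftNeg φ X t) + τ * EW m uS (shiftNeg r X t)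
              + (∫ s in (0:ℝ)..t, EW m uS (shiftNeg r X s))
            ≤ 1000000000000 * m ^ 2 *
                ((∫ ξ : ℝ, (deriv (φ 0) ξ) ^ 2)
                  + (∫ ξ : ℝ, (iteratedDeriv 2 (φ 0) ξ) ^ 2)
                  + (∫ ξ : ℝ, (deriv (r 0) ξ) ^ 2)
                  + (∫ ξ : ℝ, (iteratedDeriv 2 (r 0) ξ) ^ 2))
              + (m ^ 2 / 27) * (∫ s in (0:ℝ)..t, |deriv X s| ^ 2)
              + (1000000000000 * m ^ 3 + 1000000000000 * ((3 * m) ^ 2)) *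
                  (∫ s in (0:ℝ)..t, ∫ ξ : ℝ,
                    (shiftNeg φ X s ξ) ^ 2 * W m (uS ξ) * deriv (tuR m wR s) ξ)
              + (1000000000000 * m ^ 3
                    + (1000000000000 * ((3 * m) ^ 2)
                      + 1000000000000 * N0 T φ)) * m ^ 2 *
                  (∫ s in (0:ℝ)..t, ∫ ξ : ℝ, (shiftNeg φ X s ξ) ^ 2 * deriv uS ξ)
              + (1000000000000 * m ^ 2
                    + (1000000000000 * ((3 * m) ^ 2)
                      + 1000000000000 * N0 T φ)
                    + 1000000000000 * N0 T (dx φ)) *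
                  (∫ s in (0:ℝ)..t, EW m uS (shiftNeg φ X s))
              + 1000000000000 * m ^ 2 * ((3 * m) ^ 2) ^ ((1:ℝ) / 6) := by
  have hm := h.mpos
  have hm2 := h.m2le
  have sub : ∀ s ∈ Set.uIcc 0 t, s ∈ Set.Icc 0 T := fun s hs => by
    rw [Set.uIcc_of_le ht.1] at hs
    exact ⟨hs.1, hs.2.trans ht.2⟩
  have sub2 : ∀ s ∈ Set.Icc 0 t, s ∈ Set.Icc 0 T := fun s hs => ⟨hs.1, hs.2.trans ht.2⟩
  rw [h.EWp ht, h.EWr ht,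
    intervalIntegral.integral_congr (fun s hs => h.EWr (sub s hs)),
    intervalIntegral.integral_congr (g := EP m uS φ X) (fun s hs => h.EWp (sub s hs))]
  simp only [ID_eq, IA_eq, sq_abs, ← dx_dx_eq]
  have key := h.main ht
  rw [(h.JJ_t ht).2] at key
  have p1 : 0 ≤ ∫ s in (0 : ℝ)..t, EP m uS φ X s :=
    intervalIntegral.integral_nonneg ht.1 fun s hs => (h.EP_i (sub2 s hs)).2.1
  have p2 : 0 ≤ ∫ s in (0 : ℝ)..t, ID m uS wR φ X s :=
    intervalIntegral.integral_nonneg ht.1 fun s hs => (h.ID_i (sub2 s hs)).2.1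
  have p3 : 0 ≤ ∫ s in (0 : ℝ)..t, IA uS φ X s :=
    intervalIntegral.integral_nonneg ht.1 fun s hs => (h.IA_i (sub2 s hs)).2.1
  have p4 : 0 ≤ ∫ s in (0 : ℝ)..t, (deriv X s) ^ 2 :=
    intervalIntegral.integral_nonneg ht.1 fun s hs => sq_nonneg _
  have p5 := (h.EP_i ht).2.1
  have q1 : 0 ≤ ∫ ξ, dx φ 0 ξ ^ 2 := integral_nonneg fun _ => sq_nonneg _
  have q2 : 0 ≤ ∫ ξ, dx (dx φ) 0 ξ ^ 2 := integral_nonneg fun _ => sq_nonneg _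
  have q3 : 0 ≤ ∫ ξ, dx r 0 ξ ^ 2 := integral_nonneg fun _ => sq_nonneg _
  have q4 : 0 ≤ ∫ ξ, dx (dx r) 0 ξ ^ 2 := integral_nonneg fun _ => sq_nonneg _
  change _ ≤ 1000000000000 * m ^ 2 * ((∫ ξ, dx φ 0 ξ ^ 2) + (∫ ξ, dx (dx φ) 0 ξ ^ 2)
    + (∫ ξ, dx r 0 ξ ^ 2) + ∫ ξ, dx (dx r) 0 ξ ^ 2) + _ + _ + _ + _ + _
  have hn0 := N0_nn (T := T) φ
  have hn1 := N0_nn (T := T) (dx φ)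
  have hr := rt hm (by linarith [h.ms] : m ≤ 1)
  have hr2 := mul_le_mul_of_nonneg_left hr (by positivity : 0 ≤ 1000000000000 * m ^ 2)
  generalize ((3 * m) ^ 2) ^ ((1:ℝ) / 6) = R at *
  generalize (∫ s in (0 : ℝ)..t, EP m uS φ X s) = P1 at *
  generalize (∫ s in (0 : ℝ)..t, EP m uS r X s) = PR at *
  generalize (∫ s in (0 : ℝ)..t, ID m uS wR φ X s) = P2 at *
  generalize (∫ s in (0 : ℝ)..t, IA uS φ X s) = P3 at *
  generalize (∫ s in (0 : ℝ)..t, (deriv X s) ^ 2) = P4 at *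
  generalize EP m uS φ X t = A at *
  generalize EP m uS r X t = Br at *
  generalize N0 T φ = n0 at *
  generalize N0 T (dx φ) = n1 at *
  generalize (∫ ξ, dx φ 0 ξ ^ 2) = Q1 at *
  generalize (∫ ξ, dx (dx φ) 0 ξ ^ 2) = Q2 at *
  generalize (∫ ξ, dx r 0 ξ ^ 2) = Q3 at *
  generalize (∫ ξ, dx (dx r) 0 ξ ^ 2) = Q4 at *
  have s0 : 0 ≤ m ^ 2 * (Q1 + Q2 + Q3 + Q4) := by positivity
  have s1 : 0 ≤ (m ^ 2 + n0 + n1) * P1 := by positivity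
  have s2 : 0 ≤ m ^ 2 * P1 := by positivity
  have s3 : 0 ≤ m ^ 2 * P2 := by positivity
  have s4 : 0 ≤ m ^ 3 * P2 := by positivity
  have s5 : 0 ≤ m ^ 2 * (m ^ 2 + n0) * P3 := by positivity
  have s6 : 0 ≤ m ^ 3 * m ^ 2 * P3 := by positivity
  have s7 : 0 ≤ m ^ 2 * m ^ 2 * P3 := by positivity
  have s8 : m ^ 2 * (m ^ 2 * P4) ≤ 1 / 10 ^ 16 * (m ^ 2 * P4) :=
    mul_le_mul_of_nonneg_right hm2 (by positivity)
  have s9 : 0 ≤ m ^ 2 * P4 := by positivity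
  have s10 : 0 ≤ m ^ 3 := by positivity
  linarith
end Sys

end

/-- high-order weighted energy estimates. -/
theorem stmt_17 :
    ∃ δ₀ > (0:ℝ), ∃ ε₃ > (0:ℝ), ∃ C > (0:ℝ),
      ∀ (um τ uplus T : ℝ) (uS : ℝ → ℝ) (wR φ r : ℝ → ℝ → ℝ) (X : ℝ → ℝ),
        0 < um → 0 < τ →
        τ ≤ min (1 / (63 * (3 * um ^ 2) * (-2 * um) ^ 2)) (8 / 7785) →
        um < uplus → uplus - um = (3 * um) ^ 2 →
        3 * um ≤ δ₀ → 0 ≤ T →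
        IsShockProfile um τ uS →
        BurgersSol (3 * uplus ^ 2) (3 * um ^ 2) wR →
        PerturbSol um τ T uS wR φ r X →
        (∀ t ∈ Set.Icc 0 T,
          Real.sqrt (HnormSq 2 (φ t)) + Real.sqrt τ * Real.sqrt (HnormSq 2 (r t)) ≤ ε₃) →
        ∀ t ∈ Set.Icc 0 T,
          EW um uS (shiftNeg φ X t) + τ * EW um uS (shiftNeg r X t)
              + (∫ s in (0:ℝ)..t, EW um uS (shiftNeg r X s))
            ≤ C * um ^ 2 *
                ((∫ ξ : ℝ, (deriv (φ 0) ξ) ^ 2)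
                  + (∫ ξ : ℝ, (iteratedDeriv 2 (φ 0) ξ) ^ 2)
                  + (∫ ξ : ℝ, (deriv (r 0) ξ) ^ 2)
                  + (∫ ξ : ℝ, (iteratedDeriv 2 (r 0) ξ) ^ 2))
              + (um ^ 2 / 27) * (∫ s in (0:ℝ)..t, |deriv X s| ^ 2)
              + (C * um ^ 3 + C * (uplus - um)) *
                  (∫ s in (0:ℝ)..t, ∫ ξ : ℝ,
                    (shiftNeg φ X s ξ) ^ 2 * W um (uS ξ) * deriv (tuR um wR s) ξ)
              + (C * um ^ 3
                    + (C * (uplus - um)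
                      + C * ⨆ a ∈ Set.Icc (0:ℝ) T, ⨆ ξ : ℝ, |φ a ξ|)) * um ^ 2 *
                  (∫ s in (0:ℝ)..t, ∫ ξ : ℝ, (shiftNeg φ X s ξ) ^ 2 * deriv uS ξ)
              + (C * um ^ 2
                    + (C * (uplus - um)
                      + C * ⨆ a ∈ Set.Icc (0:ℝ) T, ⨆ ξ : ℝ, |φ a ξ|)
                    + C * ⨆ a ∈ Set.Icc (0:ℝ) T, ⨆ ξ : ℝ, |deriv (φ a) ξ|) *
                  (∫ s in (0:ℝ)..t, EW um uS (shiftNeg φ X s))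
              + C * um ^ 2 * (uplus - um) ^ ((1:ℝ) / 6) := by
  refine ⟨3 / 10 ^ 8, by norm_num, 1 / 2, by norm_num, 1000000000000, by norm_num, ?_⟩
  intro m τ uplus T uS wR φ r X hm hτ hτ2 _ hup hd hT hS hB hP he t ht
  have e1 : τ ≤ 1 / (63 * (3 * m ^ 2) * (-2 * m) ^ 2) := hτ2.trans (min_le_left _ _)
  have e2 : τ ≤ 8 / 7785 := hτ2.trans (min_le_right _ _)
  have hu : uplus = m + 9 * m ^ 2 := by linarith
  have ms : m ≤ 1 / 10 ^ 8 := by linarith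
  have hτm : τ * m ^ 4 ≤ 1 / 756 := by
    rw [le_div_iff₀ (by positivity)] at e1
    linarith
  have sh : Shock m τ uS := ⟨hm, hτ, hτm, hS⟩
  have ra : Rare m wR := ⟨hm, by linarith, hu ▸ hB⟩
  obtain ⟨ξ0, z0⟩ := sh.exists_zero
  have h : Sys m τ T ξ0 uS wR φ r X := ⟨sh, ra, ms, by linarith, hT, z0, hP, he⟩
  have := h.final ht
  rw [hup]
  exact this
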